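/- arXiv:2403.00392 — 5 statements merged into one kernel-verified Lean document; each statement's English description precedes it below -/
import Mathlib

section
/- A graph G=(V,E) is sparse if and only if its edge map E_G : (ℂ²)^V → ℂ^E is dominant, i.e. if and only if the image of E_G is Zariski dense in ℂ^E: for every nonzero polynomial F in the variables (x_e)_{e∈E} over ℂ there exists a realization r ∈ (ℂ²)^V with F(E_G(r)) ≠ 0. -/
open scoped Classical

noncomputable section

/-- The squared distance function on `ℂ²`. -/
def sd (x y : ℂ × ℂ) : ℂ := (x.1 - y.1) ^ 2 + (x.2 - y.2) ^ 2

/-- Membership in the transformation group `T`. -/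
def IsTransf (t : ℂ × ℂ → ℂ × ℂ) : Prop :=
  ∃ c s u v : ℂ, c ^ 2 + s ^ 2 = 1 ∧
    ∀ x, t x = (c * x.1 - s * x.2 + u, s * x.1 + c * x.2 + v)

variable {α : Type*} [DecidableEq α]

/-- `(V, E)` is a finite simple undirected graph: edges are non-diagonal
unordered pairs with both endpoints in `V`. -/
def IsGraph (V : Finset α) (E : Finset (Sym2 α)) : Prop :=
  ∀ e ∈ E, ¬ e.IsDiag ∧ ∀ v ∈ e, v ∈ V

/-- `(V', E')` is a subgraph of `(V, E)`. -/
def IsSubgraph (V' : Finset α) (E' : Finset (Sym2 α))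
    (V : Finset α) (E : Finset (Sym2 α)) : Prop :=
  IsGraph V' E' ∧ V' ⊆ V ∧ E' ⊆ E

/-- A graph is sparse if every subgraph `(V', E')` with `|V'| ≥ 2`
satisfies `|E'| ≤ 2|V'| - 3`. -/
def IsSparse (V : Finset α) (E : Finset (Sym2 α)) : Prop :=
  IsGraph V E ∧ ∀ V' E', IsSubgraph V' E' V E → 2 ≤ V'.card →
    (E'.card : ℤ) ≤ 2 * V'.card - 3

/-- A graph is tight if it is sparse and `|V| = 1` or `|E| = 2|V| - 3`. -/
def IsTight (V : Finset α) (E : Finset (Sym2 α)) : Prop :=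
  IsSparse V E ∧ (V.card = 1 ∨ (E.card : ℤ) = 2 * V.card - 3)

/-- `(V', E')` is a max-tight subgraph of `(V, E)`. -/
def IsMaxTight (V' : Finset α) (E' : Finset (Sym2 α))
    (V : Finset α) (E : Finset (Sym2 α)) : Prop :=
  IsSubgraph V' E' V E ∧ IsTight V' E' ∧
    ∀ V'' E'', IsSubgraph V'' E'' V E → IsTight V'' E'' →
      V' ⊆ V'' → E' ⊆ E'' → V' = V'' ∧ E' = E''

/-- `{(Vi i, Ei i)}_{i ∈ I}` is a max-tight decomposition of `(V, E)`. -/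
def IsMaxTightDecomp {I : Type*} (V : Finset α) (E : Finset (Sym2 α))
    (Vi : I → Finset α) (Ei : I → Finset (Sym2 α)) : Prop :=
  (∀ i, IsMaxTight (Vi i) (Ei i) V E) ∧
  (∀ v ∈ V, ∃ i, v ∈ Vi i) ∧
  (∀ e ∈ E, ∃ i, e ∈ Ei i) ∧
  (∀ i j, i ≠ j → ∀ e, ¬ (e ∈ Ei i ∧ e ∈ Ei j))

/-- Extend a realization of `V` to all of `α` (by zero off `V`). -/
def extendR (V : Finset α) (r : ↥V → ℂ × ℂ) : α → ℂ × ℂ :=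
  fun a => if h : a ∈ V then r ⟨a, h⟩ else 0

/-- The squared distance along an unordered pair of vertices. -/
def edgeVal (r : α → ℂ × ℂ) : Sym2 α → ℂ :=
  Sym2.lift ⟨fun u v => sd (r u) (r v), fun u v => by simp only [sd]; ring⟩

/-- The edge map `E_G : (ℂ²)^V → ℂ^E`. -/
def edgeMap (V : Finset α) (E : Finset (Sym2 α)) (r : ↥V → ℂ × ℂ) :
    {e // e ∈ E} → ℂ :=
  fun e => edgeVal (extendR V r) e.1

/-- The set `E_G⁻¹(λ)` of `λ`-compatible realizations. -/
def fiber (V : Finset α) (E : Finset (Sym2 α)) (lam : {e // e ∈ E} → ℂ) :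
    Set (↥V → ℂ × ℂ) :=
  {r | edgeMap V E r = lam}

/-- The set of equivalence classes of `S` under `r ∼ s ↔ ∃ t ∈ T, s = t ∘ r`. -/
def TClasses {β : Type*} (S : Set (β → ℂ × ℂ)) : Set (Set (β → ℂ × ℂ)) :=
  {C | ∃ r ∈ S, C = {s | s ∈ S ∧ ∃ t, IsTransf t ∧ s = fun v => t (r v)}}

/-- The coordinates of a realization, as a point of affine space with
coordinate ring `ℂ[x_v, y_v : v ∈ β]`. -/
def coords {β : Type*} (r : β → ℂ × ℂ) : β × Fin 2 → ℂ :=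
  fun p => if p.2 = 0 then (r p.1).1 else (r p.1).2

/-- The vanishing ideal of a set of realizations in `ℂ[x_v, y_v : v ∈ β]`. -/
def vanishingIdeal {β : Type*} (S : Set (β → ℂ × ℂ)) :
    Ideal (MvPolynomial (β × Fin 2) ℂ) where
  carrier := {f | ∀ r ∈ S, MvPolynomial.eval (coords r) f = 0}
  add_mem' := by
    intro a b ha hb r hr
    simp only [Set.mem_setOf_eq] at ha hb ⊢
    simp [map_add, ha r hr, hb r hr]
  zero_mem' := by intro r hr; simp
  smul_mem' := by
    intro c f hf r hr
    simp only [Set.mem_setOf_eq] at hf ⊢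
    simp [smul_eq_mul, map_mul, hf r hr]

end

/-- A loopless edge set in which every vertex set `X` with at least two elements spans at most
`2|X| - 3` edges. -/
def LamanSparse {β : Type*} [DecidableEq β] (E : Finset (Sym2 β)) : Prop :=
  (∀ e ∈ E, ¬ e.IsDiag) ∧ ∀ X : Finset β, 2 ≤ X.card → (E ∩ X.sym2).card + 3 ≤ 2 * X.card

section Combinatorics

variable {β : Type*} [DecidableEq β]

theorem LamanSparse.mono {E E' : Finset (Sym2 β)} (hE : LamanSparse E) (h : E' ⊆ E) :
    LamanSparse E' :=
  ⟨fun e he => hE.1 e (h he), fun X hX =>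
    (Nat.add_le_add_right (Finset.card_le_card (Finset.inter_subset_inter_right h)) 3).trans
      (hE.2 X hX)⟩

theorem card_inter_sym2_supermodular (E : Finset (Sym2 β)) (X Y : Finset β) :
    (E ∩ X.sym2).card + (E ∩ Y.sym2).card ≤
      (E ∩ (X ∪ Y).sym2).card + (E ∩ (X ∩ Y).sym2).card := by
  rw [← Finset.card_union_add_card_inter]
  refine Nat.add_le_add (Finset.card_le_card ?_) (Finset.card_le_card ?_)
  · intro e
    simp only [Finset.mem_union, Finset.mem_inter, Finset.mem_sym2_iff]
    rintro (⟨h, h'⟩ | ⟨h, h'⟩)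
    · exact ⟨h, fun a ha => Or.inl (h' a ha)⟩
    · exact ⟨h, fun a ha => Or.inr (h' a ha)⟩
  · intro e
    simp only [Finset.mem_inter, Finset.mem_sym2_iff]
    rintro ⟨⟨h, h1⟩, _, h2⟩
    exact ⟨h, fun a ha => ⟨h1 a ha, h2 a ha⟩⟩

theorem LamanSparse.inter_sym2_eq_empty {E : Finset (Sym2 β)} (hE : LamanSparse E)
    {X : Finset β} (hX : X.card ≤ 1) : E ∩ X.sym2 = ∅ := by
  rw [Finset.eq_empty_iff_forall_notMem]
  intro e he
  obtain ⟨h1, h2⟩ := Finset.mem_inter.1 he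
  rw [Finset.mem_sym2_iff] at h2
  induction e with
  | _ u v =>
    exact hE.1 _ h1 (Sym2.mk_isDiag_iff.2 (Finset.card_le_one.1 hX u (h2 u (by simp)) v
      (h2 v (by simp))))

/-- Two vertices are linked if both lie in a vertex set spanning the maximal number of edges
allowed by sparsity. -/
def TightlyLinked (E : Finset (Sym2 β)) (a b : β) : Prop :=
  ∃ X : Finset β, a ∈ X ∧ b ∈ X ∧ 2 * X.card ≤ (E ∩ X.sym2).card + 3

theorem LamanSparse.insert_of_not_tightlyLinked {E : Finset (Sym2 β)} (hE : LamanSparse E)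
    {a b : β} (hab : a ≠ b) (h : ¬ TightlyLinked E a b) :
    s(a, b) ∉ E ∧ LamanSparse (insert s(a, b) E) := by
  constructor
  · intro hmem
    refine h ⟨{a, b}, by simp, by simp, ?_⟩
    have : 0 < (E ∩ ({a, b} : Finset β).sym2).card :=
      Finset.card_pos.2 ⟨s(a, b), by simp [hmem]⟩
    rw [Finset.card_pair hab]
    omega
  · refine ⟨fun e he => ?_, fun X hX => ?_⟩
    · rcases Finset.mem_insert.1 he with rfl | he
      · simpa using hab
      · exact hE.1 e he
    · by_cases hX' : a ∈ X ∧ b ∈ X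
      · have h1 : ¬ 2 * X.card ≤ (E ∩ X.sym2).card + 3 := fun h' => h ⟨X, hX'.1, hX'.2, h'⟩
        have h2 : (insert s(a, b) E ∩ X.sym2).card ≤ (E ∩ X.sym2).card + 1 := by
          refine le_trans (Finset.card_le_card (t := insert s(a, b) (E ∩ X.sym2)) ?_)
            (Finset.card_insert_le _ _)
          intro e
          simp only [Finset.mem_inter, Finset.mem_insert]
          tauto
        omega
      · have : insert s(a, b) E ∩ X.sym2 = E ∩ X.sym2 :=
          Finset.insert_inter_of_notMem (by simpa using hX')
        rw [this]
        exact hE.2 X hX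

/-- Three pairwise linked vertices lie in a common tight set. -/
theorem LamanSparse.exists_tight_of_tightlyLinked {E : Finset (Sym2 β)} (hE : LamanSparse E)
    {a b c : β} (hca : a ≠ c) (hab : TightlyLinked E a b)
    (hbc : TightlyLinked E b c) (hac : TightlyLinked E a c) :
    ∃ X : Finset β, a ∈ X ∧ b ∈ X ∧ c ∈ X ∧ 2 * X.card ≤ (E ∩ X.sym2).card + 3 := by
  have glue : ∀ X Y : Finset β, 2 ≤ (X ∩ Y).card → 2 * X.card ≤ (E ∩ X.sym2).card + 3 →
      2 * Y.card ≤ (E ∩ Y.sym2).card + 3 →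
      2 * (X ∪ Y).card ≤ (E ∩ (X ∪ Y).sym2).card + 3 := by
    intro X Y h hX hY
    have h1 := card_inter_sym2_supermodular E X Y
    have h2 := hE.2 _ h
    have h3 := Finset.card_union_add_card_inter X Y
    omega
  obtain ⟨X, haX, hbX, hX⟩ := hab
  obtain ⟨Y, hbY, hcY, hY⟩ := hbc
  obtain ⟨Z, haZ, hcZ, hZ⟩ := hac
  by_cases hXY : 2 ≤ (X ∩ Y).card
  · exact ⟨X ∪ Y, by simp [haX], by simp [hbX], by simp [hcY], glue X Y hXY hX hY⟩
  by_cases hXZ : 2 ≤ (X ∩ Z).card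
  · exact ⟨X ∪ Z, by simp [haX], by simp [hbX], by simp [hcZ], glue X Z hXZ hX hZ⟩
  by_cases hYZ : 2 ≤ (Y ∩ Z).card
  · exact ⟨Y ∪ Z, by simp [haZ], by simp [hbY], by simp [hcY], glue Y Z hYZ hY hZ⟩
  refine ⟨(X ∪ Y) ∪ Z, by simp [haX], by simp [hbX], by simp [hcY], ?_⟩
  have disj : ∀ X Y : Finset β, ¬ 2 ≤ (X ∩ Y).card → Disjoint (E ∩ X.sym2) (E ∩ Y.sym2) := by
    intro X Y h
    have h0 := hE.inter_sym2_eq_empty (X := X ∩ Y) (by omega)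
    rw [Finset.disjoint_left]
    intro e h1 h2
    have : e ∈ E ∩ (X ∩ Y).sym2 := by
      simp only [Finset.mem_inter, Finset.mem_sym2_iff] at h1 h2 ⊢
      exact ⟨h1.1, fun v hv => ⟨h1.2 v hv, h2.2 v hv⟩⟩
    simp [h0] at this
  have h1 : (E ∩ X.sym2).card + (E ∩ Y.sym2).card + (E ∩ Z.sym2).card ≤
      (E ∩ ((X ∪ Y) ∪ Z).sym2).card := by
    rw [← Finset.card_union_of_disjoint (disj X Y hXY), ← Finset.card_union_of_disjoint
      (Finset.disjoint_union_left.2 ⟨disj X Z hXZ, disj Y Z hYZ⟩)]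
    refine Finset.card_le_card ?_
    intro e
    simp only [Finset.mem_inter, Finset.mem_union, Finset.mem_sym2_iff]
    rintro ((⟨h, h'⟩ | ⟨h, h'⟩) | ⟨h, h'⟩)
    · exact ⟨h, fun v hv => Or.inl (Or.inl (h' v hv))⟩
    · exact ⟨h, fun v hv => Or.inl (Or.inr (h' v hv))⟩
    · exact ⟨h, fun v hv => Or.inr (h' v hv)⟩
  have h3 := Finset.card_union_add_card_inter X Y
  have h4 := Finset.card_union_add_card_inter (X ∪ Y) Z
  have h6 : 0 < (X ∩ Y).card := Finset.card_pos.2 ⟨b, by simp [hbX, hbY]⟩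
  have h7 : 1 < ((X ∪ Y) ∩ Z).card :=
    Finset.one_lt_card.2 ⟨a, by simp [haX, haZ], c, by simp [hcY, hcZ], hca⟩
  omega

/-- In a sparse edge set, the edges avoiding a vertex `w` of degree three remain sparse after
joining some two of the three neighbours of `w` by a new edge. -/
theorem LamanSparse.exists_not_tightlyLinked {E : Finset (Sym2 β)} (hE : LamanSparse E)
    {w a b c : β} (ha : s(w, a) ∈ E) (hb : s(w, b) ∈ E) (hc : s(w, c) ∈ E)
    (hab : a ≠ b) (hac : a ≠ c) (hbc : b ≠ c) :
    ¬ TightlyLinked (E.filter (w ∉ ·)) a b ∨ ¬ TightlyLinked (E.filter (w ∉ ·)) b c ∨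
      ¬ TightlyLinked (E.filter (w ∉ ·)) a c := by
  by_contra! h
  obtain ⟨X, haX, hbX, hcX, hX⟩ :=
    (hE.mono (Finset.filter_subset _ _)).exists_tight_of_tightlyLinked hac h.1 h.2.1 h.2.2
  have hwa : a ≠ w := fun h => hE.1 _ ha (by simp [h])
  have hwb : b ≠ w := fun h => hE.1 _ hb (by simp [h])
  have hwc : c ≠ w := fun h => hE.1 _ hc (by simp [h])
  set Y := X.erase w with hY
  have hXY : E.filter (w ∉ ·) ∩ X.sym2 ⊆ E ∩ Y.sym2 := by
    intro e
    simp only [Finset.mem_inter, Finset.mem_filter, Finset.mem_sym2_iff, hY, Finset.mem_erase]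
    rintro ⟨⟨h1, h2⟩, h3⟩
    exact ⟨h1, fun v hv => ⟨fun h => h2 (h ▸ hv), h3 v hv⟩⟩
  have hmem : ∀ v, v ≠ w → v ∈ X → v ∈ Y := fun v h h' => Finset.mem_erase.2 ⟨h, h'⟩
  have hsub : (E ∩ Y.sym2) ∪ {s(w, a), s(w, b), s(w, c)} ⊆ E ∩ (insert w Y).sym2 := by
    refine Finset.union_subset (Finset.inter_subset_inter_left
      (Finset.sym2_mono (Finset.subset_insert _ _))) ?_
    intro e
    simp only [Finset.mem_insert, Finset.mem_singleton, Finset.mem_inter]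
    rintro (rfl | rfl | rfl)
    · exact ⟨ha, by simp [hmem a hwa haX]⟩
    · exact ⟨hb, by simp [hmem b hwb hbX]⟩
    · exact ⟨hc, by simp [hmem c hwc hcX]⟩
  have hdisj : Disjoint (E ∩ Y.sym2) {s(w, a), s(w, b), s(w, c)} := by
    rw [Finset.disjoint_right]
    intro e
    simp only [Finset.mem_insert, Finset.mem_singleton, Finset.mem_inter]
    rintro (rfl | rfl | rfl) <;> simp [hY]
  have h1 := Finset.card_le_card hsub
  have h3 : ({s(w, a), s(w, b), s(w, c)} : Finset (Sym2 β)).card = 3 :=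
    Finset.card_eq_three.2 ⟨_, _, _, fun h => hab (Sym2.congr_right.1 h),
      fun h => hac (Sym2.congr_right.1 h), fun h => hbc (Sym2.congr_right.1 h), rfl⟩
  rw [Finset.card_union_of_disjoint hdisj, h3] at h1
  have h2 : (insert w Y).card = Y.card + 1 := Finset.card_insert_of_notMem (by simp [hY])
  have h4 := Finset.card_le_card hXY
  have h5 : Y.card ≤ X.card := Finset.card_le_card (Finset.erase_subset _ _)
  have h6 : 0 < Y.card := Finset.card_pos.2 ⟨a, hmem a hwa haX⟩
  have h7 := hE.2 (insert w Y) (by omega)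
  omega

/-- A nonempty sparse edge set has a vertex of degree one, two or three. -/
theorem LamanSparse.exists_small_degree [Fintype β] {E : Finset (Sym2 β)} (hE : LamanSparse E)
    (hne : E.Nonempty) :
    ∃ w, (Finset.univ.filter fun u => s(w, u) ∈ E).Nonempty ∧
      (Finset.univ.filter fun u => s(w, u) ∈ E).card ≤ 3 := by
  by_contra! h
  set N : β → Finset β := fun w => Finset.univ.filter fun u => s(w, u) ∈ E with hN
  set W : Finset β := Finset.univ.filter fun w => (N w).Nonempty with hW
  have hmemW : ∀ e ∈ E, ∀ v ∈ e, v ∈ W := by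
    rintro e he v ⟨u, rfl⟩
    exact Finset.mem_filter.2 ⟨Finset.mem_univ _, u, by simp [hN, he]⟩
  have hEW : E ∩ W.sym2 = E :=
    Finset.inter_eq_left.2 fun e he => Finset.mem_sym2_iff.2 (hmemW e he)
  have hcard : 2 ≤ W.card := by
    obtain ⟨e, he⟩ := hne
    rw [← Sym2.card_toFinset_of_not_isDiag e (hE.1 e he)]
    exact Finset.card_le_card fun v hv => hmemW e he v (Sym2.mem_toFinset.1 hv)
  have hdeg : ∀ w, (N w).card = (E.filter (w ∈ ·)).card := by
    intro w
    refine Finset.card_bij (fun u _ => s(w, u)) ?_ ?_ ?_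
    · intro u hu
      simpa [hN] using hu
    · intro u _ u' _ h
      exact Sym2.congr_right.1 h
    · intro e he
      obtain ⟨he, u, rfl⟩ := Finset.mem_filter.1 he
      exact ⟨u, by simp [hN, he], rfl⟩
  have hsum : ∑ w ∈ W, (N w).card = 2 * E.card := by
    simp_rw [hdeg]
    have := Finset.sum_card_bipartiteAbove_eq_sum_card_bipartiteBelow
      (fun (w : β) (e : Sym2 β) => w ∈ e) (s := W) (t := E)
    simp only [Finset.bipartiteAbove, Finset.bipartiteBelow] at this
    rw [this, Finset.sum_const_nat (m := 2), mul_comm]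
    intro e he
    rw [← Sym2.card_toFinset_of_not_isDiag e (hE.1 e he)]
    congr 1
    ext v
    simp only [Finset.mem_filter, Sym2.mem_toFinset, and_iff_right_iff_imp]
    exact hmemW e he v
  have hge : W.card * 4 ≤ ∑ w ∈ W, (N w).card := by
    rw [← smul_eq_mul]
    exact Finset.card_nsmul_le_sum _ _ _ fun w hw => h w (Finset.mem_filter.1 hw).2
  have := hE.2 W hcard
  rw [hEW] at this
  omega

end Combinatorics
section Stresses

variable {β : Type*} [DecidableEq β]

/-- The row of the rigidity matrix at `r` belonging to an unordered pair of vertices. -/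
noncomputable def rigidityRow (r : β → ℂ × ℂ) : Sym2 β → β → ℂ × ℂ :=
  Sym2.lift ⟨fun u v => Pi.single u (r u - r v) + Pi.single v (r v - r u),
    fun _ _ => add_comm _ _⟩

/-- A realization is stress-free on `E` if every equilibrium stress supported on `E` vanishes. -/
def StressFree [Fintype β] (E : Finset (Sym2 β)) (r : β → ℂ × ℂ) : Prop :=
  ∀ ω : Sym2 β → ℂ, (∀ e ∉ E, ω e = 0) → (∀ v, ∑ u, ω s(v, u) • (r v - r u) = 0) → ∀ e, ω e = 0

theorem rigidityRow_mk_apply (r : β → ℂ × ℂ) (v u : β) :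
    rigidityRow r s(v, u) v = r v - r u := by
  rcases eq_or_ne v u with rfl | h
  · simp [rigidityRow]
  · simp [rigidityRow, h]

theorem rigidityRow_apply_of_notMem (r : β → ℂ × ℂ) {e : Sym2 β} {v : β} (h : v ∉ e) :
    rigidityRow r e v = 0 := by
  induction e with
  | _ a b =>
    simp only [Sym2.mem_iff, not_or] at h
    simp [rigidityRow, h.1, h.2]

theorem continuous_rigidityRow (e : Sym2 β) :
    Continuous fun r : β → ℂ × ℂ => rigidityRow r e := by
  induction e with
  | _ a b =>
    simp only [rigidityRow, Sym2.lift_mk]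
    refine continuous_pi fun v => ?_
    simp only [Pi.add_apply, Pi.single_apply]
    split_ifs <;> fun_prop

variable [Fintype β]

theorem sum_smul_rigidityRow_apply (r : β → ℂ × ℂ) (ω : Sym2 β → ℂ) (v : β) :
    ∑ e, ω e • rigidityRow r e v = ∑ u, ω s(v, u) • (r v - r u) := by
  have h : ∑ u, ω s(v, u) • (r v - r u) =
      ∑ e ∈ Finset.univ.image (fun u => s(v, u)), ω e • rigidityRow r e v := by
    rw [Finset.sum_image fun _ _ _ _ h => Sym2.congr_right.1 h]
    simp only [rigidityRow_mk_apply]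
  rw [h]
  symm
  refine Finset.sum_subset (Finset.subset_univ _) fun e _ he => ?_
  rw [rigidityRow_apply_of_notMem, smul_zero]
  rintro ⟨u, rfl⟩
  exact he (Finset.mem_image_of_mem _ (Finset.mem_univ _))

theorem stressFree_iff_linearIndependent (E : Finset (Sym2 β)) (r : β → ℂ × ℂ) :
    StressFree E r ↔ LinearIndependent ℂ (fun e : E => rigidityRow r e) := by
  have key : ∀ ω : Sym2 β → ℂ, (∀ e ∉ E, ω e = 0) →
      ((∀ v, ∑ u, ω s(v, u) • (r v - r u) = 0) ↔ ∑ e ∈ E, ω e • rigidityRow r e = 0) := by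
    intro ω hω
    rw [funext_iff]
    refine forall_congr' fun v => ?_
    rw [← sum_smul_rigidityRow_apply, Finset.sum_apply, ← Finset.sum_subset (Finset.subset_univ E)]
    · rfl
    · intro e _ he
      rw [hω e he, zero_smul]
  change _ ↔ LinearIndepOn ℂ (rigidityRow r) (E : Set (Sym2 β))
  rw [linearIndepOn_finset_iff]
  constructor
  · intro h f hf e he
    have hω := h (fun e => if e ∈ E then f e else 0) (fun e he => if_neg he)
      ((key _ fun e he => if_neg he).2 ?_) e
    · simpa [he] using hω
    · rw [← hf]
      exact Finset.sum_congr rfl fun e he => by simp [he]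
  · intro h ω hω hs e
    by_cases he : e ∈ E
    · exact h ω ((key ω hω).1 hs) e he
    · exact hω e he

theorem isOpen_setOf_stressFree (E : Finset (Sym2 β)) :
    IsOpen {r : β → ℂ × ℂ | StressFree E r} := by
  simp_rw [stressFree_iff_linearIndependent]
  exact (isOpen_setOfPred_linearIndependent (𝕜 := ℂ) (E := β → ℂ × ℂ) (ι := E)).preimage
    (continuous_pi fun e : E => continuous_rigidityRow e.1)

/-- The determinant of a pair of vectors in the plane. -/
def cross (p q : ℂ × ℂ) : ℂ := p.1 * q.2 - p.2 * q.1

theorem eq_zero_of_smul_add_smul_eq_zero {p q : ℂ × ℂ} (h : cross p q ≠ 0) {x y : ℂ}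
    (hxy : x • p + y • q = 0) : x = 0 ∧ y = 0 := by
  have h1 := congrArg Prod.fst hxy
  have h2 := congrArg Prod.snd hxy
  simp only [Prod.fst_add, Prod.snd_add, Prod.smul_fst, Prod.smul_snd, smul_eq_mul,
    Prod.fst_zero, Prod.snd_zero] at h1 h2
  constructor
  · refine (mul_eq_zero.1 (?_ : x * cross p q = 0)).resolve_right h
    simp only [cross]
    linear_combination q.2 * h1 - q.1 * h2
  · refine (mul_eq_zero.1 (?_ : y * cross p q = 0)).resolve_right h
    simp only [cross]
    linear_combination p.1 * h2 - p.2 * h1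

/-- A stress-free realization can be perturbed to put three given vertices in general position. -/
theorem StressFree.exists_cross_ne_zero {E : Finset (Sym2 β)} {r : β → ℂ × ℂ}
    (hr : StressFree E r) {a b c : β} (hab : a ≠ b) (hac : a ≠ c) (hbc : b ≠ c) :
    ∃ r', StressFree E r' ∧ cross (r' a - r' c) (r' b - r' c) ≠ 0 := by
  set γ : ℂ → β → ℂ × ℂ := fun t =>
    r + t • (Pi.single a ((1, 0) : ℂ × ℂ) + Pi.single b ((0, 1) : ℂ × ℂ)) with hγ
  have hγc : Continuous γ := by fun_prop
  have hopen : IsOpen (γ ⁻¹' {r | StressFree E r}) := (isOpen_setOf_stressFree E).preimage hγc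
  have hinf : (γ ⁻¹' {r | StressFree E r}).Infinite :=
    infinite_of_mem_nhds 0 (hopen.mem_nhds (by simpa [hγ] using hr))
  set p := r a - r c with hp
  set q := r b - r c with hq
  set P : Polynomial ℂ := (Polynomial.X + Polynomial.C p.1) * (Polynomial.X + Polynomial.C q.2) -
    Polynomial.C (p.2 * q.1) with hP
  have hPm : P.Monic := by
    have h1 : ((Polynomial.X + Polynomial.C p.1) * (Polynomial.X + Polynomial.C q.2)).Monic :=
      (Polynomial.monic_X_add_C _).mul (Polynomial.monic_X_add_C _)
    refine h1.sub_of_left (lt_of_le_of_lt Polynomial.degree_C_le ?_)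
    rw [Polynomial.degree_mul, Polynomial.degree_X_add_C, Polynomial.degree_X_add_C]
    norm_num
  obtain ⟨t, ht, htP⟩ := hinf.exists_notMem_finset P.roots.toFinset
  refine ⟨γ t, ht, ?_⟩
  have hev : P.eval t ≠ 0 := by
    simpa [hPm.ne_zero] using htP
  convert hev using 1
  simp [cross, hγ, hP, hp, hq, hab, hab.symm, hac.symm, hbc.symm]
  ring

/-- Adding a vertex to a stress-free realization keeps it stress-free as soon as the equilibrium
condition forces the stress to vanish on all edges at the new vertex. -/
theorem StressFree.of_filter_notMem {E : Finset (Sym2 β)} {r r' : β → ℂ × ℂ} {w : β}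
    (hr : StressFree (E.filter (w ∉ ·)) r) (hr' : ∀ v ≠ w, r' v = r v)
    (h : ∀ ω : Sym2 β → ℂ, (∀ e ∉ E, ω e = 0) → (∀ v, ∑ u, ω s(v, u) • (r' v - r' u) = 0) →
      ∀ u, ω s(w, u) = 0) : StressFree E r' := by
  intro ω hω hs
  have h0 := h ω hω hs
  refine hr ω (fun e he => ?_) fun v => ?_
  · by_cases hw : w ∈ e
    · obtain ⟨u, rfl⟩ := hw
      exact h0 u
    · exact hω e fun h => he (Finset.mem_filter.2 ⟨h, hw⟩)
  · rcases eq_or_ne v w with rfl | hv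
    · simp [h0]
    · rw [← hs v]
      refine Finset.sum_congr rfl fun u _ => ?_
      rcases eq_or_ne u w with rfl | hu
      · rw [Sym2.eq_swap, h0]
        simp
      · rw [hr' v hv, hr' u hu]

theorem StressFree.exists_of_degree_one {E : Finset (Sym2 β)} {r : β → ℂ × ℂ} {w a : β}
    (hr : StressFree (E.filter (w ∉ ·)) r) (hwa : w ≠ a)
    (hN : ∀ u, s(w, u) ∈ E ↔ u = a) : ∃ r', StressFree E r' := by
  refine ⟨Function.update r w (r a + (1, 0)), hr.of_filter_notMem
    (fun v hv => Function.update_of_ne hv _ _) fun ω hω hs => ?_⟩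
  have h1 := hs w
  rw [Finset.sum_eq_single a (fun u _ hu => by rw [hω _ (mt (hN u).1 hu), zero_smul])
    (by simp)] at h1
  intro u
  by_cases hu : u = a
  · subst hu
    simpa [hwa.symm] using h1
  · exact hω _ (mt (hN u).1 hu)

theorem StressFree.exists_of_degree_two {E : Finset (Sym2 β)} {r : β → ℂ × ℂ} {w a b : β}
    (hr : StressFree (E.filter (w ∉ ·)) r) (hwa : w ≠ a) (hwb : w ≠ b) (hab : a ≠ b)
    (hN : ∀ u, s(w, u) ∈ E ↔ u = a ∨ u = b) : ∃ r', StressFree E r' := by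
  obtain ⟨r', hr', hc⟩ := hr.exists_cross_ne_zero hab hwa.symm hwb.symm
  refine ⟨r', hr'.of_filter_notMem (fun _ _ => rfl) fun ω hω hs => ?_⟩
  have h1 := hs w
  rw [← Finset.sum_subset (Finset.subset_univ {a, b})
    (fun u _ hu => by rw [hω _ (mt (hN u).1 (by simpa using hu)), zero_smul]),
    Finset.sum_pair hab] at h1
  obtain ⟨ha, hb⟩ := eq_zero_of_smul_add_smul_eq_zero hc (x := ω s(w, a)) (y := ω s(w, b)) (by
    rw [← neg_eq_zero, ← h1, ← neg_sub (r' a), ← neg_sub (r' b), smul_neg, smul_neg, neg_add])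
  intro u
  by_cases hu : u = a ∨ u = b
  · rcases hu with rfl | rfl <;> assumption
  · exact hω _ (mt (hN u).1 hu)

theorem StressFree.exists_of_degree_three {E : Finset (Sym2 β)} {r : β → ℂ × ℂ} {w a b c : β}
    (hr : StressFree (insert s(a, b) (E.filter (w ∉ ·))) r)
    (hmem : s(a, b) ∉ E.filter (w ∉ ·))
    (hwa : w ≠ a) (hwb : w ≠ b) (hwc : w ≠ c) (hab : a ≠ b) (hac : a ≠ c) (hbc : b ≠ c)
    (hN : ∀ u, s(w, u) ∈ E ↔ u = a ∨ u = b ∨ u = c) : ∃ r', StressFree E r' := by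
  obtain ⟨r, hr, hc⟩ := hr.exists_cross_ne_zero hab hac hbc
  set r' := Function.update r w ((2⁻¹ : ℂ) • (r a + r b)) with hr'
  have hrw : r' w = (2⁻¹ : ℂ) • (r a + r b) := Function.update_self _ _ _
  have hrv : ∀ v ≠ w, r' v = r v := fun v hv => Function.update_of_ne hv _ _
  have habE : s(a, b) ∉ E := fun h => hmem (Finset.mem_filter.2 ⟨h, by simp [hwa, hwb]⟩)
  refine ⟨r', fun ω hω hs => ?_⟩
  have hw : ∀ u, u ≠ a → u ≠ b → u ≠ c → ω s(w, u) = 0 := fun u h1 h2 h3 =>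
    hω _ (mt (hN u).1 (by simp [h1, h2, h3]))
  have h1 := hs w
  rw [← Finset.sum_subset (Finset.subset_univ {a, b, c})
    (fun u _ hu => by
      simp only [Finset.mem_insert, Finset.mem_singleton, not_or] at hu
      rw [hw u hu.1 hu.2.1 hu.2.2, zero_smul]),
    Finset.sum_insert (by simp [hab, hac]), Finset.sum_pair hbc, hrw, hrv a hwa.symm,
    hrv b hwb.symm, hrv c hwc.symm] at h1
  set x := ω s(w, a) with hx
  set y := ω s(w, b) with hy
  set z := ω s(w, c) with hz
  obtain ⟨h2, h3⟩ := eq_zero_of_smul_add_smul_eq_zero hc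
    (x := 2⁻¹ * (y - x + z)) (y := 2⁻¹ * (x - y + z)) (by
      rw [← h1]
      ext <;> simp <;> ring)
  have hz0 : z = 0 := by linear_combination h2 + h3
  have hxy : y = x := by linear_combination h2 - h3
  set ω' : Sym2 β → ℂ := fun e => if e = s(a, b) then 2⁻¹ * x else if w ∈ e then 0 else ω e
    with hω'
  have h0 : ∀ e, ω' e = 0 := by
    refine hr ω' (fun e he => ?_) fun v => ?_
    · simp only [Finset.mem_insert, Finset.mem_filter, not_or, not_and, not_not] at he
      simp only [hω', he.1, if_false]
      split_ifs with h
      · rfl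
      · exact hω e fun h' => h (he.2 h')
    · rcases eq_or_ne v w with rfl | hv
      · refine Finset.sum_eq_zero fun u _ => ?_
        have : s(v, u) ≠ s(a, b) := by
          intro h
          have : v ∈ s(a, b) := h ▸ Sym2.mem_mk_left _ _
          simp [hwa, hwb] at this
        simp [hω', this]
      · have hterm : ∀ u, u ≠ w → s(v, u) ≠ s(a, b) →
            ω' s(v, u) • (r v - r u) - ω s(v, u) • (r' v - r' u) = 0 := by
          intro u hu hvu
          simp [hω', hvu, hv.symm, hu.symm, hrv v hv, hrv u hu]
        rw [← hs v, ← sub_eq_zero, ← Finset.sum_sub_distrib]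
        by_cases hva : v = a
        · subst hva
          rw [← Finset.sum_subset (Finset.subset_univ {b, w}), Finset.sum_pair hwb.symm, hrw,
            hrv v hv, hrv b hwb.symm, hω _ habE, Sym2.eq_swap (a := v) (b := w), ← hx]
          · have : s(w, v) ≠ s(v, b) := by simp [hwa, hwb]
            ext <;> simp [hω', this] <;> ring
          · intro u _ hu
            simp only [Finset.mem_insert, Finset.mem_singleton, not_or] at hu
            exact hterm u hu.2 fun h => hu.1 (Sym2.congr_right.1 h)
        by_cases hvb : v = b
        · subst hvb
          rw [← Finset.sum_subset (Finset.subset_univ {a, w}), Finset.sum_pair hwa.symm, hrw,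
            hrv v hv, hrv a hwa.symm, Sym2.eq_swap (a := v) (b := a), hω _ habE,
            Sym2.eq_swap (a := v) (b := w), ← hy, hxy]
          · have : s(w, v) ≠ s(a, v) := by simp [hwa, hwb]
            ext <;> simp [hω', this] <;> ring
          · intro u _ hu
            simp only [Finset.mem_insert, Finset.mem_singleton, not_or] at hu
            exact hterm u hu.2 fun h => hu.1 (Sym2.congr_right.1 (h.trans Sym2.eq_swap))
        have hvab : ∀ u, s(v, u) ≠ s(a, b) := by
          intro u h
          have : v ∈ s(a, b) := h ▸ Sym2.mem_mk_left _ _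
          simp [hva, hvb] at this
        refine Finset.sum_eq_zero fun u _ => ?_
        rcases eq_or_ne u w with rfl | hu
        · have : ω s(v, u) = 0 := by
            rw [Sym2.eq_swap]
            by_cases hvc : v = c
            · rw [hvc, ← hz, hz0]
            · exact hw v hva hvb hvc
          simp [hω', hvab, this]
        · exact hterm u hu (hvab u)
  have hx0 : x = 0 := by simpa [hω'] using h0 s(a, b)
  intro e
  by_cases hwe : w ∈ e
  · obtain ⟨u, rfl⟩ := hwe
    by_cases hu : u = a ∨ u = b ∨ u = c
    · rcases hu with rfl | rfl | rfl
      · exact hx0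
      · exact hxy.trans hx0
      · exact hz0
    · simp only [not_or] at hu
      exact hw u hu.1 hu.2.1 hu.2.2
  · by_cases he : e = s(a, b)
    · exact he ▸ hω _ habE
    · simpa [hω', he, hwe] using h0 e

/-- Every sparse edge set admits a stress-free realization. -/
theorem LamanSparse.exists_stressFree {E : Finset (Sym2 β)} (hE : LamanSparse E) :
    ∃ r : β → ℂ × ℂ, StressFree E r := by
  induction hn : E.card using Nat.strong_induction_on generalizing E with
  | _ n ih =>
  rcases E.eq_empty_or_nonempty with rfl | hne
  · exact ⟨0, fun ω hω _ e => hω e (Finset.notMem_empty e)⟩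
  obtain ⟨w, ⟨u, hu⟩, hle⟩ := hE.exists_small_degree hne
  set N := Finset.univ.filter fun u => s(w, u) ∈ E with hN
  have hmem : ∀ u, s(w, u) ∈ E ↔ u ∈ N := by simp [hN]
  have hw : ∀ u ∈ N, w ≠ u := fun u hu h => hE.1 _ ((hmem u).2 hu) (by simp [h])
  have hE' : LamanSparse (E.filter (w ∉ ·)) := hE.mono (Finset.filter_subset _ _)
  have hsub : ∀ v ∈ N, E.filter (w ∉ ·) ⊆ E.erase s(w, v) := by
    intro v _ e he
    obtain ⟨he, hwe⟩ := Finset.mem_filter.1 he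
    exact Finset.mem_erase.2 ⟨fun h => hwe (h ▸ Sym2.mem_mk_left _ _), he⟩
  have hlt : (E.filter (w ∉ ·)).card < n := by
    rw [← hn]
    exact (Finset.card_le_card (hsub u hu)).trans_lt
      (Finset.card_erase_lt_of_mem ((hmem u).2 hu))
  have hpos : 0 < N.card := Finset.card_pos.2 ⟨u, hu⟩
  obtain h | h | h : N.card = 1 ∨ N.card = 2 ∨ N.card = 3 := by omega
  · obtain ⟨r, hr⟩ := ih _ hlt hE' rfl
    obtain ⟨a, ha⟩ := Finset.card_eq_one.1 h
    exact hr.exists_of_degree_one (hw a (by simp [ha])) (by simp [hmem, ha])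
  · obtain ⟨r, hr⟩ := ih _ hlt hE' rfl
    obtain ⟨a, b, hab, hNab⟩ := Finset.card_eq_two.1 h
    exact hr.exists_of_degree_two (hw a (by simp [hNab])) (hw b (by simp [hNab])) hab
      (by simp [hmem, hNab])
  · have step : ∀ a b c, a ≠ b → a ≠ c → b ≠ c → (∀ u, u ∈ N ↔ u = a ∨ u = b ∨ u = c) →
        ¬ TightlyLinked (E.filter (w ∉ ·)) a b → ∃ r : β → ℂ × ℂ, StressFree E r := by
      intro a b c hab hac hbc habc hl
      obtain ⟨h1, h2⟩ := hE'.insert_of_not_tightlyLinked hab hl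
      have haN := (habc a).2 (by simp)
      have hbN := (habc b).2 (by simp)
      have hcN := (habc c).2 (by simp)
      have hcard : (insert s(a, b) (E.filter (w ∉ ·))).card < n := by
        rw [Finset.card_insert_of_notMem h1]
        have h3 : E.filter (w ∉ ·) ⊆ (E.erase s(w, a)).erase s(w, b) := by
          intro e he
          refine Finset.mem_erase.2 ⟨fun h => ?_, hsub a haN he⟩
          exact (Finset.mem_erase.1 (hsub b hbN he)).1 h
        have h4 := Finset.card_le_card h3
        have h5 : ((E.erase s(w, a)).erase s(w, b)).card < (E.erase s(w, a)).card :=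
          Finset.card_erase_lt_of_mem (Finset.mem_erase.2
            ⟨fun h => hab (Sym2.congr_right.1 h).symm, (hmem b).2 hbN⟩)
        have h6 := Finset.card_erase_lt_of_mem ((hmem a).2 haN)
        omega
      obtain ⟨r, hr⟩ := ih _ hcard h2 rfl
      exact hr.exists_of_degree_three h1 (hw a haN) (hw b hbN) (hw c hcN) hab hac hbc
        fun u => (hmem u).trans (habc u)
    obtain ⟨a, b, c, hab, hac, hbc, habc⟩ := Finset.card_eq_three.1 h
    rcases hE.exists_not_tightlyLinked ((hmem a).2 (by simp [habc])) ((hmem b).2 (by simp [habc]))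
      ((hmem c).2 (by simp [habc])) hab hac hbc with hl | hl | hl
    · exact step a b c hab hac hbc (by simp [habc]) hl
    · exact step b c a hbc hab.symm hac.symm (fun u => by simp [habc]; tauto) hl
    · exact step a c b hac hab hbc.symm (fun u => by simp [habc]; tauto) hl

end Stresses

section Dominance

open MvPolynomial

/-- The differential at `r` of the squared length of an edge. -/
noncomputable def edgeDeriv {β : Type*} [Fintype β] [DecidableEq β] (r : β → ℂ × ℂ) (e : Sym2 β) :
    (β → ℂ × ℂ) →L[ℂ] ℂ :=
  ∑ v, ((2 * (rigidityRow r e v).1) • (ContinuousLinearMap.fst ℂ ℂ ℂ ∘L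
      ContinuousLinearMap.proj (R := ℂ) (φ := fun _ : β => ℂ × ℂ) v) +
    (2 * (rigidityRow r e v).2) • (ContinuousLinearMap.snd ℂ ℂ ℂ ∘L
      ContinuousLinearMap.proj (R := ℂ) (φ := fun _ : β => ℂ × ℂ) v))

theorem edgeDeriv_single {β : Type*} [Fintype β] [DecidableEq β] (r : β → ℂ × ℂ) (e : Sym2 β)
    (v : β) (x : ℂ × ℂ) :
    edgeDeriv r e (Pi.single v x) =
      2 * (rigidityRow r e v).1 * x.1 + 2 * (rigidityRow r e v).2 * x.2 := by
  simp only [edgeDeriv, sum_apply]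
  rw [Finset.sum_eq_single v]
  · simp
  · intro u _ hu
    simp [hu]
  · simp

theorem hasStrictFDerivAt_edgeVal {β : Type*} [Fintype β] [DecidableEq β] (r : β → ℂ × ℂ)
    (e : Sym2 β) : HasStrictFDerivAt (fun r : β → ℂ × ℂ => edgeVal r e) (edgeDeriv r e) r := by
  induction e with
  | _ a b =>
    have hd : ∀ v, HasStrictFDerivAt (fun r : β → ℂ × ℂ => r v)
        (ContinuousLinearMap.proj (R := ℂ) (φ := fun _ : β => ℂ × ℂ) v) r :=
      fun v => (ContinuousLinearMap.proj (R := ℂ) (φ := fun _ : β => ℂ × ℂ) v).hasStrictFDerivAt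
    have h := (((hd a).fst.sub (hd b).fst).pow 2).add (((hd a).snd.sub (hd b).snd).pow 2)
    refine h.congr_fderiv ?_
    refine ContinuousLinearMap.ext fun x => ?_
    simp [edgeDeriv, rigidityRow, Pi.single_apply, apply_ite Prod.fst, apply_ite Prod.snd, mul_add,
      add_mul, Finset.sum_add_distrib]
    ring

/-- If the rigidity matrix has independent rows at some realization, then the edge map is
dominant. -/
theorem exists_eval_ne_zero_of_linearIndependent {β ι : Type*} [Fintype β] [DecidableEq β]
    [Fintype ι] (ε : ι → Sym2 β) {r : β → ℂ × ℂ}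
    (hr : LinearIndependent ℂ fun i => rigidityRow r (ε i)) {F : MvPolynomial ι ℂ} (hF : F ≠ 0) :
    ∃ r : β → ℂ × ℂ, eval (fun i => edgeVal r (ε i)) F ≠ 0 := by
  by_contra! h0
  set L : (β → ℂ × ℂ) →L[ℂ] ι → ℂ := ContinuousLinearMap.pi fun i => edgeDeriv r (ε i) with hL
  have hd : HasStrictFDerivAt (fun (r : β → ℂ × ℂ) i => edgeVal r (ε i)) L r :=
    hasStrictFDerivAt_pi.2 fun i => hasStrictFDerivAt_edgeVal r (ε i)
  have hsurj : (L : (β → ℂ × ℂ) →ₗ[ℂ] ι → ℂ).range = ⊤ := by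
    by_contra hne
    obtain ⟨φ, hφ, hker⟩ := Submodule.exists_le_ker_of_lt_top _ (lt_top_iff_ne_top.2 hne)
    set ω : ι → ℂ := fun i => φ (Pi.single i 1) with hω
    have hφω : ∀ x, φ x = ∑ i, x i * ω i := by
      intro x
      rw [LinearMap.pi_apply_eq_sum_univ φ x]
      refine Finset.sum_congr rfl fun i _ => ?_
      rw [smul_eq_mul]
      congr 2
      ext j
      simp [Pi.single_apply, eq_comm]
    have hLω : ∀ h, ∑ i, edgeDeriv r (ε i) h * ω i = 0 := by
      intro h
      have : φ (L h) = 0 := hker ⟨h, rfl⟩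
      rwa [hφω] at this
    have hω0 : ∀ i, ω i = 0 := by
      refine Fintype.linearIndependent_iff.1 hr ω ?_
      ext v
      · have := hLω (Pi.single v (1, 0))
        simp only [edgeDeriv_single, mul_one, mul_zero, add_zero, mul_assoc,
          ← Finset.mul_sum] at this
        simpa [Finset.sum_apply, Prod.fst_sum, mul_comm] using this
      · have := hLω (Pi.single v (0, 1))
        simp only [edgeDeriv_single, mul_one, mul_zero, zero_add, mul_assoc,
          ← Finset.mul_sum] at this
        simpa [Finset.sum_apply, Prod.snd_sum, mul_comm] using this
    refine hφ (LinearMap.ext fun x => ?_)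
    simp [hφω, hω0]
  have hmap := hd.map_nhds_eq_of_surj hsurj
  have hev : ∀ᶠ x in nhds (fun i => edgeVal r (ε i)), eval x F = 0 := by
    rw [← hmap, Filter.eventually_map]
    exact Filter.Eventually.of_forall h0
  obtain ⟨δ, hδ, hball⟩ := Metric.eventually_nhds_iff_ball.1 hev
  refine hF (MvPolynomial.funext_set (fun i => Metric.ball (edgeVal r (ε i)) δ)
    (fun i => infinite_of_mem_nhds _ (Metric.ball_mem_nhds _ hδ)) fun x hx => ?_)
  rw [map_zero]
  refine hball x ?_
  rw [ball_pi _ hδ]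
  exact hx

theorem edgeVal_map {β γ : Type*} (f : β → γ) (r : γ → ℂ × ℂ) (e : Sym2 β) :
    edgeVal r (e.map f) = edgeVal (r ∘ f) e := by
  induction e with
  | _ a b => rfl

/-- The squared length of an edge in the isotropic coordinates `x ± iy`. -/
theorem edgeVal_mk_eq_mul {γ : Type*} (r : γ → ℂ × ℂ) (u v : γ) :
    edgeVal r s(u, v) =
      (((r u).1 + Complex.I * (r u).2) - ((r v).1 + Complex.I * (r v).2)) *
      (((r u).1 - Complex.I * (r u).2) - ((r v).1 - Complex.I * (r v).2)) := by
  change sd (r u) (r v) = _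
  simp only [sd]
  linear_combination (((r u).2 - (r v).2) ^ 2) * Complex.I_sq

/-- The squared edge lengths of a graph on `W` with more than `2|W| - 3` edges satisfy a polynomial
relation, at least at the realizations where a chosen edge does not have length zero. -/
theorem exists_polynomial_relation {γ : Type*} [DecidableEq γ] {W : Finset γ}
    {E : Finset (Sym2 γ)} (hG : IsGraph W E) {a b : γ} (hab : s(a, b) ∈ E)
    (hcard : 2 * W.card < E.card + 3) :
    ∃ F : MvPolynomial {e // e ∈ E} ℂ, F ≠ 0 ∧
      ∀ r : γ → ℂ × ℂ, edgeVal r s(a, b) ≠ 0 → eval (fun e => edgeVal r e.1) F = 0 := by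
  have hne : a ≠ b := by simpa using (hG _ hab).1
  have haW : a ∈ W := (hG _ hab).2 a (by simp)
  have hbW : b ∈ W := (hG _ hab).2 b (by simp)
  set S : Finset (γ × Bool) :=
    (W ×ˢ Finset.univ) \ {(a, true), (a, false), (b, true)} with hS
  have hScard : S.card + 3 = 2 * W.card := by
    have h3 : ({(a, true), (a, false), (b, true)} : Finset (γ × Bool)).card = 3 :=
      Finset.card_eq_three.2 ⟨_, _, _, by simp, by simp [hne], by simp, rfl⟩
    have hsub : ({(a, true), (a, false), (b, true)} : Finset (γ × Bool)) ⊆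
        W ×ˢ Finset.univ := by
      intro x
      simp only [Finset.mem_insert, Finset.mem_singleton]
      rintro (rfl | rfl | rfl) <;> simp [haW, hbW]
    have h4 := Finset.card_sdiff_add_card_eq_card hsub
    rw [h3, Finset.card_product] at h4
    simp only [Finset.card_univ, Fintype.card_bool] at h4
    rw [mul_comm, ← h4]
  set Z : γ → MvPolynomial S ℂ := fun v =>
    if h : (v, true) ∈ S then X ⟨_, h⟩ else if v = b then 1 else 0 with hZ
  set Y : γ → MvPolynomial S ℂ := fun v => if h : (v, false) ∈ S then X ⟨_, h⟩ else 0 with hY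
  set P : Sym2 γ → MvPolynomial S ℂ :=
    Sym2.lift ⟨fun u v => (Z u - Z v) * (Y u - Y v), fun u v => by ring⟩ with hP
  have hdep : ¬ AlgebraicIndependent ℂ (fun e : {e // e ∈ E} => P e.1) := by
    intro h
    have h1 := h.lift_cardinalMk_le_trdeg
    rw [MvPolynomial.trdeg_of_isDomain] at h1
    simp only [Cardinal.mk_fintype, Fintype.card_coe, Cardinal.lift_natCast] at h1
    have h2 : E.card ≤ S.card := by exact_mod_cast h1
    omega
  rw [algebraicIndependent_iff] at hdep
  push Not at hdep
  obtain ⟨F, hF, hF0⟩ := hdep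
  refine ⟨F, hF0, fun r hr => ?_⟩
  set z : γ → ℂ := fun v => (r v).1 + Complex.I * (r v).2 with hz
  set y : γ → ℂ := fun v => (r v).1 - Complex.I * (r v).2 with hy
  have hval : ∀ u v, edgeVal r s(u, v) = (z u - z v) * (y u - y v) := edgeVal_mk_eq_mul r
  set k := z b - z a with hk
  have hk0 : k ≠ 0 := by
    intro h
    rw [hval, ← neg_sub, ← hk, h] at hr
    simp at hr
  set x : S → ℂ := fun p => if p.1.2 then (z p.1.1 - z a) / k else (y p.1.1 - y a) * k with hx
  have hZx : ∀ v ∈ W, eval x (Z v) = (z v - z a) / k := by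
    intro v hv
    by_cases hva : v = a
    · subst hva
      simp [hZ, hS, hne]
    · by_cases hvb : v = b
      · subst hvb
        simp [hZ, hS, ← hk, hk0]
      · have : (v, true) ∈ S := by simp [hS, hv, hva, hvb]
        simp [hZ, hx, this]
  have hYx : ∀ v ∈ W, eval x (Y v) = (y v - y a) * k := by
    intro v hv
    by_cases hva : v = a
    · subst hva
      simp [hY, hS]
    · have : (v, false) ∈ S := by simp [hS, hv, hva]
      simp [hY, hx, this]
  have hPx : ∀ e ∈ E, eval x (P e) = edgeVal r e := by
    intro e he
    induction e with
    | _ u v =>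
      have hu := (hG _ he).2 u (by simp)
      have hv := (hG _ he).2 v (by simp)
      simp only [hP, Sym2.lift_mk, map_mul, map_sub, hZx u hu, hZx v hv, hYx u hu, hYx v hv, hval]
      field_simp
      ring
  have h1 := congrArg (eval x) hF
  rw [map_zero, ← MvPolynomial.coe_aeval_eq_eval, RingHom.coe_coe, ← AlgHom.comp_apply,
    MvPolynomial.comp_aeval] at h1
  rw [← h1, ← MvPolynomial.coe_aeval_eq_eval, RingHom.coe_coe]
  congr 2
  ext e
  exact (hPx e.1 e.2).symm

/-- The pullback of the edge set of a sparse graph to the vertex type is sparse. -/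
theorem IsSparse.lamanSparse {γ : Type*} [DecidableEq γ] {V : Finset γ} {E : Finset (Sym2 γ)}
    (h : IsSparse V E) :
    LamanSparse (Finset.univ.filter fun e : Sym2 V => e.map Subtype.val ∈ E) := by
  refine ⟨fun e he hd => ?_, fun X hX => ?_⟩
  · refine (h.1 _ (Finset.mem_filter.1 he).2).1 ?_
    induction e with
    | _ u v =>
      simp at hd
      simp [hd]
  · set E₀ := (Finset.univ.filter fun e : Sym2 V => e.map Subtype.val ∈ E) ∩ X.sym2 with hE₀
    have hcardE : (E₀.image (Sym2.map Subtype.val)).card = E₀.card :=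
      Finset.card_image_of_injective _ (Sym2.map.injective Subtype.val_injective)
    have hcardX : (X.image Subtype.val).card = X.card :=
      Finset.card_image_of_injective _ Subtype.val_injective
    have hsub : E₀.image (Sym2.map Subtype.val) ⊆ E := by
      intro e he
      obtain ⟨e, he₀, rfl⟩ := Finset.mem_image.1 he
      exact (Finset.mem_filter.1 (Finset.mem_inter.1 he₀).1).2
    have := h.2 (X.image Subtype.val) (E₀.image (Sym2.map Subtype.val)) ⟨?_, ?_, hsub⟩
      (by rwa [hcardX])
    · rw [hcardE, hcardX] at this
      omega
    · refine fun e he => ⟨(h.1 e (hsub he)).1, fun v hv => ?_⟩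
      obtain ⟨e, he₀, rfl⟩ := Finset.mem_image.1 he
      obtain ⟨u, hu, rfl⟩ := Sym2.mem_map.1 hv
      exact Finset.mem_image_of_mem _ (Finset.mem_sym2_iff.1 (Finset.mem_inter.1 he₀).2 u hu)
    · intro v hv
      obtain ⟨u, _, rfl⟩ := Finset.mem_image.1 hv
      exact u.2

end Dominance

/-- A graph is sparse if and only if its edge map
`E_G : (ℂ²)^V → ℂ^E` is dominant, i.e. for every nonzero polynomial `F` in the
variables `(x_e)_{e ∈ E}` there is a realization `r` with `F(E_G(r)) ≠ 0`. -/
theorem sparse_iff_edgeMap_dominant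
    {α : Type*} [DecidableEq α]
    (V : Finset α) (E : Finset (Sym2 α)) (hGraph : IsGraph V E) :
    IsSparse V E ↔
      ∀ F : MvPolynomial {e // e ∈ E} ℂ, F ≠ 0 →
        ∃ r : ↥V → ℂ × ℂ, MvPolynomial.eval (edgeMap V E r) F ≠ 0 := by
  constructor
  · intro h F hF
    obtain ⟨r, hr⟩ := h.lamanSparse.exists_stressFree
    rw [stressFree_iff_linearIndependent] at hr
    have hex : ∀ e : {e // e ∈ E}, ∃ e' : Sym2 V, e'.map Subtype.val = e.1 := by
      rintro ⟨e, he⟩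
      have hm := (hGraph e he).2
      induction e with
      | _ u v => exact ⟨s(⟨u, hm u (by simp)⟩, ⟨v, hm v (by simp)⟩), rfl⟩
    choose ε hε using hex
    have hinj : Function.Injective ε := fun e e' h => Subtype.ext (by rw [← hε e, h, hε e'])
    set ε' : {e // e ∈ E} → {e // e ∈ Finset.univ.filter fun e : Sym2 V =>
        e.map Subtype.val ∈ E} :=
      fun e => ⟨ε e, Finset.mem_filter.2 ⟨Finset.mem_univ _, (hε e).symm ▸ e.2⟩⟩ with hε'
    obtain ⟨s, hs⟩ := exists_eval_ne_zero_of_linearIndependent ε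
      (hr.comp ε' fun e e' h => hinj (congrArg Subtype.val h)) hF
    refine ⟨s, ?_⟩
    convert hs using 3
    ext e
    have : extendR V s ∘ Subtype.val = s := by
      ext v <;> simp [extendR]
    rw [edgeMap, ← hε e, edgeVal_map, this]
  · intro h
    refine ⟨hGraph, fun V' E' hsub hV' => ?_⟩
    by_contra! hcard
    have hne : E'.Nonempty := Finset.card_pos.1 (by omega)
    obtain ⟨e, he⟩ := hne
    induction e with
    | _ a b =>
      obtain ⟨F, hF, hF0⟩ := exists_polynomial_relation hsub.1 he (by omega)
      set i : {e // e ∈ E'} → {e // e ∈ E} := fun e => ⟨e.1, hsub.2.2 e.2⟩ with hi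
      have hinj : Function.Injective i :=
        fun e e' h => Subtype.ext (congrArg (fun x => x.1) h)
      obtain ⟨r, hr⟩ := h (MvPolynomial.rename i F * MvPolynomial.X (i ⟨_, he⟩)) (mul_ne_zero
        ((MvPolynomial.rename_injective i hinj).ne_iff' (map_zero _) |>.2 hF)
        (MvPolynomial.X_ne_zero _))
      rw [map_mul, MvPolynomial.eval_rename, MvPolynomial.eval_X] at hr
      exact left_ne_zero_of_mul hr (hF0 (extendR V r) (right_ne_zero_of_mul hr))
end

section
/- If G=(V,E) is a sparse graph, then there exist a natural number N and a nonzero polynomial F in the variables (x_e)_{e∈E} over ℂ such that for every λ ∈ ℂ^E with F(λ) ≠ 0, the number of minimal prime ideals over the vanishing ideal of E_G⁻¹(λ) in ℂ[x_v, y_v : v∈V] (i.e. the number of irreducible components of the set of λ-compatible realizations) equals N; in other words, the component number c(G,λ) is the same for all general edge length assignments λ. -/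
open scoped Classical

/-- `p` is associated to a product of `N` pairwise non-associated irreducible elements, each with
positive multiplicity. -/
def HasIrreducibleFactors {R : Type*} [CommRing R] (N : ℕ) (p : R) : Prop :=
  ∃ (q : Fin N → R) (e : Fin N → ℕ), (∀ i, Irreducible (q i)) ∧ (∀ i, e i ≠ 0) ∧
    (∀ i j, i ≠ j → ¬ q i ∣ q j) ∧ Associated p (∏ i, q i ^ e i)

theorem exists_hasIrreducibleFactors {R : Type*} [CommRing R] [IsDomain R]
    [UniqueFactorizationMonoid R] {p : R} (hp : p ≠ 0) : ∃ N, HasIrreducibleFactors N p := by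
  induction p using UniqueFactorizationMonoid.induction_on_prime with
  | h₁ => exact absurd rfl hp
  | h₂ x hx =>
    exact ⟨0, Fin.elim0, Fin.elim0, fun i => i.elim0, fun i => i.elim0, fun i => i.elim0,
      by simpa [associated_one_iff_isUnit] using hx⟩
  | h₃ a p ha hpp ih =>
    obtain ⟨N, q, e, hq, he, hd, has⟩ := ih ha
    by_cases h : ∃ i, Associated p (q i)
    · obtain ⟨i, hi⟩ := h
      refine ⟨N, q, Function.update e i (e i + 1), hq, fun j => ?_, hd, ?_⟩
      · by_cases hj : j = i
        · subst hj; simp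
        · simp [hj, he]
      · have : ∏ j, q j ^ (Function.update e i (e i + 1)) j = q i * ∏ j, q j ^ e j := by
          rw [← Finset.mul_prod_erase _ _ (Finset.mem_univ i),
            ← Finset.mul_prod_erase _ (fun j => q j ^ e j) (Finset.mem_univ i)]
          rw [Function.update_self, pow_succ', mul_assoc]
          congr 2
          refine Finset.prod_congr rfl fun j hj => ?_
          rw [Function.update_of_ne (Finset.ne_of_mem_erase hj)]
        rw [this]
        exact hi.mul_mul has
    · push Not at h
      refine ⟨N + 1, Fin.cons p q, Fin.cons 1 e, ?_, ?_, ?_, ?_⟩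
      · refine Fin.cases ?_ ?_
        · exact hpp.irreducible
        · exact hq
      · refine Fin.cases ?_ ?_
        · simp
        · simpa using he
      · refine Fin.cases ?_ fun i => ?_
        · refine Fin.cases ?_ fun j => ?_
          · simp
          · intro _ hdv
            exact h j (hpp.irreducible.associated_of_dvd (hq j) hdv)
        · refine Fin.cases ?_ fun j => ?_
          · intro _ hdv
            exact h i ((hq i).associated_of_dvd hpp.irreducible hdv).symm
          · intro hij
            simpa using hd i j (fun h => hij (by rw [h]))
      · rw [Fin.prod_univ_succ]
        simpa using (Associated.refl p).mul_mul has

theorem HasIrreducibleFactors.ncard_minimalPrimes {R : Type*} [CommRing R] [IsDomain R]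
    [UniqueFactorizationMonoid R] {N : ℕ} {p : R} (h : HasIrreducibleFactors N p) :
    (Ideal.span {p}).minimalPrimes.ncard = N := by
  obtain ⟨q, e, hq, he, hd, has⟩ := h
  have hprime (i) : (Ideal.span {q i}).IsPrime :=
    (Ideal.span_singleton_prime (hq i).ne_zero).2 (hq i).prime
  have hmem (i) : Ideal.span {p} ≤ Ideal.span {q i} := by
    rw [Ideal.span_singleton_le_span_singleton, has.dvd_iff_dvd_right]
    exact (dvd_pow_self _ (he i)).trans (Finset.dvd_prod_of_mem _ (Finset.mem_univ i))
  have key (P : Ideal R) (hP : P.IsPrime) (hle : Ideal.span {p} ≤ P) : ∃ i, q i ∈ P := by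
    rw [Ideal.span_singleton_le_iff_mem] at hle
    have : ∏ i, q i ^ e i ∈ P := P.mem_of_dvd has.dvd hle
    obtain ⟨i, -, hi⟩ := hP.prod_mem_iff.1 this
    exact ⟨i, hP.mem_of_pow_mem _ hi⟩
  have hrange : (Ideal.span {p}).minimalPrimes = Set.range fun i => Ideal.span {q i} := by
    ext P
    constructor
    · rintro ⟨⟨hP, hle⟩, hmin⟩
      obtain ⟨i, hi⟩ := key P hP hle
      have hi' := (Ideal.span_singleton_le_iff_mem P).2 hi
      exact ⟨i, le_antisymm hi' (hmin ⟨hprime i, hmem i⟩ hi')⟩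
    · rintro ⟨i, rfl⟩
      refine ⟨⟨hprime i, hmem i⟩, fun Q ⟨hQ, hpQ⟩ hQi => ?_⟩
      obtain ⟨j, hj⟩ := key Q hQ hpQ
      have := Ideal.mem_span_singleton.1 (hQi hj)
      have hij : i = j := by
        by_contra hne
        exact hd i j hne this
      subst hij
      exact (Ideal.span_singleton_le_iff_mem Q).2 hj
  rw [hrange, ← Set.image_univ, Set.ncard_image_of_injective, Set.ncard_univ, Nat.card_fin]
  intro i j hij
  by_contra hne
  exact hd i j hne (Ideal.span_singleton_le_span_singleton.1 (le_of_eq hij.symm))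

theorem exists_algHom_apply_ne_zero {k R : Type*} [Field k] [IsAlgClosed k] [CommRing R]
    [IsDomain R] [Algebra k R] [Algebra.FiniteType k R] {w : R} (hw : w ≠ 0) :
    ∃ ψ : R →ₐ[k] k, ψ w ≠ 0 := by
  let S := Localization.Away w
  have : Nontrivial S :=
    (IsLocalization.injective S (powers_le_nonZeroDivisors_of_noZeroDivisors hw)).nontrivial
  obtain ⟨M, hM⟩ := Ideal.exists_maximal S
  let _ : Field (S ⧸ M) := Ideal.Quotient.field M
  have : Algebra.FiniteType R S := IsLocalization.finiteType_of_monoid_fg (Submonoid.powers w) S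
  have : Algebra.FiniteType k S := Algebra.FiniteType.trans (S := R) inferInstance inferInstance
  have : Algebra.FiniteType k (S ⧸ M) :=
    Algebra.FiniteType.trans (S := S) inferInstance inferInstance
  have : Module.Finite k (S ⧸ M) := finite_of_finite_type_of_isJacobsonRing k (S ⧸ M)
  let e : k ≃ₐ[k] (S ⧸ M) := AlgEquiv.ofBijective (Algebra.ofId k (S ⧸ M))
    IsAlgClosed.algebraMap_bijective_of_isIntegral
  let χ : R →ₐ[k] (S ⧸ M) := (Ideal.Quotient.mkₐ k M).comp (IsScalarTower.toAlgHom k R S)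
  refine ⟨e.symm.toAlgHom.comp χ, ?_⟩
  have hu : IsUnit (χ w) :=
    (IsLocalization.Away.algebraMap_isUnit (S := S) w).map (Ideal.Quotient.mkₐ k M)
  exact (hu.map e.symm.toAlgHom).ne_zero

namespace MvPolynomial

variable {σ : Type*}

theorem isUnit_of_forall_coeff_eq_zero {k : Type*} [Field k] {a : MvPolynomial σ k} (ha : a ≠ 0)
    (h : ∀ m, m ≠ 0 → coeff m a = 0) : IsUnit a := by
  have hC : a = C (coeff 0 a) := by
    ext m
    rw [coeff_C]
    split_ifs with hm
    · rw [hm]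
    · exact h m (Ne.symm hm)
  rw [isUnit_iff_eq_C_of_isReduced]
  refine ⟨_, isUnit_iff_ne_zero.2 fun h0 => ha ?_, hC⟩
  rw [hC, h0, C_0]

theorem coeff_eq_zero_of_isUnit {k : Type*} [Field k] {a : MvPolynomial σ k} (ha : IsUnit a)
    {m : σ →₀ ℕ} (hm : m ≠ 0) : coeff m a = 0 := by
  obtain ⟨r, -, rfl⟩ := isUnit_iff_eq_C_of_isReduced.1 ha
  rw [coeff_C, if_neg hm.symm]

theorem isUnit_map_iff {k K : Type*} [Field k] [Field K] (f : k →+* K) {p : MvPolynomial σ k} :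
    IsUnit (map f p) ↔ IsUnit p := by
  refine ⟨fun h => ?_, fun h => h.map _⟩
  refine isUnit_of_forall_coeff_eq_zero (fun h0 => h.ne_zero (by rw [h0, map_zero])) fun m hm => ?_
  have := coeff_eq_zero_of_isUnit h hm
  rwa [coeff_map, map_eq_zero] at this

theorem irreducible_map_of_isAlgClosed {k K : Type*} [Field k] [IsAlgClosed k] [Field K]
    [Algebra k K] {p : MvPolynomial σ k} (hp : Irreducible p) :
    Irreducible (map (algebraMap k K) p) := by
  refine ⟨fun h => hp.not_isUnit ((isUnit_map_iff _).1 h), fun a b hab => ?_⟩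
  by_contra! hn
  have h0 : a * b ≠ 0 := by
    rw [← hab]
    exact fun h => hp.ne_zero (map_injective _ (algebraMap k K).injective (by rw [h, map_zero]))
  obtain ⟨ma, hma, hca⟩ : ∃ m, m ≠ 0 ∧ coeff m a ≠ 0 := by
    by_contra! h
    exact hn.1 (isUnit_of_forall_coeff_eq_zero (left_ne_zero_of_mul h0) h)
  obtain ⟨mb, hmb, hcb⟩ : ∃ m, m ≠ 0 ∧ coeff m b ≠ 0 := by
    by_contra! h
    exact hn.2 (isUnit_of_forall_coeff_eq_zero (right_ne_zero_of_mul h0) h)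
  obtain ⟨R, hR, ⟨a', rfl⟩, ⟨b', rfl⟩⟩ : ∃ R : Subalgebra k K, Algebra.FiniteType k R ∧
      a ∈ Set.range (map (algebraMap R K)) ∧ b ∈ Set.range (map (algebraMap R K)) := by
    refine ⟨Algebra.adjoin k ((a.coeffs ∪ b.coeffs : Finset K) : Set K),
      (Subalgebra.fg_iff_finiteType _).1 (Subalgebra.fg_adjoin_finset _), ?_, ?_⟩
    all_goals
      rw [mem_range_map_iff_coeffs_subset]
      refine Set.Subset.trans (Set.Subset.trans ?_ Algebra.subset_adjoin)
        (fun x hx => ⟨⟨x, hx⟩, rfl⟩)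
      simp
  rw [coeff_map] at hca hcb
  have hw : coeff ma a' * coeff mb b' ≠ 0 :=
    mul_ne_zero (fun h => hca (by rw [h, map_zero])) (fun h => hcb (by rw [h, map_zero]))
  obtain ⟨ψ, hψ⟩ := exists_algHom_apply_ne_zero (k := k) hw
  have hab' : map (algebraMap k R) p = a' * b' := by
    apply map_injective (algebraMap R K) (FaithfulSMul.algebraMap_injective R K)
    rw [map_map, ← IsScalarTower.algebraMap_eq, hab, map_mul]
  have hp' : p = map (ψ : R →+* k) a' * map (ψ : R →+* k) b' := by
    rw [← map_mul, ← hab', map_map, ψ.comp_algebraMap]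
    exact (map_id p).symm
  rw [map_mul] at hψ
  rcases hp.isUnit_or_isUnit hp' with h | h
  · have := coeff_eq_zero_of_isUnit h hma
    rw [coeff_map] at this
    exact hψ (by rw [← RingHom.coe_coe, this, zero_mul])
  · have := coeff_eq_zero_of_isUnit h hmb
    rw [coeff_map] at this
    exact hψ (by rw [← RingHom.coe_coe (f := ψ), this, mul_zero])

theorem dvd_of_map_dvd_map {k K : Type*} [Field k] [Field K] (f : k →+* K)
    {p q : MvPolynomial σ k} (hp : Irreducible (map f p)) (hq : Irreducible (map f q))
    (h : map f p ∣ map f q) : p ∣ q := by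
  obtain ⟨u, hu⟩ := hp.associated_of_dvd hq h
  obtain ⟨c, -, hc⟩ := isUnit_iff_eq_C_of_isReduced.1 u.isUnit
  rw [hc, mul_comm] at hu
  have hu' (m) : c * f (coeff m p) = f (coeff m q) := by
    rw [← coeff_map, ← coeff_map, ← hu, coeff_C_mul]
  obtain ⟨m, hm⟩ : ∃ m, coeff m p ≠ 0 := by
    by_contra! h
    exact hp.ne_zero (by rw [show p = 0 by ext m; simpa using h m, map_zero])
  refine ⟨C (coeff m q / coeff m p), ?_⟩
  apply map_injective f f.injective
  have hm' : f (coeff m p) ≠ 0 := by simpa using hm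
  have : c = f (coeff m q / coeff m p) := by
    rw [map_div₀, ← hu', mul_div_cancel_right₀ _ hm']
  rw [map_mul, map_C, ← this, ← hu, mul_comm]

theorem _root_.HasIrreducibleFactors.map_of_isAlgClosed {k K : Type*} [Field k] [IsAlgClosed k]
    [Field K] [Algebra k K] {p : MvPolynomial σ k} {N : ℕ} (h : HasIrreducibleFactors N p) :
    HasIrreducibleFactors N (map (algebraMap k K) p) := by
  obtain ⟨q, e, hq, he, hd, has⟩ := h
  refine ⟨fun i => map (algebraMap k K) (q i), e, fun i => irreducible_map_of_isAlgClosed (hq i),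
    he, fun i j hij h => hd i j hij ?_, ?_⟩
  · exact dvd_of_map_dvd_map _ (irreducible_map_of_isAlgClosed (hq i))
      (irreducible_map_of_isAlgClosed (hq j)) h
  · simpa using has.map (map (algebraMap k K))

end MvPolynomial

theorem Ultrafilter.isAlgClosed_germ {X k : Type*} [Field k] [IsAlgClosed k] (U : Ultrafilter X) :
    IsAlgClosed ((U : Filter X).Germ k) := by
  refine IsAlgClosed.of_exists_root _ fun p hp hirr => ?_
  let γ := Filter.Germ.coeRingHom (R := k) (U : Filter X)
  have hγ : Function.Surjective γ := Quotient.mk_surjective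
  obtain ⟨P, rfl, hdeg, hP⟩ := Polynomial.lifts_and_natDegree_eq_and_monic
    ((Polynomial.mem_lifts p).2 (Polynomial.map_surjective γ hγ p)) hp
  have hroot (x : X) : ∃ z : k,
      Polynomial.eval z (P.map (Pi.evalRingHom (fun _ : X => k) x)) = 0 := by
    refine IsAlgClosed.exists_root _ fun h => ?_
    have h1 := hirr.natDegree_pos
    rw [← hdeg, ← hP.natDegree_map (Pi.evalRingHom (fun _ : X => k) x),
      Polynomial.natDegree_eq_of_degree_eq_some h] at h1
    exact lt_irrefl _ h1
  choose z hz using hroot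
  refine ⟨γ z, ?_⟩
  rw [Polynomial.eval_map_apply]
  have : Polynomial.eval z P = 0 := by
    ext x
    have := hz x
    rwa [show z x = Pi.evalRingHom (fun _ : X => k) x z from rfl, Polynomial.eval_map_apply] at this
  rw [this, map_zero]

namespace MvPolynomial

variable {X k σ : Type*} [Field k]

theorem map_germ_eq_map_germ_iff (l : Filter X) {f g : MvPolynomial σ (X → k)} :
    map (Filter.Germ.coeRingHom l) f = map (Filter.Germ.coeRingHom l) g ↔
      ∀ᶠ x in l, map (Pi.evalRingHom (fun _ : X => k) x) f = map (Pi.evalRingHom _ x) g := by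
  have h1 : map (Filter.Germ.coeRingHom l) f = map (Filter.Germ.coeRingHom l) g ↔
      ∀ m ∈ f.support ∪ g.support, ∀ᶠ x in l, coeff m f x = coeff m g x := by
    constructor
    · intro h m _
      have := congrArg (coeff m) h
      rw [coeff_map, coeff_map] at this
      exact Filter.Germ.coe_eq.1 this
    · intro h
      ext m
      rw [coeff_map, coeff_map]
      by_cases hm : m ∈ f.support ∪ g.support
      · exact Filter.Germ.coe_eq.2 (h m hm)
      · rw [Finset.notMem_union, notMem_support_iff, notMem_support_iff] at hm
        rw [hm.1, hm.2]
  rw [h1, ← Filter.eventually_all_finset]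
  refine Filter.eventually_congr
    (Filter.Eventually.of_forall fun x => ⟨fun h => ?_, fun h m _ => ?_⟩)
  · ext m
    rw [coeff_map, coeff_map]
    by_cases hm : m ∈ f.support ∪ g.support
    · exact h m hm
    · rw [Finset.notMem_union, notMem_support_iff, notMem_support_iff] at hm
      rw [hm.1, hm.2]
  · have := congrArg (coeff m) h
    rwa [coeff_map, coeff_map] at this

theorem exists_forall_map_eval_eq [Finite σ] (Φ : X → MvPolynomial σ k) {D : ℕ}
    (hD : ∀ x, (Φ x).totalDegree ≤ D) :
    ∃ f : MvPolynomial σ (X → k), ∀ x, map (Pi.evalRingHom (fun _ : X => k) x) f = Φ x := by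
  refine ⟨∑ m ∈ (Finsupp.finite_of_degree_le (σ := σ) D).toFinset,
    monomial m fun x => coeff m (Φ x), fun x => ?_⟩
  ext m
  simp only [map_sum, map_monomial, coeff_sum, coeff_monomial, Pi.evalRingHom_apply,
    Finset.sum_ite_eq', Set.Finite.mem_toFinset, Set.mem_ofPred_eq]
  split_ifs with h
  · rfl
  · by_contra hne
    refine h (le_trans ?_ (hD x))
    exact le_totalDegree (mem_support_iff.2 (Ne.symm hne))

theorem totalDegree_map_eval_le (f : MvPolynomial σ (X → k)) (x : X) :
    (map (Pi.evalRingHom (fun _ : X => k) x) f).totalDegree ≤ f.totalDegree :=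
  Finset.sup_mono (support_map_subset _ _)

theorem eventually_isUnit_map_eval (U : Ultrafilter X) {f : MvPolynomial σ (X → k)}
    (h : IsUnit (map (Filter.Germ.coeRingHom (U : Filter X)) f)) :
    ∀ᶠ x in U, IsUnit (map (Pi.evalRingHom (fun _ : X => k) x) f) := by
  obtain ⟨g', hg⟩ := h.exists_right_inv
  obtain ⟨g, rfl⟩ := map_surjective _ (show Function.Surjective
    (Filter.Germ.coeRingHom (R := k) (U : Filter X)) from Quotient.mk_surjective) g'
  rw [← map_mul, ← map_one (map (σ := σ) (Filter.Germ.coeRingHom (R := k) (U : Filter X))),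
    map_germ_eq_map_germ_iff] at hg
  filter_upwards [hg] with x hx
  rw [map_mul, map_one] at hx
  exact IsUnit.of_mul_eq_one _ hx

theorem eventually_irreducible_map_eval [Finite σ] (U : Ultrafilter X) {f : MvPolynomial σ (X → k)}
    (h : Irreducible (map (Filter.Germ.coeRingHom (U : Filter X)) f)) :
    ∀ᶠ x in U, Irreducible (map (Pi.evalRingHom (fun _ : X => k) x) f) := by
  by_contra hcon
  rw [← Ultrafilter.eventually_not] at hcon
  have h0 : ∀ᶠ x in U, map (Pi.evalRingHom (fun _ : X => k) x) f ≠ 0 := by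
    rw [Ultrafilter.eventually_not]
    intro h0
    refine h.ne_zero ?_
    rw [← map_zero (map (σ := σ) (Filter.Germ.coeRingHom (R := k) (U : Filter X))),
      map_germ_eq_map_germ_iff]
    simpa using h0
  have hu : ∀ᶠ x in U, ¬ IsUnit (map (Pi.evalRingHom (fun _ : X => k) x) f) := by
    rw [Ultrafilter.eventually_not]
    intro hu
    have hc (x : X) : (if IsUnit (map (Pi.evalRingHom (fun _ : X => k) x) f) then
      C (coeff 0 f x)⁻¹ else 0 : MvPolynomial σ k).totalDegree ≤ 0 := by
      split_ifs <;> simp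
    obtain ⟨g, hg⟩ := exists_forall_map_eval_eq _ hc
    refine h.not_isUnit (IsUnit.of_mul_eq_one (map (Filter.Germ.coeRingHom (U : Filter X)) g) ?_)
    rw [← map_mul, ← map_one (map (σ := σ) (Filter.Germ.coeRingHom (R := k) (U : Filter X))),
      map_germ_eq_map_germ_iff]
    filter_upwards [hu] with x hx
    rw [map_mul, map_one, hg, if_pos hx]
    obtain ⟨r, hr, hrx⟩ := isUnit_iff_eq_C_of_isReduced.1 hx
    have : coeff 0 f x = r := by
      have := congrArg (coeff 0) hrx
      rwa [coeff_map, coeff_zero_C] at this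
    rw [hrx, this, ← C_mul, mul_inv_cancel₀ hr.ne_zero, C_1]
  have hfac (x : X) : ∃ a b : MvPolynomial σ k, a.totalDegree ≤ f.totalDegree ∧
      b.totalDegree ≤ f.totalDegree ∧
      (¬ Irreducible (map (Pi.evalRingHom (fun _ : X => k) x) f) →
        map (Pi.evalRingHom (fun _ : X => k) x) f ≠ 0 →
        ¬ IsUnit (map (Pi.evalRingHom (fun _ : X => k) x) f) →
        map (Pi.evalRingHom (fun _ : X => k) x) f = a * b ∧ ¬ IsUnit a ∧ ¬ IsUnit b) := by
    by_cases hx : ¬ Irreducible (map (Pi.evalRingHom (fun _ : X => k) x) f) ∧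
        map (Pi.evalRingHom (fun _ : X => k) x) f ≠ 0 ∧
        ¬ IsUnit (map (Pi.evalRingHom (fun _ : X => k) x) f)
    · obtain ⟨hx1, hx2, hx3⟩ := hx
      rw [irreducible_iff] at hx1
      push Not at hx1
      obtain ⟨a, b, hab, ha, hb⟩ := hx1 hx3
      have hne := hx2
      rw [hab] at hne
      have hdeg := totalDegree_map_eval_le f x
      rw [hab, totalDegree_mul_of_isDomain (left_ne_zero_of_mul hne)
        (right_ne_zero_of_mul hne)] at hdeg
      exact ⟨a, b, by omega, by omega, fun _ _ _ => ⟨hab, ha, hb⟩⟩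
    · exact ⟨0, 0, by simp, by simp, fun h1 h2 h3 => absurd ⟨h1, h2, h3⟩ hx⟩
  choose a b ha hb hab using hfac
  obtain ⟨a', ha'⟩ := exists_forall_map_eval_eq a ha
  obtain ⟨b', hb'⟩ := exists_forall_map_eval_eq b hb
  have hprod : map (Filter.Germ.coeRingHom (U : Filter X)) f =
      map (Filter.Germ.coeRingHom (U : Filter X)) a' *
        map (Filter.Germ.coeRingHom (U : Filter X)) b' := by
    rw [← map_mul, map_germ_eq_map_germ_iff]
    filter_upwards [hcon, h0, hu] with x h1 h2 h3
    rw [map_mul, ha', hb', (hab x h1 h2 h3).1]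
  rcases h.isUnit_or_isUnit hprod with h' | h'
  · obtain ⟨x, h1, h2, h3, h4⟩ :=
      (hcon.and (h0.and (hu.and (eventually_isUnit_map_eval U h')))).exists
    exact (hab x h1 h2 h3).2.1 (ha' x ▸ h4)
  · obtain ⟨x, h1, h2, h3, h4⟩ :=
      (hcon.and (h0.and (hu.and (eventually_isUnit_map_eval U h')))).exists
    exact (hab x h1 h2 h3).2.2 (hb' x ▸ h4)

theorem eventually_not_map_eval_dvd [Finite σ] (U : Ultrafilter X) {f g : MvPolynomial σ (X → k)}
    (hg : map (Filter.Germ.coeRingHom (U : Filter X)) g ≠ 0)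
    (h : ¬ map (Filter.Germ.coeRingHom (U : Filter X)) f ∣
      map (Filter.Germ.coeRingHom (U : Filter X)) g) :
    ∀ᶠ x in U, ¬ map (Pi.evalRingHom (fun _ : X => k) x) f ∣ map (Pi.evalRingHom _ x) g := by
  rw [Ultrafilter.eventually_not]
  intro hcon
  have h0 : ∀ᶠ x in U, map (Pi.evalRingHom (fun _ : X => k) x) g ≠ 0 := by
    rw [Ultrafilter.eventually_not]
    intro h0
    refine hg ?_
    rw [← map_zero (map (σ := σ) (Filter.Germ.coeRingHom (R := k) (U : Filter X))),
      map_germ_eq_map_germ_iff]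
    simpa using h0
  have hfac (x : X) : ∃ a : MvPolynomial σ k, a.totalDegree ≤ g.totalDegree ∧
      (map (Pi.evalRingHom (fun _ : X => k) x) g ≠ 0 →
        map (Pi.evalRingHom (fun _ : X => k) x) f ∣ map (Pi.evalRingHom _ x) g →
        map (Pi.evalRingHom _ x) g = map (Pi.evalRingHom (fun _ : X => k) x) f * a) := by
    by_cases hx : map (Pi.evalRingHom (fun _ : X => k) x) g ≠ 0 ∧
        map (Pi.evalRingHom (fun _ : X => k) x) f ∣ map (Pi.evalRingHom _ x) g
    · obtain ⟨hx1, a, ha⟩ := hx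
      have hne := hx1
      rw [ha] at hne
      have hdeg := totalDegree_map_eval_le g x
      rw [ha, totalDegree_mul_of_isDomain (left_ne_zero_of_mul hne)
        (right_ne_zero_of_mul hne)] at hdeg
      exact ⟨a, by omega, fun _ _ => ha⟩
    · exact ⟨0, by simp, fun h1 h2 => absurd ⟨h1, h2⟩ hx⟩
  choose a ha hab using hfac
  obtain ⟨a', ha'⟩ := exists_forall_map_eval_eq a ha
  refine h ⟨map (Filter.Germ.coeRingHom (U : Filter X)) a', ?_⟩
  rw [← map_mul, map_germ_eq_map_germ_iff]
  filter_upwards [hcon, h0] with x h1 h2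
  rw [map_mul, ha', hab x h2 h1]

theorem eventually_hasIrreducibleFactors_map_eval [Finite σ] (U : Ultrafilter X)
    {f : MvPolynomial σ (X → k)} {N : ℕ}
    (h : HasIrreducibleFactors N (map (Filter.Germ.coeRingHom (U : Filter X)) f)) :
    ∀ᶠ x in U, HasIrreducibleFactors N (map (Pi.evalRingHom (fun _ : X => k) x) f) := by
  obtain ⟨q', e, hq, he, hd, u, hu⟩ := h
  have hsurj := map_surjective (σ := σ) _ (show Function.Surjective
    (Filter.Germ.coeRingHom (R := k) (U : Filter X)) from Quotient.mk_surjective)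
  choose q hq' using fun i => hsurj (q' i)
  obtain rfl : (fun i => map (Filter.Germ.coeRingHom (U : Filter X)) (q i)) = q' :=
    _root_.funext hq'
  obtain ⟨v, hv⟩ := hsurj u
  have hv1 := eventually_isUnit_map_eval U (hv ▸ u.isUnit)
  rw [← hv, ← map_mul] at hu
  have hu2 : map (Filter.Germ.coeRingHom (U : Filter X)) (f * v) =
      map (Filter.Germ.coeRingHom (U : Filter X)) (∏ i, q i ^ e i) := by
    rw [hu, map_prod]; simp only [map_pow]
  rw [map_germ_eq_map_germ_iff] at hu2
  have hirr : ∀ᶠ x in U, ∀ i, Irreducible (map (Pi.evalRingHom (fun _ : X => k) x) (q i)) :=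
    Filter.eventually_all.2 fun i => eventually_irreducible_map_eval U (hq i)
  have hdvd : ∀ᶠ x in U, ∀ i j, i ≠ j → ¬ map (Pi.evalRingHom (fun _ : X => k) x) (q i) ∣
      map (Pi.evalRingHom (fun _ : X => k) x) (q j) := by
    simp only [Filter.eventually_all]
    exact fun i j hij => eventually_not_map_eval_dvd U (hq j).ne_zero (hd i j hij)
  filter_upwards [hv1, hu2, hirr, hdvd] with x h1 h2 h3 h4
  refine ⟨_, e, h3, he, h4, h1.unit, ?_⟩
  rw [IsUnit.unit_spec, ← map_mul, h2, map_prod]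
  simp only [map_pow]

/-- For a filter of points at which every nonzero element of `A` is eventually nonzero, the number
of irreducible factors of the specializations of a polynomial is eventually constant. -/
theorem exists_eventually_hasIrreducibleFactors [Finite σ] [IsAlgClosed k] {A : Type*} [CommRing A]
    [IsDomain A] (ev : X → A →+* k) (l : Filter X) (hl : ∀ a, a ≠ 0 → ∀ᶠ x in l, ev x a ≠ 0)
    {g : MvPolynomial σ A} (hg : g ≠ 0) :
    ∃ N, ∀ᶠ x in l, HasIrreducibleFactors N (map (ev x) g) := by
  let Ω := AlgebraicClosure (FractionRing A)
  have hAΩ : Function.Injective (algebraMap A Ω) := by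
    rw [IsScalarTower.algebraMap_eq A (FractionRing A) Ω]
    exact (algebraMap (FractionRing A) Ω).injective.comp (IsFractionRing.injective A _)
  have : FaithfulSMul A Ω := (faithfulSMul_iff_algebraMap_injective _ _).2 hAΩ
  obtain ⟨N, hN⟩ := exists_hasIrreducibleFactors (p := map (algebraMap A Ω) g)
    (fun h => hg (map_injective _ hAΩ (by rw [h, map_zero])))
  refine ⟨N, Filter.mem_iff_ultrafilter.2 fun U hU => ?_⟩
  have := U.isAlgClosed_germ (k := k)
  let ε : A →+* (X → k) := RingHom.pi ev
  let ι : A →+* (U : Filter X).Germ k := (Filter.Germ.coeRingHom (U : Filter X)).comp ε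
  let _ : Algebra A ((U : Filter X).Germ k) := ι.toAlgebra
  have hι : Function.Injective ι := by
    rw [injective_iff_map_eq_zero]
    intro a ha
    by_contra hne
    have h1 : ∀ᶠ x in U, ev x a = 0 := Filter.Germ.coe_eq.1 ha
    obtain ⟨x, hx, hx'⟩ := (h1.and (hU (hl a hne))).exists
    exact hx' hx
  have : FaithfulSMul A ((U : Filter X).Germ k) :=
    (faithfulSMul_iff_algebraMap_injective _ _).2 hι
  have : Algebra.IsAlgebraic A Ω :=
    (IsFractionRing.comap_isAlgebraic_iff (K := FractionRing A)).2 inferInstance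
  let ψ : Ω →ₐ[A] (U : Filter X).Germ k := IsAlgClosed.lift
  let _ : Algebra Ω ((U : Filter X).Germ k) := ψ.toRingHom.toAlgebra
  have h1 := hN.map_of_isAlgClosed (K := (U : Filter X).Germ k)
  have hcomp : (algebraMap Ω ((U : Filter X).Germ k)).comp (algebraMap A Ω) = ι := ψ.comp_algebraMap
  rw [map_map, hcomp, ← map_map] at h1
  have h2 := eventually_hasIrreducibleFactors_map_eval U h1
  filter_upwards [h2] with x hx
  rwa [map_map] at hx

end MvPolynomial

namespace MvPolynomial

/-- Generic flatness in elementary form: after inverting a nonzero element of `A`, the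
ideal `I` meets every extended ideal in their product. -/
theorem exists_pow_mul_mem_map_mul {σ A : Type*} [Finite σ] [CommRing A] [IsDomain A]
    (M : MonomialOrder σ) (I : Ideal (MvPolynomial σ A)) :
    ∃ a : A, a ≠ 0 ∧ ∀ (J : Ideal A) (f : MvPolynomial σ A), f ∈ I → f ∈ J.map C →
      ∃ n : ℕ, C (a ^ n) * f ∈ J.map C * I := by
  let S : Set (σ →₀ ℕ) := {d | ∃ f ∈ I, f ≠ 0 ∧ M.degree f = d}
  have hfin : {d | Minimal (· ∈ S) d}.Finite :=
    (setOfPred_minimal_antichain (· ∈ S)).finite_of_wellQuasiOrdered wellQuasiOrdered_le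
  have hS (d : {d | Minimal (· ∈ S) d}) : ∃ f ∈ I, f ≠ 0 ∧ M.degree f = d.1 := d.2.prop
  choose F hFI hF0 hFd using hS
  have := hfin.fintype
  refine ⟨∏ d, M.leadingCoeff (F d), Finset.prod_ne_zero_iff.2 fun d _ =>
    M.leadingCoeff_ne_zero_iff.2 (hF0 d), fun J f => ?_⟩
  set a := ∏ d, M.leadingCoeff (F d) with ha
  induction hs : M.toSyn (M.degree f) using WellFoundedLT.induction generalizing f with
  | _ s ih =>
  intro hfI hfJ
  by_cases hf0 : f = 0
  · exact ⟨0, by simp [hf0]⟩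
  obtain ⟨d, hdle, hd⟩ := exists_minimal_le_of_wellFoundedLT (· ∈ S) (M.degree f) ⟨f, hfI, hf0, rfl⟩
  obtain ⟨e, he⟩ := exists_add_of_le hdle
  obtain ⟨b, hb⟩ := Finset.dvd_prod_of_mem (fun d => M.leadingCoeff (F d))
    (Finset.mem_univ (⟨d, hd⟩ : {d | Minimal (· ∈ S) d}))
  rw [← ha] at hb
  set g := C a * f - monomial e (b * M.leadingCoeff f) * F ⟨d, hd⟩ with hg
  have hlc : M.leadingCoeff f ∈ J := mem_map_C_iff.1 hfJ _
  have hmon : monomial e (b * M.leadingCoeff f) ∈ J.map (C : A →+* MvPolynomial σ A) := by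
    rw [mem_map_C_iff]
    intro m
    rw [coeff_monomial]
    split_ifs
    · exact J.mul_mem_left _ hlc
    · exact J.zero_mem
  have hgI : g ∈ I := I.sub_mem (I.mul_mem_left _ hfI) (I.mul_mem_left _ (hFI _))
  have hgJ : g ∈ J.map (C : A →+* MvPolynomial σ A) :=
    Ideal.sub_mem _ (Ideal.mul_mem_left _ _ hfJ) (Ideal.mul_mem_right _ _ hmon)
  have hmem : monomial e (b * M.leadingCoeff f) * F ⟨d, hd⟩ ∈ J.map C * I :=
    Ideal.mul_mem_mul hmon (hFI _)
  have hcoeff : coeff (M.degree f) g = 0 := by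
    have h1 : M.degree f = e + M.degree (F ⟨d, hd⟩) := by rw [hFd, he, add_comm]
    rw [hg, coeff_sub, coeff_C_mul]
    nth_rewrite 2 [h1]
    rw [coeff_monomial_mul, hb]
    change M.leadingCoeff _ * _ * M.leadingCoeff f - _ * M.leadingCoeff (F ⟨d, hd⟩) = 0
    ring
  have hdeg : M.toSyn (M.degree g) ≤ M.toSyn (M.degree f) := by
    refine M.degree_sub_le.trans (sup_le ?_ ?_)
    · refine M.degree_mul_le.trans ?_
      rw [M.degree_C, zero_add]
    · refine M.degree_mul_le.trans ?_
      rw [he, add_comm d, hFd, map_add, map_add]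
      exact add_le_add_left (M.degree_monomial_le _) _
  obtain ⟨n, hn⟩ : ∃ n : ℕ, C (a ^ n) * g ∈ J.map C * I := by
    by_cases hg0 : g = 0
    · exact ⟨0, by simp [hg0]⟩
    refine ih _ ?_ g rfl hgI hgJ
    rw [← hs]
    refine lt_of_le_of_ne hdeg fun h => ?_
    have := M.coeff_degree_ne_zero_iff.2 hg0
    rw [M.toSyn.injective h] at this
    exact this hcoeff
  refine ⟨n + 1, ?_⟩
  have : C (a ^ (n + 1)) * f =
      C (a ^ n) * g + C (a ^ n) * (monomial e (b * M.leadingCoeff f) * F ⟨d, hd⟩) := by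
    rw [hg, pow_succ, C_mul]; ring
  rw [this]
  exact Ideal.add_mem _ hn (Ideal.mul_mem_left _ _ hmem)

end MvPolynomial

/-- A nonzero element of a finitely generated domain over `A` is a nonzerodivisor modulo `J`,
for every ideal `J` of a nonempty open subset of `Spec A`. -/
theorem Algebra.FiniteType.exists_pow_smul_mem_map {A D : Type*} [CommRing A] [IsDomain A]
    [CommRing D] [IsDomain D] [Algebra A D] [Algebra.FiniteType A D] {b : D} (hb : b ≠ 0) :
    ∃ a : A, a ≠ 0 ∧ ∀ (J : Ideal A) (f : D), b * f ∈ J.map (algebraMap A D) →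
      ∃ n : ℕ, a ^ n • f ∈ J.map (algebraMap A D) := by
  obtain ⟨n, φ, hφ, hφC⟩ : ∃ (n : ℕ) (φ : MvPolynomial (Fin n) A →+* D),
      Function.Surjective φ ∧ φ.comp MvPolynomial.C = algebraMap A D := by
    obtain ⟨n, φ, hφ⟩ := Algebra.FiniteType.iff_quotient_mvPolynomial''.1 ‹Algebra.FiniteType A D›
    exact ⟨n, φ.toRingHom, hφ, φ.comp_algebraMap⟩
  obtain ⟨b, rfl⟩ := hφ b
  have hmap (J : Ideal A) : J.map (algebraMap A D) = (J.map MvPolynomial.C).map φ := by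
    rw [Ideal.map_map, hφC]
  let K : Ideal (MvPolynomial (Fin n) A) := RingHom.ker φ
  obtain ⟨a, ha, h⟩ := MvPolynomial.exists_pow_mul_mem_map_mul
    (MonomialOrder.lex (σ := Fin n)) (Ideal.span {b} ⊔ K)
  refine ⟨a, ha, fun J f hf => ?_⟩
  obtain ⟨f, rfl⟩ := hφ f
  rw [← map_mul, hmap, Ideal.mem_map_iff_of_surjective φ hφ] at hf
  obtain ⟨g, hg, hgf⟩ := hf
  have hgK : g - b * f ∈ K := by rw [RingHom.mem_ker, map_sub, hgf, sub_self]
  have hgI : g ∈ Ideal.span {b} ⊔ K := by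
    have : g = b * f + (g - b * f) := by ring
    rw [this]
    exact Ideal.add_mem _
      (Ideal.mem_sup_left (Ideal.mul_mem_right _ _ (Ideal.mem_span_singleton_self b)))
      (Ideal.mem_sup_right hgK)
  obtain ⟨k, hk⟩ := h J g hgI hg
  refine ⟨k, ?_⟩
  rw [Ideal.mul_sup] at hk
  obtain ⟨u, hu, v, hv, huv⟩ := Submodule.mem_sup.1 hk
  rw [mul_comm, Ideal.mem_span_singleton_mul] at hu
  obtain ⟨w, hw, rfl⟩ := hu
  have hvK : v ∈ K := Ideal.mul_le_right (I := J.map MvPolynomial.C) hv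
  have hv' : φ v = 0 := hvK
  have h1 : φ b * φ w = φ b * (a ^ k • φ f) := by
    have := congrArg φ huv
    rw [map_add, hv', add_zero, map_mul, map_mul, hgf, map_mul] at this
    rw [this, Algebra.smul_def, ← hφC, RingHom.comp_apply]
    ring
  rw [← mul_left_cancel₀ hb h1, hmap]
  exact Ideal.mem_map_of_mem _ hw

theorem Ideal.ncard_minimalPrimes_comap_of_surjective {R S : Type*} [CommRing R] [CommRing S]
    {f : R →+* S} (hf : Function.Surjective f) (I : Ideal S) :
    (I.comap f).minimalPrimes.ncard = I.minimalPrimes.ncard := by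
  rw [Ideal.comap_minimalPrimes_eq_of_surjective hf,
    Set.ncard_image_of_injective _ (Ideal.comap_injective_of_surjective f hf)]

theorem Ideal.ncard_minimalPrimes_map_of_isLocalization {R S : Type*} [CommRing R] [CommRing S]
    [Algebra R S] (M : Submonoid R) [IsLocalization M S] (I : Ideal R)
    (h : ∀ b ∈ M, ∀ f, b * f ∈ I → f ∈ I) :
    (I.map (algebraMap R S)).minimalPrimes.ncard = I.minimalPrimes.ncard := by
  rw [IsLocalization.minimalPrimes_map M S I]
  refine Set.ncard_preimage_of_injective_subset_range
    (IsLocalization.orderEmbedding M S).injective fun p hp => ?_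
  have := hp.isPrime
  refine ⟨p.map (algebraMap R S), IsLocalization.under_map_of_isPrime_disjoint M S this ?_⟩
  rw [Set.disjoint_left]
  intro b hb hbp
  obtain ⟨y, hy, hyb⟩ := Ideal.exists_mul_mem_of_mem_minimalPrimes hp hbp
  exact hy (h b hb y hyb)

theorem Ideal.IsMaximal.mem_map_of_pow_smul_mem {A B : Type*} [CommRing A] [CommRing B]
    [Algebra A B] {J : Ideal A} (hJ : J.IsMaximal) {a : A} (ha : a ∉ J) {f : B} {n : ℕ}
    (hf : a ^ n • f ∈ J.map (algebraMap A B)) : f ∈ J.map (algebraMap A B) := by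
  obtain ⟨y, i, hi, hyi⟩ := hJ.exists_inv fun h => ha (hJ.isPrime.mem_of_pow_mem n h)
  have : f = algebraMap A B y * a ^ n • f + algebraMap A B i * f := by
    rw [Algebra.smul_def, ← mul_assoc, ← map_mul, ← add_mul, ← map_add, hyi, map_one, one_mul]
  rw [this]
  exact Ideal.add_mem _ (Ideal.mul_mem_left _ _ hf)
    (Ideal.mul_mem_right _ _ (Ideal.mem_map_of_mem _ hi))

theorem Ideal.mem_of_mul_mem_of_mem_powers {B : Type*} [CommRing B] {I : Ideal B} {b : B}
    (hI : ∀ f, b * f ∈ I → f ∈ I) : ∀ c ∈ Submonoid.powers b, ∀ f, c * f ∈ I → f ∈ I := by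
  rintro _ ⟨n, rfl⟩ f
  induction n with
  | zero => simp
  | succ n ih =>
    intro hf
    refine ih (hI _ ?_)
    rwa [← mul_assoc, ← pow_succ']

/-- Two finitely generated domains over `A` with a common localization have, over general maximal
ideals of `A`, fibers with the same number of irreducible components. -/
theorem Algebra.FiniteType.exists_ncard_minimalPrimes_eq {A D D' : Type*} [CommRing A] [IsDomain A]
    [CommRing D] [IsDomain D] [Algebra A D] [Algebra.FiniteType A D]
    [CommRing D'] [IsDomain D'] [Algebra A D'] [Algebra.FiniteType A D']
    (φ : D →ₐ[A] D') (hφ : Function.Injective φ) {b : D} (hb : b ≠ 0)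
    (h : ∀ x : D', ∃ (n : ℕ) (d : D), φ b ^ n * x = φ d) :
    ∃ a : A, a ≠ 0 ∧ ∀ J : Ideal A, J.IsMaximal → a ∉ J →
      (J.map (algebraMap A D)).minimalPrimes.ncard =
        (J.map (algebraMap A D')).minimalPrimes.ncard := by
  have hb' : φ b ≠ 0 := fun h => hb (hφ (by rw [h, map_zero]))
  obtain ⟨a₁, ha₁, h₁⟩ := Algebra.FiniteType.exists_pow_smul_mem_map (A := A) hb
  obtain ⟨a₂, ha₂, h₂⟩ := Algebra.FiniteType.exists_pow_smul_mem_map (A := A) hb'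
  refine ⟨a₁ * a₂, mul_ne_zero ha₁ ha₂, fun J hJ ha => ?_⟩
  let S := Localization.Away (φ b)
  let _ : Algebra D S := ((algebraMap D' S).comp φ.toRingHom).toAlgebra
  have hS (d : D) : algebraMap D S d = algebraMap D' S (φ d) := rfl
  have hinj : Function.Injective (algebraMap D' S) :=
    IsLocalization.injective S (powers_le_nonZeroDivisors_of_noZeroDivisors hb')
  have : IsLocalization (Submonoid.powers b) S := by
    rw [isLocalization_iff]
    refine ⟨?_, fun z => ?_, fun {x y} hxy => ⟨1, ?_⟩⟩
    · rintro ⟨_, n, rfl⟩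
      simp only [hS, map_pow]
      exact (IsLocalization.Away.algebraMap_isUnit (S := S) (φ b)).pow n
    · obtain ⟨⟨x, _, n, rfl⟩, hx⟩ := IsLocalization.surj (Submonoid.powers (φ b)) z
      obtain ⟨m, d, hd⟩ := h x
      refine ⟨⟨d, ⟨b ^ (n + m), n + m, rfl⟩⟩, ?_⟩
      simp only [hS] at hx ⊢
      rw [← hd, map_mul, ← hx, map_pow, map_pow, map_pow, map_pow, pow_add]
      ring
    · rw [hφ (hinj hxy)]
  have e₁ := Ideal.ncard_minimalPrimes_map_of_isLocalization (S := S) (Submonoid.powers b)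
    (J.map (algebraMap A D)) (Ideal.mem_of_mul_mem_of_mem_powers fun f hf => by
      obtain ⟨n, hn⟩ := h₁ J f hf
      exact hJ.mem_map_of_pow_smul_mem (fun h => ha (J.mul_mem_right _ h)) hn)
  have e₂ := Ideal.ncard_minimalPrimes_map_of_isLocalization (S := S) (Submonoid.powers (φ b))
    (J.map (algebraMap A D')) (Ideal.mem_of_mul_mem_of_mem_powers fun f hf => by
      obtain ⟨n, hn⟩ := h₂ J f hf
      exact hJ.mem_map_of_pow_smul_mem (fun h => ha (J.mul_mem_left _ h)) hn)
  rw [← e₁, ← e₂, Ideal.map_map, Ideal.map_map]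
  congr 4
  ext x
  exact congrArg (algebraMap D' S) (φ.commutes x)

open Polynomial in
theorem Polynomial.exists_eq_span_singleton_of_comap_C_eq_bot {R : Type*} [CommRing R] [IsDomain R]
    [UniqueFactorizationMonoid R] {P : Ideal R[X]} [hP : P.IsPrime] (hne : P ≠ ⊥)
    (h0 : P.comap C = ⊥) : ∃ g, g ≠ 0 ∧ P = Ideal.span {g} := by
  have hC {c : R} (hc : C c ∈ P) : c = 0 := by
    have : c ∈ P.comap C := hc
    rwa [h0] at this
  obtain ⟨f₀, hf₀P, hf₀⟩ := Submodule.exists_mem_ne_zero_of_ne_bot hne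
  obtain ⟨f, ⟨hfP, hf0⟩, hmin⟩ := WellFounded.has_min (measure (natDegree (R := R))).wf
    {f | f ∈ P ∧ f ≠ 0} ⟨f₀, hf₀P, hf₀⟩
  replace hmin (q : R[X]) (hq : q ∈ P) (hq0 : q ≠ 0) : f.natDegree ≤ q.natDegree :=
    not_lt.1 (hmin q ⟨hq, hq0⟩)
  obtain ⟨g, hgP, hg, r, hr⟩ : ∃ g ∈ P, Prime g ∧ g ∣ f := by
    have hfac : ∃ s : Multiset R[X], (∀ p ∈ s, Prime p) ∧ Associated s.prod f :=
      UniqueFactorizationMonoid.exists_prime_factors f hf0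
    obtain ⟨s, hs, u, hu⟩ := hfac
    have : s.prod ∈ P := by
      rw [← hu] at hfP
      exact (hP.mem_or_mem hfP).resolve_right fun h => hP.ne_top (P.eq_top_of_isUnit_mem h u.isUnit)
    obtain ⟨g, hgs, hgP⟩ := (hP.multiset_prod_mem_iff_exists_mem s).1 this
    exact ⟨g, hgP, hs g hgs, (Multiset.dvd_prod hgs).trans (Dvd.intro _ hu)⟩
  have hgmin (q : R[X]) (hq : q ∈ P) (hq0 : q ≠ 0) : g.natDegree ≤ q.natDegree :=
    (natDegree_le_of_dvd ⟨r, hr⟩ hf0).trans (hmin q hq hq0)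
  have hdiv (q : R[X]) (hq : q ∈ P) : ∃ c : R, c ≠ 0 ∧ g ∣ C c * q := by
    induction hn : q.degree using WellFoundedLT.induction generalizing q with
    | _ n ih =>
    by_cases hq0 : q = 0
    · exact ⟨1, one_ne_zero, by simp [hq0]⟩
    have hle := hgmin q hq hq0
    have hlcg := leadingCoeff_ne_zero.2 hg.ne_zero
    have hlcq := leadingCoeff_ne_zero.2 hq0
    set t := C g.leadingCoeff * q - C q.leadingCoeff * X ^ (q.natDegree - g.natDegree) * g with ht
    have hd1 : (C g.leadingCoeff * q).degree = q.degree := by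
      rw [degree_mul, degree_C hlcg, zero_add]
    have hlt : t.degree < q.degree := by
      rw [← hd1]
      refine degree_sub_lt_left ?_ (mul_ne_zero (C_ne_zero.2 hlcg) hq0) ?_
      · rw [hd1, degree_mul, degree_C_mul_X_pow _ hlcq, degree_eq_natDegree hq0,
          degree_eq_natDegree hg.ne_zero, ← Nat.cast_add, Nat.sub_add_cancel hle]
      · rw [leadingCoeff_mul, leadingCoeff_mul, leadingCoeff_C, leadingCoeff_C_mul_X_pow, mul_comm]
    obtain ⟨c, hc, hct⟩ := ih _ (hn ▸ hlt) t
      (P.sub_mem (P.mul_mem_left _ hq) (P.mul_mem_left _ hgP)) rfl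
    refine ⟨c * g.leadingCoeff, mul_ne_zero hc hlcg, ?_⟩
    have : C (c * g.leadingCoeff) * q =
        C c * t + C c * (C q.leadingCoeff * X ^ (q.natDegree - g.natDegree)) * g := by
      rw [ht, C_mul]; ring
    rw [this]
    exact dvd_add hct (dvd_mul_left _ _)
  refine ⟨g, hg.ne_zero, le_antisymm (fun q hq => ?_)
    ((Ideal.span_singleton_le_iff_mem _).2 hgP)⟩
  obtain ⟨c, hc, hcq⟩ := hdiv q hq
  rw [Ideal.mem_span_singleton]
  exact (hg.dvd_or_dvd hcq).resolve_left fun h => hc (hC (P.mem_of_dvd h hgP))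

theorem MvPolynomial.exists_eq_span_singleton_of_comap_rename_some_eq_bot {ι R : Type*} [CommRing R]
    [IsDomain R] [UniqueFactorizationMonoid R] {P : Ideal (MvPolynomial (Option ι) R)}
    [hP : P.IsPrime] (hne : P ≠ ⊥) (h0 : ∀ f : MvPolynomial ι R, rename some f ∈ P → f = 0) :
    ∃ g, g ≠ 0 ∧ P = Ideal.span {g} := by
  let e := (optionEquivLeft R ι).symm
  have hC (f : MvPolynomial ι R) : e (Polynomial.C f) = rename some f := by
    have : (e : _ →ₐ[R] MvPolynomial (Option ι) R).comp Polynomial.CAlgHom = rename some := by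
      ext
      simp [e]
    exact DFunLike.congr_fun this f
  have hbot : P.comap e ≠ ⊥ := by
    intro h
    obtain ⟨f, hf, hf0⟩ := Submodule.exists_mem_ne_zero_of_ne_bot hne
    have : e.symm f ∈ P.comap e := by rwa [Ideal.mem_comap, e.apply_symm_apply]
    rw [h, Ideal.mem_bot, EmbeddingLike.map_eq_zero_iff] at this
    exact hf0 this
  obtain ⟨g, hg, hPg⟩ := Polynomial.exists_eq_span_singleton_of_comap_C_eq_bot (P := P.comap e) hbot
    ((Submodule.eq_bot_iff _).2 fun f hf => h0 f (hC f ▸ hf))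
  refine ⟨e g, (EmbeddingLike.map_ne_zero_iff).2 hg, ?_⟩
  have h1 := congrArg (Ideal.map e) hPg
  rwa [Ideal.map_comap_of_surjective e e.surjective, Ideal.map_span, Set.image_singleton] at h1

theorem Subalgebra.exists_pow_mul_mem_of_fg {A L : Type*} [CommRing A] [Field L] [Algebra A L]
    (D : Subalgebra A L) {D' : Subalgebra A L} (hfg : D'.FG)
    (h : ∀ x : L, ∃ d ∈ D, d ≠ 0 ∧ d * x ∈ D) :
    ∃ b ∈ D, b ≠ 0 ∧ ∀ x ∈ D', ∃ n : ℕ, b ^ n * x ∈ D := by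
  obtain ⟨t, rfl⟩ := hfg
  choose d hdD hd0 hd using h
  have hbD : ∏ x ∈ t, d x ∈ D := D.prod_mem fun x _ => hdD x
  refine ⟨∏ x ∈ t, d x, hbD, Finset.prod_ne_zero_iff.2 fun x _ => hd0 x,
    fun x hx => ?_⟩
  induction hx using Algebra.adjoin_induction with
  | mem x hx =>
    refine ⟨1, ?_⟩
    rw [pow_one, ← Finset.prod_erase_mul t d hx, mul_assoc]
    exact D.mul_mem (D.prod_mem fun x _ => hdD x) (hd x)
  | algebraMap r => exact ⟨0, by simp⟩
  | add x y _ _ hx hy =>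
    obtain ⟨n, hn⟩ := hx
    obtain ⟨m, hm⟩ := hy
    refine ⟨m + n, ?_⟩
    have : (∏ x ∈ t, d x) ^ (m + n) * (x + y) = (∏ x ∈ t, d x) ^ m * ((∏ x ∈ t, d x) ^ n * x) +
        (∏ x ∈ t, d x) ^ n * ((∏ x ∈ t, d x) ^ m * y) := by ring
    rw [this]
    exact D.add_mem (D.mul_mem (D.pow_mem hbD _) hn) (D.mul_mem (D.pow_mem hbD _) hm)
  | mul x y _ _ hx hy =>
    obtain ⟨n, hn⟩ := hx
    obtain ⟨m, hm⟩ := hy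
    refine ⟨n + m, ?_⟩
    have : (∏ x ∈ t, d x) ^ (n + m) * (x * y) =
        ((∏ x ∈ t, d x) ^ n * x) * ((∏ x ∈ t, d x) ^ m * y) := by ring
    rw [this]
    exact D.mul_mem hn hm

theorem Subalgebra.exists_ncard_minimalPrimes_eq_of_le {A L : Type*} [CommRing A] [IsDomain A]
    [Field L] [Algebra A L] {D D' : Subalgebra A L} (hle : D ≤ D') (hD : D.FG) (hD' : D'.FG)
    (h : ∀ x : L, ∃ d ∈ D, d ≠ 0 ∧ d * x ∈ D) :
    ∃ a : A, a ≠ 0 ∧ ∀ J : Ideal A, J.IsMaximal → a ∉ J →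
      (J.map (algebraMap A D)).minimalPrimes.ncard =
        (J.map (algebraMap A D')).minimalPrimes.ncard := by
  obtain ⟨b, hbD, hb0, hb⟩ := D.exists_pow_mul_mem_of_fg hD' h
  have := D.fg_iff_finiteType.1 hD
  have := D'.fg_iff_finiteType.1 hD'
  refine Algebra.FiniteType.exists_ncard_minimalPrimes_eq (Subalgebra.inclusion hle)
    (Subalgebra.inclusion_injective hle) (b := ⟨b, hbD⟩) (fun h => hb0 (congrArg Subtype.val h))
    fun x => ?_
  obtain ⟨n, hn⟩ := hb x x.2
  exact ⟨n, ⟨_, hn⟩, rfl⟩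

theorem Subalgebra.exists_ncard_minimalPrimes_eq {A L : Type*} [CommRing A] [IsDomain A]
    [Field L] [Algebra A L] {D D' : Subalgebra A L} (hD : D.FG) (hD' : D'.FG)
    (h : ∀ x : L, ∃ d ∈ D, d ≠ 0 ∧ d * x ∈ D) (h' : ∀ x : L, ∃ d ∈ D', d ≠ 0 ∧ d * x ∈ D') :
    ∃ a : A, a ≠ 0 ∧ ∀ J : Ideal A, J.IsMaximal → a ∉ J →
      (J.map (algebraMap A D)).minimalPrimes.ncard =
        (J.map (algebraMap A D')).minimalPrimes.ncard := by
  obtain ⟨a, ha, h₁⟩ := exists_ncard_minimalPrimes_eq_of_le le_sup_left hD (hD.sup hD') h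
  obtain ⟨b, hb, h₂⟩ := exists_ncard_minimalPrimes_eq_of_le le_sup_right hD' (hD.sup hD') h'
  exact ⟨a * b, mul_ne_zero ha hb, fun J hJ hab =>
    (h₁ J hJ fun h => hab (J.mul_mem_right _ h)).trans
      (h₂ J hJ fun h => hab (J.mul_mem_left _ h)).symm⟩

theorem AlgHom.ncard_minimalPrimes_map_range {A R L : Type*} [CommRing A] [CommRing R] [Algebra A R]
    [CommRing L] [Algebra A L] (θ : R →ₐ[A] L) (J : Ideal A) :
    (J.map (algebraMap A θ.range)).minimalPrimes.ncard =
      (J.map (algebraMap A R) ⊔ RingHom.ker θ).minimalPrimes.ncard := by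
  have hsurj : Function.Surjective (θ.rangeRestrict : R →+* θ.range) := θ.rangeRestrict_surjective
  rw [← Ideal.ncard_minimalPrimes_comap_of_surjective hsurj]
  have : algebraMap A θ.range = (θ.rangeRestrict : R →+* θ.range).comp (algebraMap A R) :=
    θ.rangeRestrict.comp_algebraMap.symm
  rw [this, ← Ideal.map_map, Ideal.comap_map_of_surjective _ hsurj, ← RingHom.ker_eq_comap_bot]
  congr 3
  ext x
  simp [RingHom.mem_ker, Subtype.ext_iff]

/-- A finitely generated field extension in characteristic zero is the function field of a
hypersurface. -/
theorem exists_mvPolynomial_option_algHom {A K L : Type*} [CommRing A] [IsDomain A] [CharZero A]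
    [UniqueFactorizationMonoid A] [Field K] [Algebra A K] [IsFractionRing A K] [Field L]
    [Algebra A L] [Algebra K L] [IsScalarTower A K L] [Algebra.EssFiniteType K L] :
    ∃ (n : ℕ) (g : MvPolynomial (Option (Fin n)) A) (θ : MvPolynomial (Option (Fin n)) A →ₐ[A] L),
      g ≠ 0 ∧ RingHom.ker θ = Ideal.span {g} ∧
        ∀ x : L, ∃ d ∈ θ.range, d ≠ 0 ∧ d * x ∈ θ.range := by
  have : CharZero K := charZero_of_injective_algebraMap (IsFractionRing.injective A K)
  obtain ⟨s, hs, hsep⟩ := exists_isTranscendenceBasis_and_isSeparable_of_perfectField K L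
  have hfin : FiniteDimensional (IntermediateField.adjoin K (s : Set L)) L := by
    have := Algebra.EssFiniteType.of_comp K (IntermediateField.adjoin K (s : Set L)) L
    exact Algebra.finite_of_essFiniteType_of_isAlgebraic
  obtain ⟨y, hy⟩ := Field.exists_primitive_element (IntermediateField.adjoin K (s : Set L)) L
  let e := s.equivFin.symm
  let v : Fin s.card → L := fun i => (e i : L)
  have hv : AlgebraicIndependent A v :=
    ((algebraicIndependent_equiv e).2 hs.1).restrictScalars (IsFractionRing.injective A K)
  let θ : MvPolynomial (Option (Fin s.card)) A →ₐ[A] L :=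
    MvPolynomial.aeval fun o => o.elim y v
  have hθ (f : MvPolynomial (Fin s.card) A) : θ (MvPolynomial.rename some f) =
      MvPolynomial.aeval v f := by
    rw [MvPolynomial.aeval_rename]; rfl
  have hfrac (x : L) : ∃ d ∈ θ.range, d ≠ 0 ∧ d * x ∈ θ.range := by
    let F : Subfield L := Subfield.closure θ.range
    have hF : (θ.range : Set L) ⊆ F := Subfield.subset_closure
    let M : IntermediateField K L := F.toIntermediateField fun z => by
      obtain ⟨a, b, -, rfl⟩ := IsFractionRing.div_surjective A z
      rw [map_div₀, ← IsScalarTower.algebraMap_apply, ← IsScalarTower.algebraMap_apply]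
      exact F.div_mem (hF (θ.range.algebraMap_mem a)) (hF (θ.range.algebraMap_mem b))
    have hM : M = ⊤ := by
      rw [eq_top_iff, ← IntermediateField.restrictScalars_top (K := K)
        (F := IntermediateField.adjoin K (s : Set L)), ← hy,
        IntermediateField.adjoin_adjoin_left, IntermediateField.adjoin_le_iff]
      rintro z (hz | rfl)
      · refine hF ⟨MvPolynomial.X (some (e.symm ⟨z, hz⟩)), ?_⟩
        simp [θ, v]
      · exact hF ⟨MvPolynomial.X none, by simp [θ]⟩
    have hx : x ∈ F := by
      have : x ∈ M := hM ▸ IntermediateField.mem_top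
      exact this
    obtain ⟨u, hu, w, hw, rfl⟩ := Subfield.mem_closure_iff.1 hx
    have hcl : Subring.closure (θ.range : Set L) = θ.range.toSubring :=
      Subring.closure_eq θ.range.toSubring
    rw [hcl] at hu hw
    by_cases hw0 : w = 0
    · exact ⟨1, θ.range.one_mem, one_ne_zero, by simp [hw0]⟩
    · exact ⟨w, hw, hw0, by rwa [mul_div_cancel₀ _ hw0]⟩
  have hprime : (RingHom.ker θ).IsPrime := RingHom.ker_isPrime θ
  have hne : RingHom.ker θ ≠ ⊥ := by
    intro h
    have hinj : AlgebraicIndependent A fun o : Option (Fin s.card) => o.elim y v := by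
      rw [AlgebraicIndependent]
      exact (RingHom.injective_iff_ker_eq_bot θ).2 h
    have : Algebra.IsAlgebraic A K :=
      (IsFractionRing.comap_isAlgebraic_iff (K := K)).2 inferInstance
    have hbasis : IsTranscendenceBasis K v := hs.comp_equiv e
    have hy := (AlgebraicIndependent.option_iff.1 (hinj.extendScalars K)).2
    exact hy (hbasis.isAlgebraic.isAlgebraic y)
  obtain ⟨g, hg, hgθ⟩ := MvPolynomial.exists_eq_span_singleton_of_comap_rename_some_eq_bot hne
    fun f hf => (injective_iff_map_eq_zero _).1 hv f ((hθ f).symm.trans hf)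
  exact ⟨_, g, θ, hg, hgθ, hfrac⟩

theorem AlgHom.range_fg {A R L : Type*} [CommRing A] [CommRing R] [Algebra A R]
    [Algebra.FiniteType A R] [CommRing L] [Algebra A L] (θ : R →ₐ[A] L) : θ.range.FG := by
  rw [← Algebra.map_top]
  exact Algebra.FiniteType.out.map θ

theorem MvPolynomial.ncard_minimalPrimes_map_ker_sup_span {A k σ : Type*} [CommRing A] [CommRing k]
    {ev : A →+* k} (hev : Function.Surjective ev) (g : MvPolynomial σ A) :
    ((RingHom.ker ev).map (algebraMap A (MvPolynomial σ A)) ⊔ Ideal.span {g}).minimalPrimes.ncard =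
      (Ideal.span {map ev g}).minimalPrimes.ncard := by
  rw [← Ideal.ncard_minimalPrimes_comap_of_surjective (map_surjective (σ := σ) ev hev)]
  congr 2
  rw [← Set.image_singleton, ← Ideal.map_span,
    Ideal.comap_map_of_surjective _ (map_surjective ev hev), ← RingHom.ker_eq_comap_bot, ker_map,
    sup_comm, algebraMap_eq]

/-- The number of irreducible components of the fibers of a morphism of finite type of integral
affine schemes is generically constant. -/
theorem exists_eventually_ncard_minimalPrimes_map_ker {A B k X : Type*} [CommRing A] [IsDomain A]
    [CharZero A] [UniqueFactorizationMonoid A] [CommRing B] [IsDomain B] [Algebra A B]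
    [Algebra.FiniteType A B] (hinj : Function.Injective (algebraMap A B)) [Field k] [IsAlgClosed k]
    (ev : X → A →+* k) (hev : ∀ x, Function.Surjective (ev x)) (l : Filter X)
    (hl : ∀ a, a ≠ 0 → ∀ᶠ x in l, ev x a ≠ 0) :
    ∃ N, ∀ᶠ x in l, ((RingHom.ker (ev x)).map (algebraMap A B)).minimalPrimes.ncard = N := by
  let K := FractionRing A
  let L := FractionRing B
  have hAL : Function.Injective (algebraMap A L) := by
    rw [IsScalarTower.algebraMap_eq A B L]
    exact (IsFractionRing.injective B L).comp hinj
  have : FaithfulSMul A L := (faithfulSMul_iff_algebraMap_injective _ _).2 hAL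
  let _ : Algebra K L := FractionRing.liftAlgebra A L
  have : IsScalarTower A K L := FractionRing.isScalarTower_liftAlgebra A L
  have : Algebra.EssFiniteType B L := .of_isLocalization _ (nonZeroDivisors B)
  have : Algebra.EssFiniteType A L := .comp A B L
  have : Algebra.EssFiniteType K L := .of_comp A K L
  obtain ⟨n, g, θ, hg, hker, hfrac⟩ := exists_mvPolynomial_option_algHom (A := A) (K := K) (L := L)
  obtain ⟨N, hN⟩ := MvPolynomial.exists_eventually_hasIrreducibleFactors ev l hl hg
  let β : B →ₐ[A] L := IsScalarTower.toAlgHom A B L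
  have hβ : RingHom.ker β = ⊥ :=
    (RingHom.injective_iff_ker_eq_bot β).1 (IsFractionRing.injective B L)
  obtain ⟨a, ha, h⟩ := Subalgebra.exists_ncard_minimalPrimes_eq β.range_fg θ.range_fg (fun x => by
    obtain ⟨u, w, hw, rfl⟩ := IsFractionRing.div_surjective B x
    have hw0 : algebraMap B L w ≠ 0 := IsFractionRing.to_map_ne_zero_of_mem_nonZeroDivisors hw
    exact ⟨_, ⟨w, rfl⟩, hw0, u, (mul_div_cancel₀ _ hw0).symm⟩) hfrac
  refine ⟨N, ?_⟩
  filter_upwards [hN, hl a ha] with x hx hxa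
  have h1 := h (RingHom.ker (ev x)) (RingHom.ker_isMaximal_of_surjective _ (hev x)) hxa
  rw [AlgHom.ncard_minimalPrimes_map_range, AlgHom.ncard_minimalPrimes_map_range, hβ, sup_bot_eq,
    hker, MvPolynomial.ncard_minimalPrimes_map_ker_sup_span (hev x)] at h1
  rw [h1, hx.ncard_minimalPrimes]

theorem MvPolynomial.eval_aeval {k σ τ : Type*} [CommRing k] (p : σ → MvPolynomial τ k) (x : τ → k)
    (f : MvPolynomial σ k) : eval x (aeval p f) = eval (fun s => eval x (p s)) f := by
  simpa [← aeval_eq_eval] using comp_aeval_apply p (aeval x) f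

open MvPolynomial in
/-- The number of irreducible components of the fibers of a polynomial map between affine spaces
over an algebraically closed field of characteristic zero is generically constant. -/
theorem MvPolynomial.exists_ncard_minimalPrimes_vanishingIdeal_fiber {k σ τ : Type*} [Field k]
    [IsAlgClosed k] [CharZero k] [Finite τ] (p : σ → MvPolynomial τ k) :
    ∃ (N : ℕ) (F : MvPolynomial σ k), F ≠ 0 ∧ ∀ y : σ → k, eval y F ≠ 0 →
      (MvPolynomial.vanishingIdeal k {x : τ → k | ∀ s, eval x (p s) = y s}).minimalPrimes.ncard =
        N := by
  by_cases hinj : Function.Injective (aeval (R := k) p)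
  · let _ : Algebra (MvPolynomial σ k) (MvPolynomial τ k) := (aeval (R := k) p).toRingHom.toAlgebra
    have : IsScalarTower k (MvPolynomial σ k) (MvPolynomial τ k) :=
      .of_algebraMap_eq fun c => ((aeval (R := k) p).commutes c).symm
    have : Algebra.FiniteType (MvPolynomial σ k) (MvPolynomial τ k) :=
      .of_restrictScalars_finiteType k _ _
    let l : Filter (σ → k) :=
      { sets := {s | ∃ F : MvPolynomial σ k, F ≠ 0 ∧ ∀ y, eval y F ≠ 0 → y ∈ s}
        univ_sets := ⟨1, one_ne_zero, fun _ _ => trivial⟩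
        sets_of_superset := fun ⟨F, hF, h⟩ hst => ⟨F, hF, fun y hy => hst (h y hy)⟩
        inter_sets := fun ⟨F, hF, h⟩ ⟨G, hG, h'⟩ => ⟨F * G, mul_ne_zero hF hG, fun y hy => by
          rw [map_mul] at hy
          exact ⟨h y (left_ne_zero_of_mul hy), h' y (right_ne_zero_of_mul hy)⟩⟩ }
    obtain ⟨N, F, hF, h⟩ := exists_eventually_ncard_minimalPrimes_map_ker hinj
      (fun y : σ → k => eval y) (fun y c => ⟨C c, eval_C c⟩) l fun F hF => ⟨F, hF, fun _ => id⟩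
    refine ⟨N, F, hF, fun y hy => ?_⟩
    have hfiber : {x : τ → k | ∀ s, eval x (p s) = y s} = zeroLocus k
        ((RingHom.ker (eval y)).map (algebraMap (MvPolynomial σ k) (MvPolynomial τ k))) := by
      ext x
      rw [Set.mem_ofPred_eq, mem_zeroLocus_iff]
      refine ⟨fun hx => ?_, fun hx s => ?_⟩
      · have hle : (RingHom.ker (eval y)).map (algebraMap (MvPolynomial σ k) (MvPolynomial τ k)) ≤
            RingHom.ker (eval x) := by
          refine Ideal.map_le_iff_le_comap.2 fun f hf => ?_
          change eval x (aeval p f) = 0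
          rwa [eval_aeval, _root_.funext hx]
        exact fun f hf => hle hf
      · have := hx (aeval p (X s - C (y s))) (Ideal.mem_map_of_mem _ (by simp [RingHom.mem_ker]))
        simpa [sub_eq_zero, aeval_eq_eval] using this
    rw [hfiber, vanishingIdeal_zeroLocus_eq_radical, Ideal.radical_minimalPrimes]
    exact h y hy
  · rw [injective_iff_map_eq_zero] at hinj
    push Not at hinj
    obtain ⟨F, hF, hF0⟩ := hinj
    refine ⟨0, F, hF0, fun y hy => ?_⟩
    have : {x : τ → k | ∀ s, eval x (p s) = y s} = ∅ :=
      Set.eq_empty_of_forall_notMem fun x hx => hy <| by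
        rw [← show (fun s => eval x (p s)) = y from _root_.funext hx,
          ← eval_aeval, hF, map_zero]
    rw [this, vanishingIdeal_empty, Ideal.minimalPrimes_top, Set.ncard_empty]

/-- For a sparse graph `G` the component number `c(G, λ)`,
i.e. the number of minimal primes over the vanishing ideal of `E_G⁻¹(λ)`, is
the same for all general edge length assignments `λ`. -/
theorem component_number_well_defined
    {α : Type*} [DecidableEq α]
    (V : Finset α) (E : Finset (Sym2 α)) (hSparse : IsSparse V E) :
    ∃ (N : ℕ) (F : MvPolynomial {e // e ∈ E} ℂ), F ≠ 0 ∧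
      ∀ lam : {e // e ∈ E} → ℂ, MvPolynomial.eval lam F ≠ 0 →
        ((vanishingIdeal (fiber V E lam)).minimalPrimes).ncard = N := by
  let q (i : Fin 2) (a : α) : MvPolynomial (V × Fin 2) ℂ :=
    if h : a ∈ V then MvPolynomial.X (⟨a, h⟩, i) else 0
  have hq (r : V → ℂ × ℂ) (a : α) : extendR V r a =
      (MvPolynomial.eval (coords r) (q 0 a), MvPolynomial.eval (coords r) (q 1 a)) := by
    by_cases h : a ∈ V <;> simp [q, extendR, coords, h, Prod.zero_eq_mk]
  have hp (e : Sym2 α) : ∃ p : MvPolynomial (V × Fin 2) ℂ, ∀ r : V → ℂ × ℂ,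
      MvPolynomial.eval (coords r) p = edgeVal (extendR V r) e := by
    induction e with
    | h a b =>
      exact ⟨(q 0 a - q 0 b) ^ 2 + (q 1 a - q 1 b) ^ 2, fun r => by simp [edgeVal, sd, hq]⟩
  choose p hp using hp
  obtain ⟨N, F, hF, h⟩ := MvPolynomial.exists_ncard_minimalPrimes_vanishingIdeal_fiber
    fun e : {e // e ∈ E} => p e
  refine ⟨N, F, hF, fun lam hlam => ?_⟩
  rw [← h lam hlam]
  congr 2
  have hcoords (x : V × Fin 2 → ℂ) : ∃ r, coords r = x :=
    ⟨fun v => (x (v, 0), x (v, 1)), by ext ⟨v, i⟩; fin_cases i <;> rfl⟩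
  ext f
  rw [MvPolynomial.mem_vanishingIdeal_iff]
  refine ⟨fun hf x hx => ?_, fun hf r hr => hf _ fun e => (hp e r).trans (congrFun hr e)⟩
  obtain ⟨r, rfl⟩ := hcoords x
  exact hf r (funext fun e => (hp e r).symm.trans (hx e))
end

section
/- Let p₁,p₂,q₁,q₂ ∈ ℂ² with d(p₁,p₂) = d(q₁,q₂) ≠ 0 (in particular p₁ ≠ p₂). Define Γ := {(p₀,q₀) ∈ ℂ² × ℂ² : d(p₀,p_w) = d(q₀,q_w) for w = 1,2} and Γ' := {(p₀,q₀) ∈ Γ : there exists t ∈ T with t(p₀) = q₀, t(p₁) = q₁ and t(p₂) = q₂}. Then Γ' is irreducible and dim Γ = dim Γ' = 2, where subsets of ℂ² × ℂ² are regarded as subsets of ℂ⁴. -/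
noncomputable section

/-- A point of `ℂ² × ℂ²` viewed as a point of `ℂ⁴`. -/
def pt4 (p : (ℂ × ℂ) × (ℂ × ℂ)) : Fin 4 → ℂ := ![p.1.1, p.1.2, p.2.1, p.2.2]

/-- The vanishing ideal of a subset of `ℂ² × ℂ² = ℂ⁴` in `ℂ[x₁, x₂, x₃, x₄]`. -/
def vanIdeal4 (S : Set ((ℂ × ℂ) × (ℂ × ℂ))) : Ideal (MvPolynomial (Fin 4) ℂ) where
  carrier := {f | ∀ p ∈ S, MvPolynomial.eval (pt4 p) f = 0}
  add_mem' := by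
    intro a b ha hb p hp
    simp only [Set.mem_setOf_eq] at ha hb ⊢
    simp [map_add, ha p hp, hb p hp]
  zero_mem' := by intro p hp; simp
  smul_mem' := by
    intro c f hf p hp
    simp only [Set.mem_setOf_eq] at hf ⊢
    simp [smul_eq_mul, map_mul, hf p hp]

/-- A subset of `ℂ⁴` is irreducible if its vanishing ideal is prime. -/
def IsIrr4 (S : Set ((ℂ × ℂ) × (ℂ × ℂ))) : Prop := (vanIdeal4 S).IsPrime

/-- The dimension of a subset of `ℂ⁴`: the Krull dimension of the quotient of
`ℂ[x₁, x₂, x₃, x₄]` by its vanishing ideal. -/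
def dim4 (S : Set ((ℂ × ℂ) × (ℂ × ℂ))) : WithBot (WithTop ℕ) :=
  ringKrullDim (MvPolynomial (Fin 4) ℂ ⧸ vanIdeal4 S)

end

/-- `Γ` for two base points: pairs `(p₀, q₀)` with `d(p₀, p_w) = d(q₀, q_w)`
for `w = 1, 2`. -/
def Gamma2 (p1 p2 q1 q2 : ℂ × ℂ) : Set ((ℂ × ℂ) × (ℂ × ℂ)) :=
  {pq | sd pq.1 p1 = sd pq.2 q1 ∧ sd pq.1 p2 = sd pq.2 q2}

/-- `Γ'`: the pairs in `Γ` for which some transformation `t ∈ T` sends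
`(p₀, p₁, p₂)` to `(q₀, q₁, q₂)`. -/
def Gamma2' (p1 p2 q1 q2 : ℂ × ℂ) : Set ((ℂ × ℂ) × (ℂ × ℂ)) :=
  {pq ∈ Gamma2 p1 p2 q1 q2 |
    ∃ t, IsTransf t ∧ t pq.1 = pq.2 ∧ t p1 = q1 ∧ t p2 = q2}

open MvPolynomial in
/-- The graph of the polynomial map `ℂ² → ℂ²` with components `G` and `H`. -/
def polyGraph (G H : MvPolynomial (Fin 2) ℂ) : Set ((ℂ × ℂ) × (ℂ × ℂ)) :=
  {pq | pq.2.1 = eval ![pq.1.1, pq.1.2] G ∧ pq.2.2 = eval ![pq.1.1, pq.1.2] H}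

open MvPolynomial in
/-- The pullback of polynomials along `x ↦ (x, (G x, H x))`. -/
noncomputable def graphPullback (G H : MvPolynomial (Fin 2) ℂ) :
    MvPolynomial (Fin 4) ℂ →ₐ[ℂ] MvPolynomial (Fin 2) ℂ :=
  aeval ![X 0, X 1, G, H]

open MvPolynomial in
theorem eval_graphPullback (G H : MvPolynomial (Fin 2) ℂ) (x : Fin 2 → ℂ)
    (f : MvPolynomial (Fin 4) ℂ) :
    eval x (graphPullback G H f) = eval ![x 0, x 1, eval x G, eval x H] f := by
  induction f using MvPolynomial.induction_on with
  | C a => simp [graphPullback]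
  | add f g hf hg => simp [hf, hg]
  | mul_X f i hf =>
    rw [map_mul, map_mul, map_mul, hf]
    fin_cases i <;> simp [graphPullback]

open MvPolynomial in
theorem graphPullback_surjective (G H : MvPolynomial (Fin 2) ℂ) :
    Function.Surjective (graphPullback G H) := by
  intro f
  refine ⟨aeval ![X 0, X 1] f, ?_⟩
  induction f using MvPolynomial.induction_on with
  | C a => simp [graphPullback]
  | add f g hf hg => rw [map_add, map_add, hf, hg]
  | mul_X f i hf =>
    rw [map_mul, map_mul, hf]
    fin_cases i <;> simp [graphPullback]

open MvPolynomial in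
theorem vanIdeal4_polyGraph (G H : MvPolynomial (Fin 2) ℂ) :
    vanIdeal4 (polyGraph G H) = RingHom.ker (graphPullback G H) := by
  ext f
  rw [RingHom.mem_ker]
  constructor
  · intro hf
    refine MvPolynomial.funext fun x => ?_
    have hx : ![x 0, x 1] = x := by ext i; fin_cases i <;> rfl
    rw [eval_graphPullback, map_zero]
    exact hf ((x 0, x 1), (eval x G, eval x H)) (by simp [polyGraph, hx])
  · rintro hf ⟨⟨a, b⟩, ⟨c, d⟩⟩ ⟨h₁, h₂⟩
    have h := eval_graphPullback G H ![a, b] f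
    rw [hf, map_zero] at h
    dsimp only at h₁ h₂
    rw [← h₁, ← h₂] at h
    exact h.symm

theorem isPrime_vanIdeal4_polyGraph (G H : MvPolynomial (Fin 2) ℂ) :
    IsIrr4 (polyGraph G H) := by
  rw [IsIrr4, vanIdeal4_polyGraph]
  exact RingHom.ker_isPrime _

theorem ringKrullDim_vanIdeal4_polyGraph (G H : MvPolynomial (Fin 2) ℂ) :
    ringKrullDim (MvPolynomial (Fin 4) ℂ ⧸ vanIdeal4 (polyGraph G H)) = 2 := by
  rw [vanIdeal4_polyGraph]
  have e := RingHom.quotientKerEquivOfSurjective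
    (f := (graphPullback G H : MvPolynomial (Fin 4) ℂ →+* MvPolynomial (Fin 2) ℂ))
    (graphPullback_surjective G H)
  have h := ringKrullDim_eq_of_ringEquiv e
  rw [MvPolynomial.ringKrullDim_of_isNoetherianRing, ringKrullDim_eq_zero_of_field] at h
  rw [Nat.card_fin, zero_add] at h
  exact h

theorem vanIdeal4_union (S T : Set ((ℂ × ℂ) × (ℂ × ℂ))) :
    vanIdeal4 (S ∪ T) = vanIdeal4 S ⊓ vanIdeal4 T := by
  ext f
  exact ⟨fun h => ⟨fun p hp => h p (Or.inl hp), fun p hp => h p (Or.inr hp)⟩,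
    fun h p hp => hp.elim (h.1 p) (h.2 p)⟩

/-- The Krull dimension of a union of two closed subschemes is the larger of the two. -/
theorem ringKrullDim_quotient_inf {R : Type*} [CommRing R] (I J : Ideal R) :
    ringKrullDim (R ⧸ I ⊓ J) = max (ringKrullDim (R ⧸ I)) (ringKrullDim (R ⧸ J)) := by
  refine le_antisymm ?_ (max_le
    (ringKrullDim_le_of_surjective (Ideal.Quotient.factor inf_le_left)
      (Ideal.Quotient.factor_surjective _))
    (ringKrullDim_le_of_surjective (Ideal.Quotient.factor inf_le_right)
      (Ideal.Quotient.factor_surjective _)))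
  have key : ∀ (K : Ideal R) (x : PrimeSpectrum.zeroLocus (R := R) (I ⊓ J : Ideal R)),
      K ≤ x.1.asIdeal → (Order.coheight x : WithBot ℕ∞) ≤ ringKrullDim (R ⧸ K) := by
    intro K x hx
    rw [Order.coheight_eq_krullDim_Ici, ringKrullDim_quotient]
    exact Order.krullDim_le_of_strictMono
      (fun y => ⟨y.1.1, fun _ hr => y.2 (hx hr)⟩) fun _ _ h => h
  rw [ringKrullDim_quotient (I ⊓ J), Order.krullDim_eq_iSup_coheight]
  refine iSup_le fun x => ?_
  rcases x.1.isPrime.inf_le.1 (show I ⊓ J ≤ x.1.asIdeal from x.2) with h | h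
  · exact (key I x h).trans (le_max_left _ _)
  · exact (key J x h).trans (le_max_right _ _)

open MvPolynomial in
/-- The graph of the affine map sending `p1` to `q1` whose linear part sends `e = p2 - p1` to
`f = q2 - q1` and the quarter turn of `e` to `ε` times the quarter turn of `f`. -/
def affineGraph (p1 p2 q1 q2 : ℂ × ℂ) (ε : ℂ) : Set ((ℂ × ℂ) × (ℂ × ℂ)) :=
  polyGraph
    (C q1.1 + C (sd p1 p2)⁻¹ *
      (((X 0 - C p1.1) * C (p2.1 - p1.1) + (X 1 - C p1.2) * C (p2.2 - p1.2)) * C (q2.1 - q1.1)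
        - C ε * ((X 1 - C p1.2) * C (p2.1 - p1.1) - (X 0 - C p1.1) * C (p2.2 - p1.2))
          * C (q2.2 - q1.2)))
    (C q1.2 + C (sd p1 p2)⁻¹ *
      (((X 0 - C p1.1) * C (p2.1 - p1.1) + (X 1 - C p1.2) * C (p2.2 - p1.2)) * C (q2.2 - q1.2)
        + C ε * ((X 1 - C p1.2) * C (p2.1 - p1.1) - (X 0 - C p1.1) * C (p2.2 - p1.2))
          * C (q2.1 - q1.1)))

theorem mem_affineGraph {p1 p2 q1 q2 : ℂ × ℂ} (hne : sd p1 p2 ≠ 0) {ε : ℂ}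
    {pq : (ℂ × ℂ) × (ℂ × ℂ)} :
    pq ∈ affineGraph p1 p2 q1 q2 ε ↔
      sd p1 p2 * (pq.2.1 - q1.1) =
          ((pq.1.1 - p1.1) * (p2.1 - p1.1) + (pq.1.2 - p1.2) * (p2.2 - p1.2)) * (q2.1 - q1.1)
          - ε * ((pq.1.2 - p1.2) * (p2.1 - p1.1) - (pq.1.1 - p1.1) * (p2.2 - p1.2))
            * (q2.2 - q1.2) ∧
      sd p1 p2 * (pq.2.2 - q1.2) =
          ((pq.1.1 - p1.1) * (p2.1 - p1.1) + (pq.1.2 - p1.2) * (p2.2 - p1.2)) * (q2.2 - q1.2)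
          + ε * ((pq.1.2 - p1.2) * (p2.1 - p1.1) - (pq.1.1 - p1.1) * (p2.2 - p1.2))
            * (q2.1 - q1.1) := by
  have solve : ∀ a b c : ℂ, a = b + (sd p1 p2)⁻¹ * c ↔ sd p1 p2 * (a - b) = c := by
    intro a b c
    rw [← sub_eq_iff_eq_add', eq_inv_mul_iff_mul_eq₀ hne]
  simp [affineGraph, polyGraph, solve]

theorem gamma2_eq_union {p1 p2 q1 q2 : ℂ × ℂ} (heq : sd p1 p2 = sd q1 q2)
    (hne : sd p1 p2 ≠ 0) :
    Gamma2 p1 p2 q1 q2 = affineGraph p1 p2 q1 q2 1 ∪ affineGraph p1 p2 q1 q2 (-1) := by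
  ext ⟨⟨x, y⟩, ⟨z, w⟩⟩
  obtain ⟨a, b⟩ := p1
  obtain ⟨a', b'⟩ := p2
  obtain ⟨c, d⟩ := q1
  obtain ⟨c', d'⟩ := q2
  rw [Set.mem_union]
  change sd (x, y) (a, b) = sd (z, w) (c, d) ∧ sd (x, y) (a', b') = sd (z, w) (c', d') ↔ _
  constructor
  · rw [mem_affineGraph hne, mem_affineGraph hne]
    simp only [sd] at heq hne ⊢
    rintro ⟨h₁, h₂⟩
    have hu : (x - a) * (a' - a) + (y - b) * (b' - b)
        = (z - c) * (c' - c) + (w - d) * (d' - d) := by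
      linear_combination (h₁ - h₂ + heq) / 2
    have hv : ((w - d) * (c' - c) - (z - c) * (d' - d)) ^ 2
        = ((y - b) * (a' - a) - (x - a) * (b' - b)) ^ 2 := by
      linear_combination (((x - a) * (a' - a) + (y - b) * (b' - b))
        + ((z - c) * (c' - c) + (w - d) * (d' - d))) * hu
        - ((a - a') ^ 2 + (b - b') ^ 2) * h₁ - ((z - c) ^ 2 + (w - d) ^ 2) * heq
    refine (sq_eq_sq_iff_eq_or_eq_neg.1 hv).imp (fun hv => ⟨?_, ?_⟩) fun hv => ⟨?_, ?_⟩
    · linear_combination (z - c) * heq - (c' - c) * hu - (d' - d) * hv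
    · linear_combination (w - d) * heq - (d' - d) * hu + (c' - c) * hv
    · linear_combination (z - c) * heq - (c' - c) * hu - (d' - d) * hv
    · linear_combination (w - d) * heq - (d' - d) * hu + (c' - c) * hv
  · intro h
    obtain ⟨ε, hε, h⟩ : ∃ ε : ℂ, ε ^ 2 = 1 ∧
        ((x, y), (z, w)) ∈ affineGraph (a, b) (a', b') (c, d) (c', d') ε :=
      h.elim (fun h => ⟨1, by norm_num, h⟩) fun h => ⟨-1, by norm_num, h⟩
    rw [mem_affineGraph hne] at h
    simp only [sd] at h heq hne ⊢
    obtain ⟨h₁, h₂⟩ := h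
    have hu : (x - a) * (a' - a) + (y - b) * (b' - b)
        = (z - c) * (c' - c) + (w - d) * (d' - d) := by
      refine mul_left_cancel₀ hne ?_
      linear_combination ((x - a) * (a' - a) + (y - b) * (b' - b)) * heq
        - (c' - c) * h₁ - (d' - d) * h₂
    have hv : ε * ((y - b) * (a' - a) - (x - a) * (b' - b))
        = (w - d) * (c' - c) - (z - c) * (d' - d) := by
      refine mul_left_cancel₀ hne ?_
      linear_combination ε * ((y - b) * (a' - a) - (x - a) * (b' - b)) * heq
        + (d' - d) * h₁ - (c' - c) * h₂
    have hd : (x - a) ^ 2 + (y - b) ^ 2 = (z - c) ^ 2 + (w - d) ^ 2 := by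
      refine mul_left_cancel₀ hne ?_
      linear_combination (((x - a) * (a' - a) + (y - b) * (b' - b))
        + ((z - c) * (c' - c) + (w - d) * (d' - d))) * hu
        + (ε * ((y - b) * (a' - a) - (x - a) * (b' - b))
        + ((w - d) * (c' - c) - (z - c) * (d' - d))) * hv
        - ((y - b) * (a' - a) - (x - a) * (b' - b)) ^ 2 * hε
        - ((z - c) ^ 2 + (w - d) ^ 2) * heq
    exact ⟨hd, by linear_combination hd - 2 * hu + heq⟩

theorem gamma2'_eq_affineGraph {p1 p2 q1 q2 : ℂ × ℂ} (heq : sd p1 p2 = sd q1 q2)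
    (hne : sd p1 p2 ≠ 0) :
    Gamma2' p1 p2 q1 q2 = affineGraph p1 p2 q1 q2 1 := by
  ext pq
  constructor
  · rintro ⟨-, t, ⟨c, s, u, v, hcs, ht⟩, h₀, rfl, rfl⟩
    rw [mem_affineGraph hne, ← h₀]
    simp only [ht, sd]
    constructor <;> ring
  · intro h
    refine ⟨gamma2_eq_union heq hne ▸ Or.inl h, ?_⟩
    rw [mem_affineGraph hne] at h
    obtain ⟨h₁, h₂⟩ := h
    set c := ((p2.1 - p1.1) * (q2.1 - q1.1) + (p2.2 - p1.2) * (q2.2 - q1.2)) / sd p1 p2 with hc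
    set s := ((p2.1 - p1.1) * (q2.2 - q1.2) - (p2.2 - p1.2) * (q2.1 - q1.1)) / sd p1 p2 with hs
    rw [eq_div_iff hne] at hc hs
    refine ⟨fun x => (c * x.1 - s * x.2 + (q1.1 - (c * p1.1 - s * p1.2)),
      s * x.1 + c * x.2 + (q1.2 - (s * p1.1 + c * p1.2))), ⟨c, s, _, _, ?_, fun _ => rfl⟩, ?_, ?_, ?_⟩
    · refine mul_left_cancel₀ (pow_ne_zero 2 hne) ?_
      calc sd p1 p2 ^ 2 * (c ^ 2 + s ^ 2) = (c * sd p1 p2) ^ 2 + (s * sd p1 p2) ^ 2 := by ring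
        _ = sd p1 p2 * sd q1 q2 := by rw [hc, hs, sd, sd]; ring
        _ = sd p1 p2 ^ 2 * 1 := by rw [← heq]; ring
    · ext
      · refine mul_left_cancel₀ hne ?_
        linear_combination (pq.1.1 - p1.1) * hc - (pq.1.2 - p1.2) * hs - h₁
      · refine mul_left_cancel₀ hne ?_
        linear_combination (pq.1.1 - p1.1) * hs + (pq.1.2 - p1.2) * hc - h₂
    · ext <;> ring
    · ext
      · refine mul_left_cancel₀ hne ?_
        have hD : sd p1 p2 = (p1.1 - p2.1) ^ 2 + (p1.2 - p2.2) ^ 2 := rfl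
        linear_combination (p2.1 - p1.1) * hc - (p2.2 - p1.2) * hs - (q2.1 - q1.1) * hD
      · refine mul_left_cancel₀ hne ?_
        have hD : sd p1 p2 = (p1.1 - p2.1) ^ 2 + (p1.2 - p2.2) ^ 2 := rfl
        linear_combination (p2.1 - p1.1) * hs + (p2.2 - p1.2) * hc - (q2.2 - q1.2) * hD

/-- If `d(p₁, p₂) = d(q₁, q₂) ≠ 0`, then `Γ'` is irreducible
and `dim Γ = dim Γ' = 2`. -/
theorem gamma_two_points_equal_lengths (p1 p2 q1 q2 : ℂ × ℂ)
    (heq : sd p1 p2 = sd q1 q2) (hne : sd p1 p2 ≠ 0) :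
    IsIrr4 (Gamma2' p1 p2 q1 q2) ∧
    dim4 (Gamma2 p1 p2 q1 q2) = 2 ∧ dim4 (Gamma2' p1 p2 q1 q2) = 2 := by
  rw [dim4, dim4, gamma2_eq_union heq hne, gamma2'_eq_affineGraph heq hne, affineGraph, affineGraph,
    vanIdeal4_union]
  refine ⟨isPrime_vanIdeal4_polyGraph _ _, ?_, ringKrullDim_vanIdeal4_polyGraph _ _⟩
  rw [ringKrullDim_quotient_inf, ringKrullDim_vanIdeal4_polyGraph,
    ringKrullDim_vanIdeal4_polyGraph, max_self]
  rfl
end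

section
/- Let p₁,p₂,q₁,q₂ ∈ ℂ² with p₁ ≠ p₂ and d(p₁,p₂) ≠ d(q₁,q₂). Then the set Γ := {(p₀,q₀) ∈ ℂ² × ℂ² : d(p₀,p_w) = d(q₀,q_w) for w = 1,2}, regarded as a subset of ℂ⁴, is irreducible and has dimension 2. -/
open MvPolynomial in
theorem eval_bind₁ {σ τ R : Type*} [CommSemiring R] (f : τ → R)
    (A : σ → MvPolynomial τ R) (P : MvPolynomial σ R) :
    eval f (bind₁ A P) = eval (fun i => eval f (A i)) P := by
  rw [← coe_aeval_eq_eval, ← coe_aeval_eq_eval]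
  exact aeval_bind₁ f A P

theorem ringKrullDim_eq_of_isIntegral_of_injective {R S : Type*} [CommRing R] [CommRing S]
    [Algebra R S] [Algebra.IsIntegral R S] (h : Function.Injective (algebraMap R S)) :
    ringKrullDim S = ringKrullDim R := by
  apply le_antisymm
  · exact Order.krullDim_le_of_strictMono (PrimeSpectrum.comap (algebraMap R S))
      fun _ _ hPQ => Ideal.IsIntegral.comap_lt_comap hPQ
  · refine iSup_le fun l => ?_
    obtain ⟨Q, -, hQ, hQl⟩ := Ideal.exists_ideal_over_prime_of_isIntegral (S := S)
      l.head.asIdeal ⊥ (by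
        rw [← RingHom.ker_eq_comap_bot, (RingHom.injective_iff_ker_eq_bot _).1 h]
        exact bot_le)
    have : Q.LiesOver l.head.asIdeal := ⟨hQl.symm⟩
    obtain ⟨L, hL, -⟩ := Ideal.exists_ltSeries_of_hasGoingUp l Q
    rw [← hL]
    exact Order.LTSeries.length_le_krullDim L

theorem exists_pt4_eq (x : Fin 4 → ℂ) : ∃ p, pt4 p = x := by
  refine ⟨((x 0, x 1), (x 2, x 3)), ?_⟩
  ext i
  fin_cases i <;> rfl

open MvPolynomial in
/-- The vanishing ideal of the image of a polynomial map `ℂⁿ → ℂ⁴` is prime. -/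
theorem isIrr4_of_polynomial_image {n : ℕ} (S : Set ((ℂ × ℂ) × (ℂ × ℂ)))
    (F : Fin 4 → MvPolynomial (Fin n) ℂ)
    (hF : ∀ p, p ∈ S ↔ ∃ t : Fin n → ℂ, pt4 p = fun i => eval t (F i)) : IsIrr4 S := by
  have h : vanIdeal4 S = RingHom.ker (bind₁ F).toRingHom := by
    ext f
    change (∀ p ∈ S, eval (pt4 p) f = 0) ↔ bind₁ F f = 0
    constructor
    · intro hf
      refine MvPolynomial.funext fun t => ?_
      obtain ⟨p, hp⟩ := exists_pt4_eq (fun i => eval t (F i))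
      rw [eval_bind₁, ← hp, hf p ((hF p).2 ⟨t, hp⟩), map_zero]
    · intro hf p hp
      obtain ⟨t, ht⟩ := (hF p).1 hp
      rw [ht, ← eval_bind₁, hf, map_zero]
  rw [IsIrr4, h]
  exact RingHom.ker_isPrime _

open MvPolynomial in
/-- A subset of `ℂ⁴` given, in suitable polynomial coordinates `A` on `ℂ⁴`, as the set of
singular `2 × 2` matrices with a fixed trace is irreducible. -/
theorem isIrr4_of_singular_matrix_coords (S : Set ((ℂ × ℂ) × (ℂ × ℂ))) (δ : ℂ)
    (A B : Fin 4 → MvPolynomial (Fin 4) ℂ)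
    (hAB : ∀ m i, eval (fun j => eval m (B j)) (A i) = m i)
    (hBA : ∀ m i, eval (fun j => eval m (A j)) (B i) = m i)
    (hS : ∀ p, p ∈ S ↔ eval (pt4 p) (A 0) + eval (pt4 p) (A 3) = δ ∧
      eval (pt4 p) (A 0) * eval (pt4 p) (A 3) = eval (pt4 p) (A 1) * eval (pt4 p) (A 2)) :
    IsIrr4 S := by
  let W : MvPolynomial (Fin 3) ℂ := C δ - X 2 * X 1
  let V : MvPolynomial (Fin 3) ℂ := X 2 - X 0 * W
  let G : Fin 4 → MvPolynomial (Fin 3) ℂ :=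
    ![X 1 * V, V * (1 + X 0 * X 1), X 1 * W, W * (1 + X 0 * X 1)]
  refine isIrr4_of_polynomial_image S (fun i => bind₁ G (B i)) fun p => ?_
  simp only [eval_bind₁]
  rw [hS]
  constructor
  · rintro ⟨h1, h2⟩
    suffices h : ∃ t : Fin 3 → ℂ, ∀ i, eval t (G i) = eval (pt4 p) (A i) by
      obtain ⟨t, ht⟩ := h
      refine ⟨t, funext fun i => ?_⟩
      simp only [ht, hBA]

    have key : ∀ x y b : ℂ,
        y * (b - x * (δ - b * y)) = eval (pt4 p) (A 0) →
        (b - x * (δ - b * y)) * (1 + x * y) = eval (pt4 p) (A 1) →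
        y * (δ - b * y) = eval (pt4 p) (A 2) →
        (δ - b * y) * (1 + x * y) = eval (pt4 p) (A 3) →
        ∃ t : Fin 3 → ℂ, ∀ i, eval t (G i) = eval (pt4 p) (A i) := by
      intro x y b e0 e1 e2 e3
      refine ⟨![x, y, b], fun i => ?_⟩
      fin_cases i <;> simpa [G, V, W]
    generalize eval (pt4 p) (A 0) = α, eval (pt4 p) (A 1) = β,
      eval (pt4 p) (A 2) = γ, eval (pt4 p) (A 3) = ε at h1 h2 key
    obtain rfl : ε = δ - α := by linear_combination h1
    by_cases hγ : γ = 0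
    · subst hγ
      rcases eq_or_ne α 0 with rfl | hα
      · exact key 0 0 β (by simp) (by simp) (by simp) (by simp)
      · obtain rfl : δ = α := by simpa [hα, sub_eq_zero] using h2
        refine key (β / δ - 1) 1 δ ?_ ?_ ?_ ?_ <;> field_simp <;> ring
    · refine key ((δ - α) / γ - 1) 1 (δ - γ) ?_ ?_ ?_ ?_ <;> field_simp <;>
        first | ring1 | linear_combination γ * h2
  · rintro ⟨t, ht⟩
    have h : ∀ i, eval (pt4 p) (A i) = eval t (G i) := fun i => by rw [ht, hAB]
    simp only [h, G, V, W]
    constructor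
    · simp; ring
    · simp; ring

open MvPolynomial in
/-- A subset of `ℂ⁴` given, in suitable polynomial coordinates `A` on `ℂ⁴`, as the set of
singular `2 × 2` matrices with a fixed trace has dimension 2. -/
theorem dim4_of_singular_matrix_coords (S : Set ((ℂ × ℂ) × (ℂ × ℂ))) (δ : ℂ)
    (A B : Fin 4 → MvPolynomial (Fin 4) ℂ)
    (hAB : ∀ m i, eval (fun j => eval m (B j)) (A i) = m i)
    (hBA : ∀ m i, eval (fun j => eval m (A j)) (B i) = m i)
    (hS : ∀ p, p ∈ S ↔ eval (pt4 p) (A 0) + eval (pt4 p) (A 3) = δ ∧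
      eval (pt4 p) (A 0) * eval (pt4 p) (A 3) = eval (pt4 p) (A 1) * eval (pt4 p) (A 2)) :
    dim4 S = 2 := by
  let R := MvPolynomial (Fin 4) ℂ ⧸ vanIdeal4 S
  let π : MvPolynomial (Fin 4) ℂ →ₐ[ℂ] R := Ideal.Quotient.mkₐ ℂ (vanIdeal4 S)
  let g : MvPolynomial (Fin 2) ℂ →ₐ[ℂ] R := π.comp (bind₁ ![A 0, A 1 + A 2])
  have hg : Function.Injective g := by
    refine (injective_iff_map_eq_zero g).2 fun f hf => MvPolynomial.funext fun t => ?_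
    obtain ⟨r, hr⟩ := IsAlgClosed.exists_pow_nat_eq (t 1 ^ 2 - 4 * (t 0 * (δ - t 0))) two_pos
    let m : Fin 4 → ℂ := ![t 0, (t 1 + r) / 2, (t 1 - r) / 2, δ - t 0]
    obtain ⟨p, hp⟩ := exists_pt4_eq fun i => eval m (B i)
    have hm : ∀ i, eval (pt4 p) (A i) = m i := fun i => by rw [hp, hAB]
    have hpS : p ∈ S := by
      rw [hS]
      simp only [hm, m]
      constructor
      · simp
      · simp
        linear_combination (1 / 4) * hr
    have hf' : bind₁ ![A 0, A 1 + A 2] f ∈ vanIdeal4 S := Ideal.Quotient.eq_zero_iff_mem.1 hf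
    have h0 : eval (pt4 p) (bind₁ ![A 0, A 1 + A 2] f) = 0 := hf' p hpS
    rw [eval_bind₁] at h0
    rw [map_zero, ← h0]
    congr 2
    ext i
    fin_cases i
    · simp [hm, m]
    · simp [hm, m]
      ring
  have hrel (P : MvPolynomial (Fin 4) ℂ) (hP : ∀ p ∈ S, eval (pt4 p) P = 0) : π P = 0 :=
    Ideal.Quotient.eq_zero_iff_mem.2 hP
  have hsum : π (A 0) + π (A 3) = algebraMap ℂ R δ := by
    rw [← sub_eq_zero, ← AlgHom.commutes π, ← map_add, ← map_sub]
    refine hrel _ fun p hp => ?_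
    simp [((hS p).1 hp).1]
  have hmul : π (A 0) * π (A 3) = π (A 1) * π (A 2) := by
    rw [← sub_eq_zero, ← map_mul, ← map_mul, ← map_sub]
    refine hrel _ fun p hp => ?_
    simp [((hS p).1 hp).2]
  algebraize [g.toRingHom]
  have hg0 : algebraMap (MvPolynomial (Fin 2) ℂ) R (X 0) = π (A 0) := by
    change π (bind₁ _ _) = _
    simp
  have hg1 : algebraMap (MvPolynomial (Fin 2) ℂ) R (X 1) = π (A 1) + π (A 2) := by
    change π (bind₁ _ _) = _
    simp
  have hgC (c : ℂ) : algebraMap (MvPolynomial (Fin 2) ℂ) R (C c) = algebraMap ℂ R c :=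
    g.commutes c
  have hA : ∀ i, IsIntegral (MvPolynomial (Fin 2) ℂ) (π (A i)) := by
    have h0 : IsIntegral (MvPolynomial (Fin 2) ℂ) (π (A 0)) := hg0 ▸ isIntegral_algebraMap
    have h12 : IsIntegral (MvPolynomial (Fin 2) ℂ) (π (A 1) + π (A 2)) :=
      hg1 ▸ isIntegral_algebraMap
    have hδ : IsIntegral (MvPolynomial (Fin 2) ℂ) (algebraMap ℂ R δ) :=
      hgC δ ▸ isIntegral_algebraMap
    have h3 : IsIntegral (MvPolynomial (Fin 2) ℂ) (π (A 3)) := by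
      rw [eq_sub_of_add_eq' hsum]
      exact hδ.sub h0
    have h1 : IsIntegral (MvPolynomial (Fin 2) ℂ) (π (A 1)) := by
      refine ⟨Polynomial.X ^ 2 + (Polynomial.C (-X 1) * Polynomial.X +
        Polynomial.C (X 0 * (C δ - X 0))), ?_, ?_⟩
      · exact Polynomial.monic_X_pow_add
          (lt_of_le_of_lt Polynomial.degree_linear_le (by norm_num))
      · simp only [Polynomial.eval₂_add, Polynomial.eval₂_pow, Polynomial.eval₂_X,
          Polynomial.eval₂_mul, Polynomial.eval₂_C, Polynomial.eval₂_neg,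
          Polynomial.eval₂_sub, map_neg, map_mul, map_sub, hg0, hg1, hgC]
        linear_combination -π (A 0) * hsum + hmul
    have h2 : IsIntegral (MvPolynomial (Fin 2) ℂ) (π (A 2)) := by
      simpa using h12.sub h1
    intro i
    fin_cases i
    exacts [h0, h1, h2, h3]
  have : Algebra.IsIntegral (MvPolynomial (Fin 2) ℂ) R := by
    refine ⟨fun x => ?_⟩
    obtain ⟨f, rfl⟩ := Ideal.Quotient.mkₐ_surjective ℂ (vanIdeal4 S) x
    change IsIntegral _ (π f)
    have hf : f = bind₁ A (bind₁ B f) := MvPolynomial.funext fun m => by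
      simp only [eval_bind₁, hBA]
    rw [hf]
    generalize bind₁ B f = f'
    induction f' using MvPolynomial.induction_on with
    | C c =>
      rw [bind₁_C_right, ← MvPolynomial.algebraMap_eq, AlgHom.commutes, ← hgC]
      exact isIntegral_algebraMap
    | add a b ha hb =>
      rw [map_add, map_add]
      exact ha.add hb
    | mul_X a i ha =>
      rw [map_mul, map_mul, bind₁_X_right]
      exact ha.mul (hA i)
  have hdim : ringKrullDim R = ringKrullDim (MvPolynomial (Fin 2) ℂ) :=
    ringKrullDim_eq_of_isIntegral_of_injective hg
  change ringKrullDim R = 2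
  rw [hdim, MvPolynomial.ringKrullDim_of_isNoetherianRing, ringKrullDim_eq_zero_of_field]
  simp

open MvPolynomial in
theorem exists_singular_matrix_coords (p1 p2 q1 q2 : ℂ × ℂ) (hne : sd p1 p2 ≠ sd q1 q2) :
    ∃ A B : Fin 4 → MvPolynomial (Fin 4) ℂ,
      (∀ m i, eval (fun j => eval m (B j)) (A i) = m i) ∧
      (∀ m i, eval (fun j => eval m (A j)) (B i) = m i) ∧
      ∀ p, p ∈ Gamma2 p1 p2 q1 q2 ↔
        eval (pt4 p) (A 0) + eval (pt4 p) (A 3) = sd p1 p2 - sd q1 q2 ∧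
        eval (pt4 p) (A 0) * eval (pt4 p) (A 3) =
          eval (pt4 p) (A 1) * eval (pt4 p) (A 2) := by
  obtain ⟨p11, p12⟩ := p1
  obtain ⟨p21, p22⟩ := p2
  obtain ⟨q11, q12⟩ := q1
  obtain ⟨q21, q22⟩ := q2
  have hI : Complex.I ^ 2 = -1 := Complex.I_sq
  set J : ℂ := Complex.I
  obtain ⟨a, ha⟩ : ∃ a, a = (p21 - p11) - J * (p22 - p12) := ⟨_, rfl⟩
  obtain ⟨b, hb⟩ : ∃ b, b = (p21 - p11) + J * (p22 - p12) := ⟨_, rfl⟩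
  obtain ⟨c, hc⟩ : ∃ c, c = (q21 - q11) - J * (q22 - q12) := ⟨_, rfl⟩
  obtain ⟨e, he⟩ : ∃ e, e = (q21 - q11) + J * (q22 - q12) := ⟨_, rfl⟩
  have hδ : sd (p11, p12) (p21, p22) - sd (q11, q12) (q21, q22) = a * b - c * e := by
    simp only [sd, ha, hb, hc, he]
    linear_combination ((p22 - p12) ^ 2 - (q22 - q12) ^ 2) * hI
  have hδ0 : a * b - c * e ≠ 0 := hδ ▸ sub_ne_zero.2 hne
  obtain ⟨k, hk⟩ : ∃ k, k * (a * b - c * e) = 1 := ⟨_, inv_mul_cancel₀ hδ0⟩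
  let u : MvPolynomial (Fin 4) ℂ := (X 0 - C p11) + C J * (X 1 - C p12)
  let v : MvPolynomial (Fin 4) ℂ := (X 0 - C p11) - C J * (X 1 - C p12)
  let w : MvPolynomial (Fin 4) ℂ := (X 2 - C q11) + C J * (X 3 - C q12)
  let z : MvPolynomial (Fin 4) ℂ := (X 2 - C q11) - C J * (X 3 - C q12)
  let u' : MvPolynomial (Fin 4) ℂ := C k * (C b * X 0 + C c * X 1)
  let v' : MvPolynomial (Fin 4) ℂ := C k * (C e * X 2 + C a * X 3)
  let w' : MvPolynomial (Fin 4) ℂ := C k * (C e * X 0 + C a * X 1)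
  let z' : MvPolynomial (Fin 4) ℂ := C k * (C b * X 2 + C c * X 3)
  refine ⟨![C a * u - C c * w, C b * w - C e * u, C a * z - C c * v, C b * v - C e * z],
    ![C p11 + C (1 / 2) * (u' + v'), C p12 - C (J / 2) * (u' - v'),
      C q11 + C (1 / 2) * (w' + z'), C q12 - C (J / 2) * (w' - z')], ?_, ?_, ?_⟩
  · intro m i
    fin_cases i <;> simp [u, v, w, z, u', v', w', z']
    · linear_combination m 0 * hk - 1 / 2 * (a * (k * (b * m 0 + c * m 1) - k * (e * m 2 + a * m 3)) -
        c * (k * (e * m 0 + a * m 1) - k * (b * m 2 + c * m 3))) * hI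
    · linear_combination m 1 * hk - 1 / 2 * (b * (k * (e * m 0 + a * m 1) - k * (b * m 2 + c * m 3)) -
        e * (k * (b * m 0 + c * m 1) - k * (e * m 2 + a * m 3))) * hI
    · linear_combination m 2 * hk + 1 / 2 * (a * (k * (e * m 0 + a * m 1) - k * (b * m 2 + c * m 3)) -
        c * (k * (b * m 0 + c * m 1) - k * (e * m 2 + a * m 3))) * hI
    · linear_combination m 3 * hk + 1 / 2 * (b * (k * (b * m 0 + c * m 1) - k * (e * m 2 + a * m 3)) -
        e * (k * (e * m 0 + a * m 1) - k * (b * m 2 + c * m 3))) * hI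
  · intro m i
    fin_cases i <;> simp [u, v, w, z, u', v', w', z']
    · linear_combination (m 0 - p11) * hk
    · linear_combination -J ^ 2 * (m 1 - p12) * hk - (m 1 - p12) * hI
    · linear_combination (m 2 - q11) * hk
    · linear_combination -J ^ 2 * (m 3 - q12) * hk - (m 3 - q12) * hI
  · rintro ⟨⟨x1, x2⟩, ⟨y1, y2⟩⟩
    rw [hδ]
    simp [u, v, w, z, Gamma2, sd, pt4]
    subst ha hb hc he
    let δ := (p21 - p11 - J * (p22 - p12)) * (p21 - p11 + J * (p22 - p12)) -
      (q21 - q11 - J * (q22 - q12)) * (q21 - q11 + J * (q22 - q12))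
    constructor
    · rintro ⟨h1, h2⟩
      constructor
      · linear_combination h1 - h2 + ((p22 - p12) ^ 2 - 2 * (x2 - p12) * (p22 - p12) -
        (q22 - q12) ^ 2 + 2 * (y2 - q12) * (q22 - q12)) * hI
      · linear_combination δ * h1 - δ * ((x2 - p12) ^ 2 - (y2 - q12) ^ 2) * hI
    · rintro ⟨hT, hD⟩
      have h1 : (x1 - p11) ^ 2 + (x2 - p12) ^ 2 = (y1 - q11) ^ 2 + (y2 - q12) ^ 2 := by
        linear_combination k * hD + k * δ * ((x2 - p12) ^ 2 - (y2 - q12) ^ 2) * hI -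
          ((x1 - p11) ^ 2 + (x2 - p12) ^ 2 - (y1 - q11) ^ 2 - (y2 - q12) ^ 2) * hk
      refine ⟨h1, ?_⟩
      linear_combination h1 - hT + ((p22 - p12) ^ 2 - 2 * (x2 - p12) * (p22 - p12) -
        (q22 - q12) ^ 2 + 2 * (y2 - q12) * (q22 - q12)) * hI

/-- If `p₁ ≠ p₂` and `d(p₁, p₂) ≠ d(q₁, q₂)`, then `Γ` is
irreducible of dimension 2. -/
theorem gamma_two_points_distinct_lengths (p1 p2 q1 q2 : ℂ × ℂ)
    (hp : p1 ≠ p2) (hne : sd p1 p2 ≠ sd q1 q2) :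
    IsIrr4 (Gamma2 p1 p2 q1 q2) ∧ dim4 (Gamma2 p1 p2 q1 q2) = 2 := by
  obtain ⟨A, B, hAB, hBA, hS⟩ := exists_singular_matrix_coords p1 p2 q1 q2 hne
  exact ⟨isIrr4_of_singular_matrix_coords _ _ A B hAB hBA hS,
    dim4_of_singular_matrix_coords _ _ A B hAB hBA hS⟩
end

section
/- Let p₁,p₂,p₃,q₁,q₂,q₃ ∈ ℂ² be such that p₁,p₂,p₃ are not collinear (the vectors p₂−p₁ and p₃−p₁ are linearly independent over ℂ), d(p₁,p₂) = d(q₁,q₂) ≠ 0, d(p₁,p₃) ≠ d(q₁,q₃), and d(p₂,p₃) ≠ d(q₂,q₃). Define Γ := {(p₀,q₀) ∈ ℂ² × ℂ² : d(p₀,p_w) = d(q₀,q_w) for w = 1,2,3} and Γ' := {(p₀,q₀) ∈ Γ : there exists t ∈ T with t(p₀) = q₀, t(p₁) = q₁ and t(p₂) = q₂}. Then Γ' is irreducible and dim Γ = dim Γ' = 1, where subsets of ℂ² × ℂ² are regarded as subsets of ℂ⁴. -/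
/-- `Γ` for three base points: pairs `(p₀, q₀)` with `d(p₀, p_w) = d(q₀, q_w)`
for `w = 1, 2, 3`. -/
def Gamma3 (p1 p2 p3 q1 q2 q3 : ℂ × ℂ) : Set ((ℂ × ℂ) × (ℂ × ℂ)) :=
  {pq | sd pq.1 p1 = sd pq.2 q1 ∧ sd pq.1 p2 = sd pq.2 q2 ∧
    sd pq.1 p3 = sd pq.2 q3}

/-- `Γ'`: the pairs in `Γ` for which some transformation `t ∈ T` sends
`(p₀, p₁, p₂)` to `(q₀, q₁, q₂)`. -/
def Gamma3' (p1 p2 p3 q1 q2 q3 : ℂ × ℂ) : Set ((ℂ × ℂ) × (ℂ × ℂ)) :=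
  {pq ∈ Gamma3 p1 p2 p3 q1 q2 q3 |
    ∃ t, IsTransf t ∧ t pq.1 = pq.2 ∧ t p1 = q1 ∧ t p2 = q2}

/-- `S ⊆ ℂ⁴` is an affine line. -/
def IsLine4 (S : Set ((ℂ × ℂ) × (ℂ × ℂ))) : Prop :=
  ∃ a b : Fin 4 → ℂ, b ≠ 0 ∧ ∀ p, p ∈ S ↔ ∃ r : ℂ, pt4 p = a + r • b

theorem pt4_surjective : Function.Surjective pt4 := fun v =>
  ⟨((v 0, v 1), (v 2, v 3)), by ext i; fin_cases i <;> rfl⟩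

open Polynomial in
/-- The coordinate ring of an affine line in `ℂ⁴` is `ℂ[X]`. -/
theorem IsLine4.nonempty_ringEquiv {S : Set ((ℂ × ℂ) × (ℂ × ℂ))} (hS : IsLine4 S) :
    Nonempty ((MvPolynomial (Fin 4) ℂ ⧸ vanIdeal4 S) ≃+* ℂ[X]) := by
  obtain ⟨a, b, hb, hS⟩ := hS
  let φ : MvPolynomial (Fin 4) ℂ →ₐ[ℂ] ℂ[X] :=
    MvPolynomial.aeval fun i => C (a i) + C (b i) * X
  have hφ : ∀ (f : MvPolynomial (Fin 4) ℂ) (r : ℂ),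
      (φ f).eval r = MvPolynomial.eval (a + r • b) f := by
    intro f r
    have h : (Polynomial.aeval r).comp φ = MvPolynomial.aeval (a + r • b) := by
      ext i
      simp only [φ, AlgHom.comp_apply, MvPolynomial.aeval_X, map_add, map_mul,
        Polynomial.aeval_X, Polynomial.aeval_C, Algebra.algebraMap_self, RingHom.id_apply,
        Pi.add_apply, Pi.smul_apply, smul_eq_mul, mul_comm]
    have h' := DFunLike.congr_fun h f
    simpa [Polynomial.coe_aeval_eq_eval, MvPolynomial.aeval_eq_eval] using h'
  have hker : vanIdeal4 S = RingHom.ker φ := by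
    ext f
    rw [RingHom.mem_ker]
    constructor
    · intro hf
      refine Polynomial.funext fun r => ?_
      obtain ⟨p, hp⟩ := pt4_surjective (a + r • b)
      rw [hφ, ← hp, hf p ((hS p).2 ⟨r, hp⟩), Polynomial.eval_zero]
    · intro hf p hp
      obtain ⟨r, hr⟩ := (hS p).1 hp
      rw [hr, ← hφ, hf, Polynomial.eval_zero]
  have hsurj : Function.Surjective φ := by
    obtain ⟨i, hi⟩ := Function.ne_iff.1 hb
    have hi : b i ≠ 0 := hi
    rw [← AlgHom.range_eq_top, eq_top_iff, ← Polynomial.adjoin_X, Algebra.adjoin_le_iff,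
      Set.singleton_subset_iff]
    refine ⟨MvPolynomial.C (b i)⁻¹ * (MvPolynomial.X i - MvPolynomial.C (a i)), ?_⟩
    have hC : ∀ z : ℂ, φ (MvPolynomial.C z) = C z := fun z => φ.commutes z
    have hX : φ (MvPolynomial.X i) = C (a i) + C (b i) * X := MvPolynomial.aeval_X _ _
    change φ _ = _
    rw [map_mul, map_sub, hC, hC, hX, add_sub_cancel_left, ← mul_assoc, ← C_mul,
      inv_mul_cancel₀ hi, C_1, one_mul]
  exact ⟨(Ideal.quotEquivOfEq hker).trans
    (RingHom.quotientKerEquivOfSurjective (f := (φ : MvPolynomial (Fin 4) ℂ →+* ℂ[X])) hsurj)⟩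

theorem IsLine4.dim4_eq_one {S : Set ((ℂ × ℂ) × (ℂ × ℂ))} (hS : IsLine4 S) : dim4 S = 1 := by
  obtain ⟨e⟩ := hS.nonempty_ringEquiv
  exact (ringKrullDim_eq_of_ringEquiv e).trans
    (IsPrincipalIdealRing.ringKrullDim_eq_one _ (Polynomial.not_isField ℂ))

theorem IsLine4.isIrr4 {S : Set ((ℂ × ℂ) × (ℂ × ℂ))} (hS : IsLine4 S) : IsIrr4 S := by
  obtain ⟨e⟩ := hS.nonempty_ringEquiv
  exact (Ideal.Quotient.isDomain_iff_prime _).1 (e.toMulEquiv.isDomain _)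

/-- The part over `d(p, p₃) = d(q, q₃)` of the graph of the affine map `p ↦ q` with matrix
`!![a, b; c, d]` taking `p₁` to `q₁`. -/
def isometryGraph (a b c d : ℂ) (p1 p3 q1 q3 : ℂ × ℂ) : Set ((ℂ × ℂ) × (ℂ × ℂ)) :=
  {pq | pq.2.1 - q1.1 = a * (pq.1.1 - p1.1) + b * (pq.1.2 - p1.2) ∧
    pq.2.2 - q1.2 = c * (pq.1.1 - p1.1) + d * (pq.1.2 - p1.2) ∧ sd pq.1 p3 = sd pq.2 q3}

/-- A nondegenerate linear equation in the plane has a line of solutions. -/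
theorem exists_linear_solution (m n k : ℂ) (h : m ≠ 0 ∨ n ≠ 0) :
    ∃ x0 y0 : ℂ, ∀ x y : ℂ, m * x + n * y = k ↔ ∃ r, x = x0 + r * -n ∧ y = y0 + r * m := by
  rcases h with h | h
  · refine ⟨k / m, 0, fun x y => ⟨fun hxy => ⟨y / m, ?_, ?_⟩, ?_⟩⟩
    · field_simp
      linear_combination hxy
    · field_simp
      ring
    · rintro ⟨r, rfl, rfl⟩
      field_simp
      ring
  · refine ⟨0, k / n, fun x y => ⟨fun hxy => ⟨-x / n, ?_, ?_⟩, ?_⟩⟩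
    · field_simp
      ring
    · field_simp
      linear_combination hxy
    · rintro ⟨r, rfl, rfl⟩
      field_simp
      ring

/-- If the matrix `!![a, b; c, d]` is orthogonal and `d(p₁, p₃) ≠ d(q₁, q₃)`, then the quadratic
terms of `d(p, p₃) = d(q, q₃)` cancel on the graph and a nontrivial linear equation remains. -/
theorem isLine4_isometryGraph {a b c d : ℂ} {p1 p3 q1 q3 : ℂ × ℂ}
    (h1 : a ^ 2 + c ^ 2 = 1) (h2 : b ^ 2 + d ^ 2 = 1) (h3 : a * b + c * d = 0)
    (h : sd p1 p3 ≠ sd q1 q3) : IsLine4 (isometryGraph a b c d p1 p3 q1 q3) := by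
  have hdet : (a * d - b * c) ^ 2 = 1 := by
    linear_combination (b ^ 2 + d ^ 2) * h1 + h2 - (a * b + c * d) * h3
  obtain ⟨w1, hw1⟩ : ∃ w, w = p3.1 - p1.1 := ⟨_, rfl⟩
  obtain ⟨w2, hw2⟩ : ∃ w, w = p3.2 - p1.2 := ⟨_, rfl⟩
  obtain ⟨z1, hz1⟩ : ∃ w, w = q3.1 - q1.1 := ⟨_, rfl⟩
  obtain ⟨z2, hz2⟩ : ∃ w, w = q3.2 - q1.2 := ⟨_, rfl⟩
  obtain ⟨m, hm⟩ : ∃ m, m = 2 * (a * z1 + c * z2 - w1) := ⟨_, rfl⟩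
  obtain ⟨n, hn⟩ : ∃ n, n = 2 * (b * z1 + d * z2 - w2) := ⟨_, rfl⟩
  have hmn : m ≠ 0 ∨ n ≠ 0 := by
    by_contra! hmn
    obtain ⟨hm0, hn0⟩ := hmn
    apply h
    have e1 : w1 = a * z1 + c * z2 := by linear_combination -(1 / 2) * hm0 + (1 / 2) * hm
    have e2 : w2 = b * z1 + d * z2 := by linear_combination -(1 / 2) * hn0 + (1 / 2) * hn
    have ha : a = d * (a * d - b * c) := by linear_combination b * h3 - a * h2
    have hb : b = -c * (a * d - b * c) := by linear_combination a * h3 - b * h1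
    have h4 : a ^ 2 + b ^ 2 = 1 := by
      linear_combination (a + d * (a * d - b * c)) * ha + d ^ 2 * hdet + h2
    have h5 : c ^ 2 + d ^ 2 = 1 := by linear_combination h1 + h2 - h4
    have h6 : a * c + b * d = 0 := by linear_combination c * ha + d * hb
    have : w1 ^ 2 + w2 ^ 2 = z1 ^ 2 + z2 ^ 2 := by
      rw [e1, e2]
      linear_combination z1 ^ 2 * h4 + z2 ^ 2 * h5 + 2 * z1 * z2 * h6
    rw [hw1, hw2, hz1, hz2] at this
    simp only [sd]
    linear_combination this
  obtain ⟨x0, y0, hxy⟩ := exists_linear_solution m n (z1 ^ 2 + z2 ^ 2 - w1 ^ 2 - w2 ^ 2) hmn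
  refine ⟨![p1.1 + x0, p1.2 + y0, q1.1 + a * x0 + b * y0, q1.2 + c * x0 + d * y0],
    ![-n, m, -a * n + b * m, -c * n + d * m], ?_, ?_⟩
  · intro hb
    rcases hmn with hm | hn
    · exact hm (congr_fun hb 1)
    · exact hn (neg_eq_zero.1 (congr_fun hb 0))
  · rintro ⟨⟨x, y⟩, ⟨x', y'⟩⟩
    have hsd : x' - q1.1 = a * (x - p1.1) + b * (y - p1.2) →
        y' - q1.2 = c * (x - p1.1) + d * (y - p1.2) →
        (sd (x, y) p3 = sd (x', y') q3 ↔ m * (x - p1.1) + n * (y - p1.2) =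
          z1 ^ 2 + z2 ^ 2 - w1 ^ 2 - w2 ^ 2) := by
      intro e1 e2
      have : sd (x, y) p3 - sd (x', y') q3 = m * (x - p1.1) + n * (y - p1.2) -
          (z1 ^ 2 + z2 ^ 2 - w1 ^ 2 - w2 ^ 2) := by
        have e1' : x' = q1.1 + (a * (x - p1.1) + b * (y - p1.2)) := by linear_combination e1
        have e2' : y' = q1.2 + (c * (x - p1.1) + d * (y - p1.2)) := by linear_combination e2
        simp only [sd]
        rw [e1', e2', hm, hn, hw1, hw2, hz1, hz2]
        linear_combination -(x - p1.1) ^ 2 * h1 - (y - p1.2) ^ 2 * h2 -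
          2 * (x - p1.1) * (y - p1.2) * h3
      rw [← sub_eq_zero, this, sub_eq_zero]
    constructor
    · rintro ⟨e1, e2, e3⟩
      dsimp only at e1 e2 e3
      obtain ⟨r, hr1, hr2⟩ := (hxy _ _).1 ((hsd e1 e2).1 e3)
      refine ⟨r, ?_⟩
      ext i
      fin_cases i <;> simp [pt4]
      · linear_combination hr1
      · linear_combination hr2
      · linear_combination e1 + a * hr1 + b * hr2
      · linear_combination e2 + c * hr1 + d * hr2
    · rintro ⟨r, hr⟩
      have g0 : x = p1.1 + x0 + r * -n := congr_fun hr 0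
      have g1 : y = p1.2 + y0 + r * m := congr_fun hr 1
      have g2 : x' = q1.1 + a * x0 + b * y0 + r * (-a * n + b * m) := congr_fun hr 2
      have g3 : y' = q1.2 + c * x0 + d * y0 + r * (-c * n + d * m) := congr_fun hr 3
      have e1 : x' - q1.1 = a * (x - p1.1) + b * (y - p1.2) := by
        linear_combination g2 - a * g0 - b * g1
      have e2 : y' - q1.2 = c * (x - p1.1) + d * (y - p1.2) := by
        linear_combination g3 - c * g0 - d * g1
      exact ⟨e1, e2, (hsd e1 e2).2 ((hxy _ _).2
        ⟨r, by linear_combination g0, by linear_combination g1⟩)⟩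

/-- A plane vector is determined by its dot and cross products with a non-isotropic vector. -/
theorem eq_of_dot_of_cross {f1 f2 y1 y2 z1 z2 : ℂ} (hf : f1 ^ 2 + f2 ^ 2 ≠ 0)
    (hdot : y1 * f1 + y2 * f2 = z1 * f1 + z2 * f2)
    (hcross : y1 * f2 - y2 * f1 = z1 * f2 - z2 * f1) : y1 = z1 ∧ y2 = z2 :=
  ⟨mul_left_cancel₀ hf (by linear_combination f1 * hdot + f2 * hcross),
    mul_left_cancel₀ hf (by linear_combination f2 * hdot - f1 * hcross)⟩

/-- If `p₁, p₂, p₃` are not collinear,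
`d(p₁, p₂) = d(q₁, q₂) ≠ 0`, `d(p₁, p₃) ≠ d(q₁, q₃)` and
`d(p₂, p₃) ≠ d(q₂, q₃)`, then `Γ'` is irreducible and `dim Γ = dim Γ' = 1`. -/
theorem gamma_three_points_one_equal_length (p1 p2 p3 q1 q2 q3 : ℂ × ℂ)
    (hcol : LinearIndependent ℂ ![p2 - p1, p3 - p1])
    (h12 : sd p1 p2 = sd q1 q2) (h12ne : sd p1 p2 ≠ 0)
    (h13 : sd p1 p3 ≠ sd q1 q3)
    (h23 : sd p2 p3 ≠ sd q2 q3) :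
    IsIrr4 (Gamma3' p1 p2 p3 q1 q2 q3) ∧
    dim4 (Gamma3 p1 p2 p3 q1 q2 q3) = 1 ∧
    dim4 (Gamma3' p1 p2 p3 q1 q2 q3) = 1 := by
  obtain ⟨e1, he1⟩ : ∃ w, w = p2.1 - p1.1 := ⟨_, rfl⟩
  obtain ⟨e2, he2⟩ : ∃ w, w = p2.2 - p1.2 := ⟨_, rfl⟩
  obtain ⟨f1, hf1⟩ : ∃ w, w = q2.1 - q1.1 := ⟨_, rfl⟩
  obtain ⟨f2, hf2⟩ : ∃ w, w = q2.2 - q1.2 := ⟨_, rfl⟩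
  have hE : e1 ^ 2 + e2 ^ 2 ≠ 0 := by
    rw [he1, he2]
    intro h
    exact h12ne (by simp only [sd]; linear_combination h)
  have hEF : f1 ^ 2 + f2 ^ 2 = e1 ^ 2 + e2 ^ 2 := by
    rw [he1, he2, hf1, hf2]
    simp only [sd] at h12
    linear_combination -h12
  have hF : f1 ^ 2 + f2 ^ 2 ≠ 0 := hEF ▸ hE
  -- the rotation and the reflection taking `p₂ - p₁` to `q₂ - q₁`
  obtain ⟨c, hc⟩ : ∃ c, c = (e1 * f1 + e2 * f2) / (e1 ^ 2 + e2 ^ 2) := ⟨_, rfl⟩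
  obtain ⟨s, hs⟩ : ∃ s, s = (e1 * f2 - e2 * f1) / (e1 ^ 2 + e2 ^ 2) := ⟨_, rfl⟩
  obtain ⟨c', hc'⟩ : ∃ c', c' = (e1 * f1 - e2 * f2) / (e1 ^ 2 + e2 ^ 2) := ⟨_, rfl⟩
  obtain ⟨s', hs'⟩ : ∃ s', s' = (e2 * f1 + e1 * f2) / (e1 ^ 2 + e2 ^ 2) := ⟨_, rfl⟩
  have hc : c * (e1 ^ 2 + e2 ^ 2) = e1 * f1 + e2 * f2 := by rw [hc, div_mul_cancel₀ _ hE]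
  have hs : s * (e1 ^ 2 + e2 ^ 2) = e1 * f2 - e2 * f1 := by rw [hs, div_mul_cancel₀ _ hE]
  have hc' : c' * (e1 ^ 2 + e2 ^ 2) = e1 * f1 - e2 * f2 := by rw [hc', div_mul_cancel₀ _ hE]
  have hs' : s' * (e1 ^ 2 + e2 ^ 2) = e2 * f1 + e1 * f2 := by rw [hs', div_mul_cancel₀ _ hE]
  have hf1c : c * e1 - s * e2 = f1 :=
    mul_left_cancel₀ hE (by linear_combination e1 * hc - e2 * hs)
  have hf2c : s * e1 + c * e2 = f2 :=
    mul_left_cancel₀ hE (by linear_combination e1 * hs + e2 * hc)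
  have hf1c' : c' * e1 + s' * e2 = f1 :=
    mul_left_cancel₀ hE (by linear_combination e1 * hc' + e2 * hs')
  have hf2c' : s' * e1 - c' * e2 = f2 :=
    mul_left_cancel₀ hE (by linear_combination e1 * hs' - e2 * hc')
  have hcs : c ^ 2 + s ^ 2 = 1 := mul_left_cancel₀ hE (by
    linear_combination hEF + (c * e1 - s * e2 + f1) * hf1c + (s * e1 + c * e2 + f2) * hf2c)
  have hcs' : c' ^ 2 + s' ^ 2 = 1 := mul_left_cancel₀ hE (by
    linear_combination hEF + (c' * e1 + s' * e2 + f1) * hf1c' + (s' * e1 - c' * e2 + f2) * hf2c')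
  have hmem : ∀ {a b d k : ℂ}, a ^ 2 + d ^ 2 = 1 → b ^ 2 + k ^ 2 = 1 → a * b + d * k = 0 →
      a * e1 + b * e2 = f1 → d * e1 + k * e2 = f2 →
      isometryGraph a b d k p1 p3 q1 q3 ⊆ Gamma3 p1 p2 p3 q1 q2 q3 := by
    rintro a b d k h1 h2 h3 h4 h5 ⟨⟨x, y⟩, ⟨x', y'⟩⟩ ⟨g1, g2, g3⟩
    dsimp only at g1 g2
    refine ⟨?_, ?_, g3⟩
    · simp only [sd]
      rw [g1, g2]
      linear_combination -(x - p1.1) ^ 2 * h1 - (y - p1.2) ^ 2 * h2 -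
          2 * (x - p1.1) * (y - p1.2) * h3
    · have g1' : x' - q2.1 = a * (x - p2.1) + b * (y - p2.2) := by
        linear_combination g1 + h4 - a * he1 - b * he2 + hf1
      have g2' : y' - q2.2 = d * (x - p2.1) + k * (y - p2.2) := by
        linear_combination g2 + h5 - d * he1 - k * he2 + hf2
      simp only [sd]
      rw [g1', g2']
      linear_combination -(x - p2.1) ^ 2 * h1 - (y - p2.2) ^ 2 * h2 -
          2 * (x - p2.1) * (y - p2.2) * h3
  have hrot : isometryGraph c (-s) s c p1 p3 q1 q3 ⊆ Gamma3 p1 p2 p3 q1 q2 q3 :=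
    hmem hcs (by linear_combination hcs) (by ring) (by linear_combination hf1c) hf2c
  have hrefl : isometryGraph c' s' s' (-c') p1 p3 q1 q3 ⊆ Gamma3 p1 p2 p3 q1 q2 q3 :=
    hmem hcs' (by linear_combination hcs') (by ring) hf1c' (by linear_combination hf2c')
  have hΓ' : Gamma3' p1 p2 p3 q1 q2 q3 = isometryGraph c (-s) s c p1 p3 q1 q3 := by
    apply Set.Subset.antisymm
    · rintro ⟨⟨x, y⟩, ⟨x', y'⟩⟩ ⟨⟨-, -, g3⟩, t, ⟨a, b, u, v, -, ht⟩, t0, t1, t2⟩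
      rw [ht, Prod.ext_iff] at t0 t1 t2
      obtain ⟨t01, t02⟩ := t0
      obtain ⟨t11, t12⟩ := t1
      obtain ⟨t21, t22⟩ := t2
      dsimp only at t01 t02 t11 t12 t21 t22
      have k1 : a * e1 - b * e2 = f1 := by
        linear_combination t21 - t11 + a * he1 - b * he2 - hf1
      have k2 : b * e1 + a * e2 = f2 := by
        linear_combination t22 - t12 + b * he1 + a * he2 - hf2
      have ha : a = c := mul_left_cancel₀ hE (by linear_combination e1 * k1 + e2 * k2 - hc)
      have hb : b = s := mul_left_cancel₀ hE (by linear_combination e1 * k2 - e2 * k1 - hs)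
      subst ha hb
      refine ⟨?_, ?_, g3⟩
      · linear_combination t11 - t01
      · linear_combination t12 - t02
    · intro p hp
      refine ⟨hrot hp, fun x => (c * x.1 - s * x.2 + (q1.1 - c * p1.1 + s * p1.2),
        s * x.1 + c * x.2 + (q1.2 - s * p1.1 - c * p1.2)), ⟨c, s, _, _, hcs, fun x => rfl⟩, ?_⟩
      obtain ⟨g1, g2, -⟩ := hp
      refine ⟨Prod.ext ?_ ?_, Prod.ext ?_ ?_, Prod.ext ?_ ?_⟩ <;> dsimp only
      · linear_combination -g1
      · linear_combination -g2
      · ring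
      · ring
      · linear_combination hf1c + hf1 - c * he1 + s * he2
      · linear_combination hf2c + hf2 - s * he1 - c * he2
  have hΓ : Gamma3 p1 p2 p3 q1 q2 q3 =
      isometryGraph c (-s) s c p1 p3 q1 q3 ∪ isometryGraph c' s' s' (-c') p1 p3 q1 q3 := by
    apply Set.Subset.antisymm
    · rintro ⟨⟨x, y⟩, ⟨x', y'⟩⟩ ⟨g1, g2, g3⟩
      simp only [sd] at g1 g2
      have hdot : (x' - q1.1) * f1 + (y' - q1.2) * f2 = (x - p1.1) * e1 + (y - p1.2) * e2 := by
        have : 2 * ((x' - q1.1) * f1 + (y' - q1.2) * f2) =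
            2 * ((x - p1.1) * e1 + (y - p1.2) * e2) := by
          rw [he1, he2, hf1, hf2] at *
          linear_combination g2 - g1 + hEF
        exact mul_left_cancel₀ two_ne_zero this
      have hcross : ((x' - q1.1) * f2 - (y' - q1.2) * f1) ^ 2 =
          ((x - p1.1) * e2 - (y - p1.2) * e1) ^ 2 := by
        linear_combination -(e1 ^ 2 + e2 ^ 2) * g1 +
          ((x' - q1.1) ^ 2 + (y' - q1.2) ^ 2) * hEF -
          ((x' - q1.1) * f1 + (y' - q1.2) * f2 + ((x - p1.1) * e1 + (y - p1.2) * e2)) * hdot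
      rcases sq_eq_sq_iff_eq_or_eq_neg.1 hcross with h | h
      · obtain ⟨k1, k2⟩ := eq_of_dot_of_cross (z1 := c * (x - p1.1) + -s * (y - p1.2))
          (z2 := s * (x - p1.1) + c * (y - p1.2)) hF
          (by rw [hdot, ← hf1c, ← hf2c]
              linear_combination -((x - p1.1) * e1 + (y - p1.2) * e2) * hcs)
          (by rw [h, ← hf1c, ← hf2c]
              linear_combination -((x - p1.1) * e2 - (y - p1.2) * e1) * hcs)
        exact Or.inl ⟨k1, k2, g3⟩
      · obtain ⟨k1, k2⟩ := eq_of_dot_of_cross (z1 := c' * (x - p1.1) + s' * (y - p1.2))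
          (z2 := s' * (x - p1.1) + -c' * (y - p1.2)) hF
          (by rw [hdot, ← hf1c', ← hf2c']
              linear_combination -((x - p1.1) * e1 + (y - p1.2) * e2) * hcs')
          (by rw [h, ← hf1c', ← hf2c']
              linear_combination ((x - p1.1) * e2 - (y - p1.2) * e1) * hcs')
        exact Or.inr ⟨k1, k2, g3⟩
    · exact Set.union_subset hrot hrefl
  have hL : IsLine4 (isometryGraph c (-s) s c p1 p3 q1 q3) :=
    isLine4_isometryGraph hcs (by linear_combination hcs) (by ring) h13
  have hL' : IsLine4 (isometryGraph c' s' s' (-c') p1 p3 q1 q3) :=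
    isLine4_isometryGraph hcs' (by linear_combination hcs') (by ring) h13
  rw [hΓ']
  refine ⟨hL.isIrr4, ?_, hL.dim4_eq_one⟩
  rw [hΓ, dim4, vanIdeal4_union, ringKrullDim_quotient_inf]
  exact (congr_arg₂ max hL.dim4_eq_one hL'.dim4_eq_one).trans (max_self 1)
end
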